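/- Let K be a totally real number field (r₂ = 0) of degree r₁ ≥ 1, let q > 1 and let χ be an even, nonprincipal, primitive Dirichlet character modulo q. Let ρ be real with ρ > r₁/2, and set θ := ρ + 1/4 − (2ρ+1)/(4(r₁+1)). Then, as the real variable x → ∞, (1/Γ(ρ+1)) Σ_{n ≤ x} (x² − n²)^ρ D_{K,χ}(n) = −(G(χ) √π γ₋₁(K))/(2q Γ(ρ+3/2)) · x^{1+2ρ} · Σ_{n=1}^{q−1} χ̄(n) log(2 sin(πn/q)) + O(x^{2θ}). -/

import Mathlib

open scoped Real Classical
open Filter Asymptotics NumberField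

/-- `f_K(n)`: the number of nonzero integral ideals of `𝓞 K` of absolute norm `n`. -/
noncomputable def idealCount (K : Type*) [Field K] [NumberField K] (n : ℕ) : ℕ :=
  Nat.card {I : Ideal (𝓞 K) // I ≠ ⊥ ∧ Ideal.absNorm I = n}

/-- `γ₋₁(K)`, the residue of the Dedekind zeta function of `K` at `s = 1`. -/
noncomputable def dedekindResidue (K : Type*) [Field K] [NumberField K] : ℝ :=
  2 ^ (NumberField.InfinitePlace.nrRealPlaces K + NumberField.InfinitePlace.nrComplexPlaces K) *
    π ^ (NumberField.InfinitePlace.nrComplexPlaces K) *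
    NumberField.Units.regulator K * NumberField.classNumber K /
    (NumberField.Units.torsionOrder K * Real.sqrt |(NumberField.discr K : ℝ)|)

/-- `D_{K,χ}(n) = ∑_{d ∣ n} f_K(d) χ(n/d)`. -/
noncomputable def DKchi (K : Type*) [Field K] [NumberField K] {q : ℕ}
    (χ : DirichletCharacter ℂ q) (n : ℕ) : ℂ :=
  ∑ d ∈ n.divisors, (idealCount K d : ℂ) * χ ((n / d : ℕ) : ZMod q)

/-- Gauss sum `G(χ) = ∑_{h=1}^{q-1} χ(h) e^{2πih/q}`. -/
noncomputable def gaussSum' {q : ℕ} (χ : DirichletCharacter ℂ q) : ℂ :=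
  ∑ h ∈ Finset.Ico 1 q, χ (h : ZMod q) * Complex.exp (2 * π * Complex.I * h / q)

open MeasureTheory

set_option linter.unusedSectionVars false

section GaussianPoisson

variable {ι : Type*} [Fintype ι]

/-- A Gaussian is summable over `ℤ^ι`. -/
lemma summable_exp_neg_sum_sq {c : ℝ} (hc : 0 < c) :
    Summable (fun m : ι → ℤ => Real.exp (-c * ∑ i, (m i : ℝ) ^ 2)) := by
  classical
  have h1 : Summable (fun n : ℤ => Real.exp (-c * (n : ℝ) ^ 2)) := by
    have := (summable_int_iff_summable_nat_and_neg
      (f := fun n : ℤ => Real.exp (-c * (n : ℝ) ^ 2))).2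
    have hn : Summable (fun n : ℕ => Real.exp (-c * (n : ℝ) ^ 2)) := by
      refine Summable.of_nonneg_of_le (fun _ => (Real.exp_pos _).le) (fun n => ?_)
        (Real.summable_exp_nat_mul_iff.2 (show -c < 0 by linarith))
      apply Real.exp_le_exp.2
      have : (n : ℝ) ≤ (n : ℝ) ^ 2 := by exact_mod_cast Nat.le_self_pow two_ne_zero n
      nlinarith
    exact this ⟨by simpa using hn, by simpa using hn⟩
  refine summable_of_sum_le (c := ∏ _i : ι, ∑' n : ℤ, Real.exp (-c * (n : ℝ) ^ 2))
    (fun _ => (Real.exp_pos _).le) (fun s => ?_)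
  let t : ι → Finset ℤ := fun i => s.image (fun m => m i)
  have hst : s ⊆ Fintype.piFinset t := fun m hm =>
    Fintype.mem_piFinset.2 fun i => Finset.mem_image_of_mem _ hm
  calc ∑ m ∈ s, Real.exp (-c * ∑ i, (m i : ℝ) ^ 2)
      ≤ ∑ m ∈ Fintype.piFinset t, Real.exp (-c * ∑ i, (m i : ℝ) ^ 2) :=
        Finset.sum_le_sum_of_subset_of_nonneg hst fun _ _ _ => (Real.exp_pos _).le
    _ = ∑ m ∈ Fintype.piFinset t, ∏ i, Real.exp (-c * (m i : ℝ) ^ 2) := by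
        refine Finset.sum_congr rfl fun m _ => ?_
        rw [Finset.mul_sum, Real.exp_sum]
    _ = ∏ i, ∑ n ∈ t i, Real.exp (-c * (n : ℝ) ^ 2) :=
        (Finset.prod_univ_sum t (fun _ n => Real.exp (-c * (n : ℝ) ^ 2))).symm
    _ ≤ _ := Finset.prod_le_prod (fun _ _ => Finset.sum_nonneg fun _ _ => (Real.exp_pos _).le)
        fun i _ => h1.sum_le_tsum _ fun _ _ => (Real.exp_pos _).le

/-- An invertible matrix is bounded below. -/
lemma exists_pos_mul_sum_sq_le [DecidableEq ι] {A B : Matrix ι ι ℝ} (hAB : B * A = 1) :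
    ∃ c : ℝ, 0 < c ∧ ∀ x : ι → ℝ, c * ∑ i, x i ^ 2 ≤ ∑ i, (A.mulVec x i) ^ 2 := by
  set M : ℝ := ∑ i, ∑ j, B i j ^ 2 with hM
  have hM0 : 0 ≤ M := Finset.sum_nonneg fun _ _ => Finset.sum_nonneg fun _ _ => sq_nonneg _
  have key : ∀ x : ι → ℝ, ∑ i, x i ^ 2 ≤ M * ∑ i, (A.mulVec x i) ^ 2 := by
    intro x
    have hx : x = B.mulVec (A.mulVec x) := by simp [hAB]
    calc ∑ i, x i ^ 2 = ∑ i, (∑ j, B i j * A.mulVec x j) ^ 2 := by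
          refine Finset.sum_congr rfl fun i _ => ?_
          conv_lhs => rw [hx]
          rfl
      _ ≤ ∑ i, (∑ j, B i j ^ 2) * ∑ j, (A.mulVec x j) ^ 2 :=
          Finset.sum_le_sum fun i _ => Finset.sum_mul_sq_le_sq_mul_sq _ _ _
      _ = _ := by rw [Finset.sum_mul]
  refine ⟨(M + 1)⁻¹, by positivity, fun x => ?_⟩
  rw [inv_mul_le_iff₀ (by positivity)]
  have : 0 ≤ ∑ i, (A.mulVec x i) ^ 2 := Finset.sum_nonneg fun _ _ => sq_nonneg _
  nlinarith [key x]

/-- The Gaussian `exp (-π |A x|²)`. -/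
noncomputable def matGaussian (A : Matrix ι ι ℝ) (x : ι → ℝ) : ℝ :=
  Real.exp (-π * ∑ i, (A.mulVec x i) ^ 2)

lemma continuous_matGaussian (A : Matrix ι ι ℝ) : Continuous (matGaussian A) := by
  unfold matGaussian Matrix.mulVec dotProduct
  fun_prop

lemma summable_matGaussian_int [DecidableEq ι] {A B : Matrix ι ι ℝ} (hAB : B * A = 1) :
    Summable (fun m : ι → ℤ => matGaussian A (fun i => (m i : ℝ))) := by
  obtain ⟨c, hc, h⟩ := exists_pos_mul_sum_sq_le hAB
  refine Summable.of_nonneg_of_le (fun _ => (Real.exp_pos _).le) (fun m => ?_)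
    (summable_exp_neg_sum_sq (ι := ι) (show 0 < π * c by positivity))
  apply Real.exp_le_exp.2
  have := h (fun i => (m i : ℝ))
  nlinarith [Real.pi_pos]

lemma summable_bound_matGaussian_translate [DecidableEq ι] {A B : Matrix ι ι ℝ} (hAB : B * A = 1)
    (R : ℝ) : ∃ u : (ι → ℤ) → ℝ, Summable u ∧ ∀ m : ι → ℤ, ∀ x : ι → ℝ, (∑ i, x i ^ 2 ≤ R) →
      matGaussian A (fun i => x i + m i) ≤ u m := by
  obtain ⟨c, hc, h⟩ := exists_pos_mul_sum_sq_le hAB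
  refine ⟨fun m => Real.exp (π * c * R) * Real.exp (-(π * c / 2) * ∑ i, (m i : ℝ) ^ 2),
    (summable_exp_neg_sum_sq (by positivity)).mul_left _, fun m x hx => ?_⟩
  simp only [matGaussian]
  rw [← Real.exp_add]
  apply Real.exp_le_exp.2
  have h1 := h (fun i => x i + m i)
  have h2 : ∑ i, (m i : ℝ) ^ 2 / 2 - ∑ i, x i ^ 2 ≤ ∑ i, (x i + m i) ^ 2 := by
    rw [← Finset.sum_sub_distrib]
    exact Finset.sum_le_sum fun i _ => by nlinarith [sq_nonneg ((m i : ℝ) + 2 * x i)]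
  rw [← Finset.sum_div] at h2
  have h3 : π * (c * ∑ i, (x i + m i) ^ 2) ≤ π * ∑ i, (A.mulVec (fun i => x i + m i) i) ^ 2 :=
    mul_le_mul_of_nonneg_left h1 Real.pi_pos.le
  have h4 : π * c * (∑ i, (m i : ℝ) ^ 2 / 2 - R) ≤ π * c * ∑ i, (x i + m i) ^ 2 := by
    apply mul_le_mul_of_nonneg_left _ (by positivity)
    rw [← Finset.sum_div]
    linarith
  rw [← Finset.sum_div] at h4
  nlinarith

/-- The periodisation of the Gaussian `exp (-π |A x|²)`. -/
noncomputable def perGaussian (A : Matrix ι ι ℝ) (x : ι → ℝ) : ℂ :=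
  ∑' m : ι → ℤ, (matGaussian A (fun i => x i + m i) : ℂ)

lemma continuous_perGaussian [DecidableEq ι] {A B : Matrix ι ι ℝ} (hAB : B * A = 1) :
    Continuous (perGaussian A) := by
  rw [continuous_iff_continuousAt]
  intro x₀
  obtain ⟨u, hu, h⟩ := summable_bound_matGaussian_translate hAB (∑ i, x₀ i ^ 2 + 1)
  have hopen : IsOpen {x : ι → ℝ | ∑ i, x i ^ 2 < ∑ i, x₀ i ^ 2 + 1} :=
    isOpen_lt (by fun_prop) (by fun_prop)
  have hx₀ : x₀ ∈ {x : ι → ℝ | ∑ i, x i ^ 2 < ∑ i, x₀ i ^ 2 + 1} := by simp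
  refine ContinuousOn.continuousAt (s := {x : ι → ℝ | ∑ i, x i ^ 2 < ∑ i, x₀ i ^ 2 + 1}) ?_
    (hopen.mem_nhds hx₀)
  refine continuousOn_tsum (fun m => ?_) hu (fun m x hx => ?_)
  · refine (Complex.continuous_ofReal.comp ((continuous_matGaussian A).comp ?_)).continuousOn
    fun_prop
  · rw [Complex.norm_real, Real.norm_eq_abs,
      abs_of_pos (show 0 < matGaussian A _ from Real.exp_pos _)]
    exact h m x (le_of_lt hx)

lemma perGaussian_add_int (A : Matrix ι ι ℝ) (x : ι → ℝ) (k : ι → ℤ) :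
    perGaussian A (fun i => x i + k i) = perGaussian A x := by
  unfold perGaussian
  rw [← (Equiv.addLeft k).tsum_eq (fun m : ι → ℤ => (matGaussian A (fun i => x i + m i) : ℂ))]
  refine tsum_congr fun m => ?_
  congr 2
  funext i
  simp
  ring

lemma isOpenQuotientMap_coe_torus {ι : Type*} :
    IsOpenQuotientMap (fun x : ι → ℝ => (fun i => (x i : AddCircle (1 : ℝ)) : UnitAddTorus ι)) :=
  IsOpenQuotientMap.piMap (f := fun (_ : ι) (x : ℝ) => (x : AddCircle (1 : ℝ)))
    fun _ => QuotientAddGroup.isOpenQuotientMap_mk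

/-- The periodised Gaussian as a continuous function on the torus. -/
lemma exists_torus_perGaussian [DecidableEq ι] {A B : Matrix ι ι ℝ} (hAB : B * A = 1) :
    ∃ P : C(UnitAddTorus ι, ℂ), ∀ x : ι → ℝ, P (fun i => (x i : AddCircle (1 : ℝ))) =
      perGaussian A x := by
  let P : UnitAddTorus ι → ℂ := fun z => perGaussian A
    (Function.surjInv (isOpenQuotientMap_coe_torus (ι := ι)).surjective z)
  have hP : ∀ x : ι → ℝ, P (fun i => (x i : AddCircle (1 : ℝ))) = perGaussian A x := by
    intro x
    have h := Function.surjInv_eq (isOpenQuotientMap_coe_torus (ι := ι)).surjective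
      (fun i => (x i : AddCircle (1 : ℝ)))
    set y := Function.surjInv (isOpenQuotientMap_coe_torus (ι := ι)).surjective
      (fun i => (x i : AddCircle (1 : ℝ))) with hy
    have h' : ∀ i, ∃ k : ℤ, y i = x i + k := by
      intro i
      have hi : ((y i : ℝ) : AddCircle (1 : ℝ)) = (x i : AddCircle (1 : ℝ)) := congrFun h i
      have hi' : ((y i - x i : ℝ) : AddCircle (1 : ℝ)) = 0 := by
        rw [AddCircle.coe_sub, hi, sub_self]
      obtain ⟨k, hk⟩ := (AddCircle.coe_eq_zero_iff (1 : ℝ)).1 hi'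
      exact ⟨k, by simp at hk; linarith⟩
    choose k hk using h'
    have : y = fun i => x i + k i := funext hk
    change perGaussian A y = _
    rw [this, perGaussian_add_int]
  refine ⟨⟨P, ?_⟩, hP⟩
  rw [(isOpenQuotientMap_coe_torus (ι := ι)).isQuotientMap.continuous_iff]
  have : P ∘ (fun x : ι → ℝ => (fun i => (x i : AddCircle (1 : ℝ)) : UnitAddTorus ι)) =
      perGaussian A := funext hP
  rw [this]
  exact continuous_perGaussian hAB

lemma integral_gaussian_fourier [DecidableEq ι] {A B : Matrix ι ι ℝ} (hAB : A.transpose * B = 1)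
    (n : ι → ℝ) :
    ∫ x : ι → ℝ, Complex.exp (-2 * π * Complex.I * ∑ i, (n i : ℂ) * x i) * (matGaussian A x : ℂ) =
      (|A.det|⁻¹ : ℝ) * (matGaussian B n : ℂ) := by
  have hdet : A.det ≠ 0 := by
    intro h
    have := congrArg Matrix.det hAB
    rw [Matrix.det_mul, Matrix.det_transpose, h] at this
    simp at this
  let g : (ι → ℝ) → ℂ := fun y =>
    Complex.exp (-∑ i, (π : ℂ) * (y i : ℂ) ^ 2 +
      ∑ i, (-2 * π * Complex.I * (B.mulVec n i : ℂ)) * (y i : ℂ))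
  have hBA : B * A.transpose = 1 := mul_eq_one_comm.1 hAB
  have hg : ∀ x : ι → ℝ,
      Complex.exp (-2 * π * Complex.I * ∑ i, (n i : ℂ) * x i) * (matGaussian A x : ℂ) =
        g (A.toLin' x) := by
    intro x
    simp only [g, matGaussian, Matrix.toLin'_apply]
    push_cast
    rw [← Complex.exp_add]
    congr 1
    have h1 : ∑ i, B.mulVec n i * A.mulVec x i = ∑ i, n i * x i := by
      change B.mulVec n ⬝ᵥ A.mulVec x = n ⬝ᵥ x
      rw [Matrix.dotProduct_mulVec, ← Matrix.mulVec_transpose, Matrix.mulVec_mulVec, hAB,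
        Matrix.one_mulVec]
    have h2 : ∑ i, (n i : ℂ) * x i = ∑ i, (B.mulVec n i : ℂ) * (A.mulVec x i : ℂ) := by
      exact_mod_cast h1.symm
    rw [h2, Finset.mul_sum, Finset.mul_sum, add_comm, ← Finset.sum_neg_distrib]
    congr 1
    · exact Finset.sum_congr rfl fun i _ => by ring
    · exact Finset.sum_congr rfl fun i _ => by ring
  simp_rw [hg]
  have hdet' : LinearMap.det A.toLin' ≠ 0 := by rwa [LinearMap.det_toLin']
  have hgc : Continuous g := by fun_prop
  have hmap := Measure.map_linearMap_addHaar_eq_smul_addHaar (volume : Measure (ι → ℝ)) hdet'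
  have h3 : ∫ x : ι → ℝ, g (A.toLin' x) = ∫ y, g y ∂(Measure.map (A.toLin') volume) :=
    (integral_map (by fun_prop) hgc.aestronglyMeasurable).symm
  rw [h3, hmap, integral_smul_measure, ENNReal.toReal_ofReal (abs_nonneg _), LinearMap.det_toLin',
    abs_inv, Complex.real_smul]
  congr 1
  have := GaussianFourier.integral_cexp_neg_sum_mul_add (ι := ι) (b := fun _ => (π : ℂ))
    (fun _ => by simpa using Real.pi_pos) (fun i => -2 * π * Complex.I * (B.mulVec n i : ℂ))
  simp only [g]
  rw [this, matGaussian]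
  push_cast
  have hpi : (π : ℂ) ≠ 0 := by exact_mod_cast Real.pi_ne_zero
  simp only [div_self hpi, Complex.one_cpow, one_mul]
  rw [← Complex.exp_sum, Finset.mul_sum]
  congr 1
  refine Finset.sum_congr rfl fun i _ => ?_
  field_simp
  rw [Complex.I_sq]
  ring

lemma integrable_matGaussian [DecidableEq ι] {A B : Matrix ι ι ℝ} (hAB : A.transpose * B = 1) :
    Integrable (matGaussian A) := by
  have hBA : B.transpose * A = 1 := by
    have := congrArg Matrix.transpose hAB
    simpa using this
  obtain ⟨c, hc, h⟩ := exists_pos_mul_sum_sq_le hBA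
  have h1 : Integrable (fun x : ι → ℝ => ∏ i, Real.exp (-(π * c) * x i ^ 2)) :=
    Integrable.fintype_prod (f := fun _ t => Real.exp (-(π * c) * t ^ 2))
      fun _ => integrable_exp_neg_mul_sq (by positivity)
  refine h1.mono' (continuous_matGaussian A).aestronglyMeasurable (ae_of_all _ fun x => ?_)
  rw [Real.norm_eq_abs, abs_of_pos (show 0 < matGaussian A _ from Real.exp_pos _),
    ← Real.exp_sum, ← Finset.mul_sum]
  apply Real.exp_le_exp.2
  nlinarith [h x, Real.pi_pos]

/-- Integrals over `ℝ^ι` as sums over unit boxes. -/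
lemma hasSum_integral_unitBox {E : Type*} [NormedAddCommGroup E] [NormedSpace ℝ E]
    {f : (ι → ℝ) → E} (hf : Integrable f) :
    HasSum (fun m : ι → ℤ => ∫ x in {x : ι → ℝ | ∀ i, x i ∈ Set.Ioc (0 : ℝ) (0 + 1)},
      f (fun i => x i + m i)) (∫ x, f x) := by
  let s : (ι → ℤ) → Set (ι → ℝ) := fun m => {x | ∀ i, x i ∈ Set.Ioc (m i : ℝ) (m i + 1)}
  have hs : ∀ m, MeasurableSet (s m) := by
    intro m
    have : s m = Set.univ.pi fun i => Set.Ioc (m i : ℝ) (m i + 1) := by ext; simp [s]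
    rw [this]
    exact MeasurableSet.univ_pi fun _ => measurableSet_Ioc
  have hU : ⋃ m, s m = Set.univ := by
    refine Set.eq_univ_of_forall fun x => Set.mem_iUnion.2 ⟨fun i => ⌈x i⌉ - 1, fun i => ?_⟩
    push_cast
    constructor
    · linarith [Int.ceil_lt_add_one (x i)]
    · linarith [Int.le_ceil (x i)]
  have hd : Pairwise (Function.onFun Disjoint s) := by
    intro m k hmk
    refine Set.disjoint_left.2 fun x hx hx' => hmk (funext fun i => ?_)
    have h1 := hx i
    have h2 := hx' i
    have e1 : ⌈x i⌉ = m i + 1 := by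
      rw [Int.ceil_eq_iff]; push_cast; exact ⟨by linarith [h1.1], h1.2⟩
    have e2 : ⌈x i⌉ = k i + 1 := by
      rw [Int.ceil_eq_iff]; push_cast; exact ⟨by linarith [h2.1], h2.2⟩
    omega
  have := hasSum_integral_iUnion hs hd (f := f) (μ := volume) (by rw [hU]; exact hf.integrableOn)
  rw [hU, setIntegral_univ] at this
  have he : ∀ m : ι → ℤ, ∫ x in {x : ι → ℝ | ∀ i, x i ∈ Set.Ioc (0 : ℝ) (0 + 1)},
      f (fun i => x i + m i) = ∫ x in s m, f x := fun m => ?_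
  · simpa only [he] using this
  rw [← (measurePreserving_add_right volume (fun i => (m i : ℝ))).setIntegral_preimage_emb
    (measurableEmbedding_addRight _) f (s m)]
  have : (fun x : ι → ℝ => x + fun i => (m i : ℝ)) ⁻¹' s m =
      {x : ι → ℝ | ∀ i, x i ∈ Set.Ioc (0 : ℝ) (0 + 1)} := by
    ext x
    simp only [s, Set.mem_preimage, Set.mem_ofPred_eq, Set.mem_Ioc, Pi.add_apply]
    refine forall_congr' fun i => ?_
    constructor <;> rintro ⟨h1, h2⟩ <;> constructor <;> linarith
  rw [this]
  rfl

/-- Poisson summation for a Gaussian attached to an invertible matrix. -/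
theorem tsum_matGaussian [DecidableEq ι] {A B : Matrix ι ι ℝ} (hAB : A.transpose * B = 1) :
    ∑' m : ι → ℤ, matGaussian A (fun i => (m i : ℝ)) =
      |A.det|⁻¹ * ∑' m : ι → ℤ, matGaussian B (fun i => (m i : ℝ)) := by
  have hBA : B.transpose * A = 1 := by
    have := congrArg Matrix.transpose hAB
    simpa using this
  obtain ⟨P, hP⟩ := exists_torus_perGaussian hBA
  have hAB' : A.transpose * B = 1 := hAB
  have hcoef : ∀ n : ι → ℤ, UnitAddTorus.mFourierCoeff P n =
      (|A.det|⁻¹ : ℝ) * (matGaussian B (fun i => (n i : ℝ)) : ℂ) := by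
    intro n
    rw [UnitAddTorus.mFourierCoeff_eq_integral _ _ (fun _ => 0), ← integral_gaussian_fourier hAB]
    let F : (ι → ℝ) → ℂ := fun x =>
      Complex.exp (-2 * π * Complex.I * ∑ i, ((n i : ℝ) : ℂ) * x i) * (matGaussian A x : ℂ)
    have hnorm : ∀ x, ‖F x‖ = matGaussian A x := by
      intro x
      have h1 : -2 * π * Complex.I * ∑ i, ((n i : ℝ) : ℂ) * x i =
          ((-2 * π * ∑ i, (n i : ℝ) * x i : ℝ) : ℂ) * Complex.I := by
        push_cast; ring
      simp only [F]
      rw [norm_mul, h1, Complex.norm_exp_ofReal_mul_I, one_mul, Complex.norm_real,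
        Real.norm_eq_abs, abs_of_pos (show 0 < matGaussian A _ from Real.exp_pos _)]
    have hFc : Continuous F := by
      have := continuous_matGaussian A
      fun_prop
    have hF : Integrable F := (integrable_matGaussian hAB).mono' hFc.aestronglyMeasurable
      (ae_of_all _ fun x => (hnorm x).le)
    have h1 := hasSum_integral_unitBox hF
    have h2 := hasSum_integral_unitBox hF.norm
    change _ = ∫ x, F x
    rw [← h1.tsum_eq]
    have h3 := hasSum_integral_of_summable_integral_norm
      (μ := volume.restrict {x : ι → ℝ | ∀ i, x i ∈ Set.Ioc (0 : ℝ) (0 + 1)})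
      (F := fun (m : ι → ℤ) (x : ι → ℝ) => F (fun i => x i + m i)) ?_ ?_
    · rw [h3.tsum_eq]
      refine integral_congr_ae (ae_of_all _ fun x => ?_)
      simp only [smul_eq_mul]
      rw [hP, perGaussian, ← tsum_mul_left]
      refine tsum_congr fun m => ?_
      simp only [F]
      congr 1
      have h5 : (UnitAddTorus.mFourier (-n)) (fun i => (x i : AddCircle (1 : ℝ))) =
          Complex.exp (-2 * π * Complex.I * ∑ i, ((n i : ℝ) : ℂ) * x i) := by
        rw [UnitAddTorus.mFourier, ContinuousMap.coe_mk, Finset.mul_sum, Complex.exp_sum]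
        refine Finset.prod_congr rfl fun i _ => ?_
        rw [fourier_coe_apply]
        congr 1
        simp
        ring
      rw [h5]
      have h6 : -2 * π * Complex.I * ∑ i, ((n i : ℝ) : ℂ) * ((x i + m i : ℝ) : ℂ) =
          -2 * π * Complex.I * (∑ i, ((n i : ℝ) : ℂ) * x i) +
            ((-∑ i, n i * m i : ℤ) : ℂ) * (2 * π * Complex.I) := by
        push_cast
        simp only [mul_add, Finset.sum_add_distrib]
        ring
      rw [h6, Complex.exp_add, Complex.exp_int_mul_two_pi_mul_I, mul_one]
    · intro m
      refine Integrable.integrableOn ?_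
      exact hF.comp_add_right (fun i => (m i : ℝ))
    · exact h2.summable
  have hsum : Summable (UnitAddTorus.mFourierCoeff P) := by
    have : UnitAddTorus.mFourierCoeff P = fun n : ι → ℤ =>
      (|A.det|⁻¹ : ℝ) * (matGaussian B (fun i => (n i : ℝ)) : ℂ) := funext hcoef
    rw [this]
    exact (Complex.ofRealCLM.summable (summable_matGaussian_int hAB)).mul_left _
  have h := (UnitAddTorus.hasSum_mFourier_series_apply_of_summable hsum 0).tsum_eq
  have h0 : P 0 = perGaussian A 0 := hP 0
  rw [h0] at h
  have h8 : perGaussian A 0 = ((∑' m : ι → ℤ, matGaussian A (fun i => (m i : ℝ)) : ℝ) : ℂ) := by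
    rw [Complex.ofReal_tsum, perGaussian]
    simp
  have h9 : ∀ n : ι → ℤ, UnitAddTorus.mFourier n (0 : UnitAddTorus ι) = 1 := by
    intro n
    simp [UnitAddTorus.mFourier]
  simp only [h9, hcoef, smul_eq_mul, mul_one] at h
  rw [h8, tsum_mul_left, ← Complex.ofReal_tsum] at h
  exact_mod_cast h.symm

end GaussianPoisson

section Theta

variable {ι : Type*} [Fintype ι]
  {V : Type*} [NormedAddCommGroup V] [NormedSpace ℝ V] [FiniteDimensional ℝ V]
  [MeasurableSpace V] [BorelSpace V]

/-- The Gaussian `exp (-π ∑ t ^ (1 / n) e ^ (2 h_w(v)) r_w)`. -/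
noncomputable def twGauss (H : V →ₗ[ℝ] ι → ℝ) (t : ℝ) (v : V) (r : ι → ℝ) : ℝ :=
  Real.exp (-π * ∑ w, t ^ (1 / Fintype.card ι : ℝ) * Real.exp (2 * H v w) * r w)

/-- The squared coordinates of the lattice vector `A m`. -/
def sqCoord (A : Matrix ι ι ℝ) (m : ι → ℤ) (w : ι) : ℝ := (A.mulVec (fun i => (m i : ℝ)) w) ^ 2

/-- The integral of `twGauss` over `D`. -/
noncomputable def thetaTerm (H : V →ₗ[ℝ] ι → ℝ) (D : Set V) (μ : Measure V) (t : ℝ)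
    (r : ι → ℝ) : ℝ := ∫ v in D, twGauss H t v r ∂μ

/-- The theta function of the lattice `A ℤ^n`, averaged over `D`. -/
noncomputable def latTheta (H : V →ₗ[ℝ] ι → ℝ) (D : Set V) (μ : Measure V) (A : Matrix ι ι ℝ)
    (t : ℝ) : ℝ := ∑' m : ι → ℤ, thetaTerm H D μ t (sqCoord A m)

lemma twGauss_pos (H : V →ₗ[ℝ] ι → ℝ) (t : ℝ) (v : V) (r : ι → ℝ) : 0 < twGauss H t v r :=
  Real.exp_pos _

lemma continuous_twGauss (H : V →ₗ[ℝ] ι → ℝ) (t : ℝ) (r : ι → ℝ) :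
    Continuous (fun v => twGauss H t v r) := by
  have h : Continuous H := H.continuous_of_finiteDimensional
  unfold twGauss
  fun_prop

lemma thetaTerm_nonneg (H : V →ₗ[ℝ] ι → ℝ) (D : Set V) (μ : Measure V) (t : ℝ) (r : ι → ℝ) :
    0 ≤ thetaTerm H D μ t r := integral_nonneg fun _ => (twGauss_pos ..).le

lemma exists_twGauss_le (H : V →ₗ[ℝ] ι → ℝ) {D : Set V} (hD : Bornology.IsBounded D)
    {A B : Matrix ι ι ℝ} (hAB : B * A = 1) :
    ∃ c > 0, ∀ t > 0, ∀ v ∈ D, ∀ m : ι → ℤ, twGauss H t v (sqCoord A m) ≤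
      Real.exp (-(c * t ^ (1 / Fintype.card ι : ℝ)) * ∑ i, (m i : ℝ) ^ 2) := by
  obtain ⟨c, hc, h⟩ := exists_pos_mul_sum_sq_le hAB
  have hcont : Continuous H := H.continuous_of_finiteDimensional
  obtain ⟨R, hR⟩ := hD.exists_norm_le
  obtain ⟨C, hC⟩ := (isCompact_closedBall (0 : V) R).exists_bound_of_continuousOn
    hcont.continuousOn
  refine ⟨π * (Real.exp (-2 * C) * c), by positivity, fun t ht v hv m => ?_⟩
  have h1 : ∀ w, Real.exp (-2 * C) ≤ Real.exp (2 * H v w) := fun w => by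
    have h2 := (norm_le_pi_norm (H v) w).trans (hC v (by simpa using hR v hv))
    rw [Real.norm_eq_abs, abs_le] at h2
    exact Real.exp_le_exp.2 (by linarith)
  apply Real.exp_le_exp.2
  have ht' : 0 < t ^ (1 / Fintype.card ι : ℝ) := Real.rpow_pos_of_pos ht _
  have h3 : ∑ w, t ^ (1 / Fintype.card ι : ℝ) * Real.exp (-2 * C) * sqCoord A m w ≤
      ∑ w, t ^ (1 / Fintype.card ι : ℝ) * Real.exp (2 * H v w) * sqCoord A m w :=
    Finset.sum_le_sum fun w _ => by
      refine mul_le_mul_of_nonneg_right (mul_le_mul_of_nonneg_left (h1 w) ht'.le) (sq_nonneg _)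
  rw [← Finset.mul_sum] at h3
  have h4 := mul_le_mul_of_nonneg_left (h (fun i => (m i : ℝ)))
    (show 0 ≤ t ^ (1 / Fintype.card ι : ℝ) * Real.exp (-2 * C) by positivity)
  have h5 := mul_le_mul_of_nonneg_left (h4.trans h3) Real.pi_pos.le
  nlinarith

lemma integrableOn_twGauss (H : V →ₗ[ℝ] ι → ℝ) {D : Set V} (hD : Bornology.IsBounded D)
    (μ : Measure V) [IsFiniteMeasureOnCompacts μ] (t : ℝ) (r : ι → ℝ) :
    IntegrableOn (fun v => twGauss H t v r) D μ :=
  ((continuous_twGauss H t r).locallyIntegrable.integrableOn_isCompact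
    hD.isCompact_closure).mono_set subset_closure

variable (H : V →ₗ[ℝ] ι → ℝ) {D : Set V} (μ : Measure V)
  [IsFiniteMeasureOnCompacts μ] {A B : Matrix ι ι ℝ}

lemma exists_thetaTerm_le (hD : Bornology.IsBounded D) (hDm : MeasurableSet D)
    (hAB : B * A = 1) :
    ∃ c > 0, ∀ t > 0, ∀ m : ι → ℤ, thetaTerm H D μ t (sqCoord A m) ≤
      μ.real D * Real.exp (-(c * t ^ (1 / Fintype.card ι : ℝ)) * ∑ i, (m i : ℝ) ^ 2) := by
  obtain ⟨c, hc, h⟩ := exists_twGauss_le H hD hAB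
  refine ⟨c, hc, fun t ht m => ?_⟩
  have hfin : μ D < ⊤ := hD.measure_lt_top
  refine (setIntegral_mono_on (integrableOn_twGauss H hD μ t _)
    (integrableOn_const hfin.ne) hDm fun v hv => h t ht v hv m).trans ?_
  simp

lemma summable_thetaTerm (hD : Bornology.IsBounded D) (hDm : MeasurableSet D)
    (hAB : B * A = 1) {t : ℝ} (ht : 0 < t) :
    Summable fun m : ι → ℤ => thetaTerm H D μ t (sqCoord A m) := by
  obtain ⟨c, hc, h⟩ := exists_thetaTerm_le H μ hD hDm hAB
  refine Summable.of_nonneg_of_le (fun _ => thetaTerm_nonneg ..) (h t ht)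
    ((summable_exp_neg_sum_sq ?_).mul_left _)
  have := Real.rpow_pos_of_pos ht (1 / Fintype.card ι : ℝ)
  positivity

lemma latTheta_eq_integral (hD : Bornology.IsBounded D) (hDm : MeasurableSet D)
    (hAB : B * A = 1) {t : ℝ} (ht : 0 < t) :
    latTheta H D μ A t = ∫ v in D, ∑' m : ι → ℤ, twGauss H t v (sqCoord A m) ∂μ := by
  refine (hasSum_integral_of_summable_integral_norm
    (F := fun (m : ι → ℤ) v => twGauss H t v (sqCoord A m))
    (fun m => integrableOn_twGauss H hD μ t _) ?_).tsum_eq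
  refine (summable_thetaTerm H μ hD hDm hAB ht).congr fun m => ?_
  exact integral_congr_ae (ae_of_all _ fun v => by simp [abs_of_pos (twGauss_pos H t v _)])

lemma tsum_twGauss_inv [Nonempty ι] (hsum : ∀ v, ∑ w, H v w = 0) (hAB : A.transpose * B = 1)
    {t : ℝ} (ht : 0 < t) (v : V) :
    ∑' m : ι → ℤ, twGauss H (1 / t) v (sqCoord A m) =
      |A.det|⁻¹ * t ^ (1 / 2 : ℝ) * ∑' m : ι → ℤ, twGauss (-H) t v (sqCoord B m) := by
  set N : ℝ := (Fintype.card ι : ℝ) with hN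
  have hN0 : N ≠ 0 := by simp [hN]
  set d : ι → ℝ := fun w => t ^ (-1 / (2 * N)) * Real.exp (H v w) with hd
  set d' : ι → ℝ := fun w => t ^ (1 / (2 * N)) * Real.exp (-H v w) with hd'
  have hdd : ∀ w, d w * d' w = 1 := fun w => by
    simp only [hd, hd']
    rw [mul_mul_mul_comm, ← Real.rpow_add ht, ← Real.exp_add]
    simp [neg_div]
  have h1 : (Matrix.diagonal d * A).transpose * (Matrix.diagonal d' * B) = 1 := by
    rw [Matrix.transpose_mul, Matrix.diagonal_transpose, Matrix.mul_assoc,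
      ← Matrix.mul_assoc (Matrix.diagonal d), Matrix.diagonal_mul_diagonal]
    simp [hdd, hAB]
  have h2 := tsum_matGaussian h1
  have e1 : ∀ m : ι → ℤ, matGaussian (Matrix.diagonal d * A) (fun i => (m i : ℝ)) =
      twGauss H (1 / t) v (sqCoord A m) := fun m => by
    simp only [matGaussian, twGauss, sqCoord]
    congr 2
    refine Finset.sum_congr rfl fun w _ => ?_
    rw [← Matrix.mulVec_mulVec, Matrix.mulVec_diagonal, mul_pow]
    congr 1
    simp only [hd, mul_pow, ← Real.exp_nat_mul, ← Real.rpow_mul_natCast ht.le]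
    rw [one_div, Real.inv_rpow ht.le, ← Real.rpow_neg ht.le]
    congr 2
    push_cast; field_simp; rw [hN]
  have e2 : ∀ m : ι → ℤ, matGaussian (Matrix.diagonal d' * B) (fun i => (m i : ℝ)) =
      twGauss (-H) t v (sqCoord B m) := fun m => by
    simp only [matGaussian, twGauss, sqCoord]
    congr 2
    refine Finset.sum_congr rfl fun w _ => ?_
    rw [← Matrix.mulVec_mulVec, Matrix.mulVec_diagonal, mul_pow]
    congr 1
    simp only [hd', mul_pow, ← Real.exp_nat_mul, ← Real.rpow_mul_natCast ht.le]
    congr 2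
    push_cast; field_simp; rw [hN]
  have hdet : |(Matrix.diagonal d * A).det|⁻¹ = |A.det|⁻¹ * t ^ (1 / 2 : ℝ) := by
    have : ∏ w, d w = t ^ (-(1 / 2) : ℝ) := by
      simp only [hd, Finset.prod_mul_distrib, ← Real.exp_sum, hsum, Finset.prod_const,
        Finset.card_univ, ← Real.rpow_mul_natCast ht.le, Real.exp_zero, mul_one]
      congr 1
      rw [← hN]; field_simp
    rw [Matrix.det_mul, Matrix.det_diagonal, this, abs_mul, mul_inv, Real.rpow_neg ht.le,
      abs_of_pos (by positivity), inv_inv, mul_comm]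
  simp only [e1, e2, hdet] at h2
  exact h2

lemma latTheta_inv [Nonempty ι] (hD : Bornology.IsBounded D) (hDm : MeasurableSet D)
    (hsum : ∀ v, ∑ w, H v w = 0) (hAB : A.transpose * B = 1)
    {t : ℝ} (ht : 0 < t) :
    latTheta H D μ A (1 / t) = |A.det|⁻¹ * t ^ (1 / 2 : ℝ) * latTheta (-H) D μ B t := by
  have h1 : B.transpose * A = 1 := by
    have := congrArg Matrix.transpose hAB
    simpa [Matrix.transpose_mul] using this
  have h2 : A.transpose * B = 1 := hAB
  rw [latTheta_eq_integral H μ hD hDm h1 (by positivity),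
    latTheta_eq_integral (-H) μ hD hDm h2 ht, ← integral_const_mul]
  exact integral_congr_ae (ae_of_all _ fun v => tsum_twGauss_inv H hsum hAB ht v)

lemma antitoneOn_latTheta (hD : Bornology.IsBounded D) (hDm : MeasurableSet D)
    (hAB : B * A = 1) :
    AntitoneOn (latTheta H D μ A) (Set.Ioi 0) := by
  intro s hs t ht hst
  refine (summable_thetaTerm H μ hD hDm hAB ht).tsum_le_tsum (fun m => ?_)
    (summable_thetaTerm H μ hD hDm hAB hs)
  refine integral_mono (integrableOn_twGauss H hD μ t _) (integrableOn_twGauss H hD μ s _)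
    fun v => Real.exp_le_exp.2 ?_
  have hs0 : (0 : ℝ) < s := hs
  have : ∑ w, s ^ (1 / Fintype.card ι : ℝ) * Real.exp (2 * H v w) * sqCoord A m w ≤
      ∑ w, t ^ (1 / Fintype.card ι : ℝ) * Real.exp (2 * H v w) * sqCoord A m w := by
    refine Finset.sum_le_sum fun w _ => ?_
    have h1 : s ^ (1 / Fintype.card ι : ℝ) ≤ t ^ (1 / Fintype.card ι : ℝ) :=
      Real.rpow_le_rpow hs0.le hst (by positivity)
    exact mul_le_mul_of_nonneg_right (mul_le_mul_of_nonneg_right h1 (Real.exp_pos _).le)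
      (sq_nonneg _)
  nlinarith [Real.pi_pos]

lemma AntitoneOn.locallyIntegrableOn_Ioi_zero {f : ℝ → ℝ} (hf : AntitoneOn f (Set.Ioi 0)) :
    LocallyIntegrableOn (fun t => (f t : ℂ)) (Set.Ioi 0) := by
  rw [locallyIntegrableOn_iff isOpen_Ioi.isLocallyClosed]
  intro k hk hkc
  exact (AntitoneOn.integrableOn_isCompact hkc (hf.mono hk)).ofReal

lemma thetaTerm_sqCoord_zero (t : ℝ) : thetaTerm H D μ t (sqCoord A 0) = μ.real D := by
  have : sqCoord A 0 = 0 := by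
    funext w
    simp only [sqCoord, Pi.zero_apply, Int.cast_zero]
    rw [show (fun _ : ι => (0 : ℝ)) = 0 from rfl, Matrix.mulVec_zero]
    simp
  simp [thetaTerm, twGauss, this]

lemma latTheta_sub_eq (hD : Bornology.IsBounded D) (hDm : MeasurableSet D)
    (hAB : B * A = 1) {t : ℝ} (ht : 0 < t) :
    latTheta H D μ A t - μ.real D =
      ∑' m : {m : ι → ℤ // m ≠ 0}, thetaTerm H D μ t (sqCoord A m) := by
  have h := summable_thetaTerm H μ hD hDm hAB ht
  have h0 := h.sum_add_tsum_subtype_compl ({0} : Finset (ι → ℤ))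
  simp only [Finset.sum_singleton, thetaTerm_sqCoord_zero] at h0
  rw [latTheta, ← h0, add_sub_cancel_left]
  exact (Equiv.subtypeEquivRight (fun m => by simp)).tsum_eq
    (fun m : {m : ι → ℤ // m ≠ 0} => thetaTerm H D μ t (sqCoord A m))

lemma isBigO_latTheta_sub [Nonempty ι] (hD : Bornology.IsBounded D) (hDm : MeasurableSet D)
    (hAB : B * A = 1) (r : ℝ) :
    (fun t => ((latTheta H D μ A t : ℝ) : ℂ) - (μ.real D : ℂ)) =O[atTop] (fun t : ℝ => t ^ r) := by
  obtain ⟨c, hc, h⟩ := exists_thetaTerm_le H μ hD hDm hAB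
  set N : ℝ := (Fintype.card ι : ℝ) with hN
  have hN0 : 0 < N := by simp [hN, Fintype.card_pos]
  set S := ∑' m : ι → ℤ, Real.exp (-(c / 2) * ∑ i, (m i : ℝ) ^ 2) with hS
  have hsum := summable_exp_neg_sum_sq (ι := ι) (half_pos hc)
  have hb : (fun t => ((latTheta H D μ A t : ℝ) : ℂ) - (μ.real D : ℂ)) =O[atTop]
      (fun t : ℝ => Real.exp (-(c / 2) * t ^ (1 / N))) := by
    refine IsBigO.of_bound (μ.real D * S) ?_
    filter_upwards [eventually_ge_atTop 1] with t ht
    have ht0 : 0 < t := by linarith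
    have hT : 1 ≤ t ^ (1 / N) := Real.one_le_rpow ht (by positivity)
    have hnn : ∀ m : {m : ι → ℤ // m ≠ 0}, 0 ≤ thetaTerm H D μ t (sqCoord A m) :=
      fun m => thetaTerm_nonneg ..
    rw [← Complex.ofReal_sub, Complex.norm_real, latTheta_sub_eq H μ hD hDm hAB ht0,
      Real.norm_of_nonneg (tsum_nonneg hnn), Real.norm_of_nonneg (Real.exp_pos _).le]
    have hs1 : Summable fun m : {m : ι → ℤ // m ≠ 0} =>
        Real.exp (-(c / 2) * ∑ i, ((m : ι → ℤ) i : ℝ) ^ 2) := hsum.subtype _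
    have hle : ∀ m : {m : ι → ℤ // m ≠ 0}, thetaTerm H D μ t (sqCoord A m) ≤
        μ.real D * Real.exp (-(c / 2) * t ^ (1 / N)) *
          Real.exp (-(c / 2) * ∑ i, ((m : ι → ℤ) i : ℝ) ^ 2) := fun m => by
      refine (h t ht0 m).trans ?_
      rw [mul_assoc, ← Real.exp_add]
      refine mul_le_mul_of_nonneg_left (Real.exp_le_exp.2 ?_) measureReal_nonneg
      have hm : (1 : ℝ) ≤ ∑ i, ((m : ι → ℤ) i : ℝ) ^ 2 := by
        obtain ⟨i, hi⟩ := Function.ne_iff.1 m.2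
        have h1 : (1 : ℝ) ≤ ((m : ι → ℤ) i : ℝ) ^ 2 := by
          have h3 : 0 < ((m : ι → ℤ) i) ^ 2 := sq_pos_iff.2 hi
          exact_mod_cast h3
        exact h1.trans (Finset.single_le_sum (f := fun i => ((m : ι → ℤ) i : ℝ) ^ 2)
          (fun _ _ => sq_nonneg _) (Finset.mem_univ i))
      nlinarith [mul_nonneg (sub_nonneg.2 hT) (sub_nonneg.2 hm)]
    calc _ ≤ ∑' m : {m : ι → ℤ // m ≠ 0}, μ.real D * Real.exp (-(c / 2) * t ^ (1 / N)) *
          Real.exp (-(c / 2) * ∑ i, ((m : ι → ℤ) i : ℝ) ^ 2) :=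
          (Summable.of_nonneg_of_le hnn hle (hs1.mul_left _)).tsum_le_tsum hle (hs1.mul_left _)
      _ = μ.real D * Real.exp (-(c / 2) * t ^ (1 / N)) *
          ∑' m : {m : ι → ℤ // m ≠ 0}, Real.exp (-(c / 2) * ∑ i, ((m : ι → ℤ) i : ℝ) ^ 2) :=
          tsum_mul_left
      _ ≤ μ.real D * Real.exp (-(c / 2) * t ^ (1 / N)) * S := by
          refine mul_le_mul_of_nonneg_left ?_ (by positivity)
          exact hsum.tsum_subtype_le _ {m | m ≠ 0} (fun _ => (Real.exp_pos _).le)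
      _ = _ := by ring
  refine hb.trans ?_
  have h1 := (isLittleO_exp_neg_mul_rpow_atTop (half_pos hc) (r * N)).isBigO.comp_tendsto
    (tendsto_rpow_atTop (show 0 < 1 / N by positivity))
  refine h1.trans (Eventually.isBigO ?_)
  filter_upwards [eventually_gt_atTop 0] with t ht
  simp only [Function.comp]
  rw [← Real.rpow_mul ht.le, show 1 / N * (r * N) = r by field_simp,
    Real.norm_of_nonneg (Real.rpow_nonneg ht.le _)]

/-- The functional equation pair attached to a lattice and its dual. -/
noncomputable def latFEPair [Nonempty ι] (hD : Bornology.IsBounded D) (hDm : MeasurableSet D)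
    (hsum : ∀ v, ∑ w, H v w = 0) (hAB : A.transpose * B = 1) : WeakFEPair ℂ where
  f t := latTheta H D μ A t
  g t := latTheta (-H) D μ B t
  k := 1 / 2
  ε := (|A.det|⁻¹ : ℝ)
  f₀ := μ.real D
  g₀ := μ.real D
  hf_int := (antitoneOn_latTheta H μ hD hDm (B := B.transpose) (by
    simpa [Matrix.transpose_mul] using congrArg Matrix.transpose hAB)).locallyIntegrableOn_Ioi_zero
  hg_int := (antitoneOn_latTheta (-H) μ hD hDm hAB).locallyIntegrableOn_Ioi_zero
  hk := by norm_num
  hε := by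
    have h : A.det ≠ 0 := fun h => by
      have := congrArg Matrix.det hAB
      simp [h] at this
    simpa using h
  h_feq t ht := by
    rw [latTheta_inv H μ hD hDm hsum hAB ht]
    push_cast
    rfl
  hf_top := isBigO_latTheta_sub H μ hD hDm (B := B.transpose) (by
    simpa [Matrix.transpose_mul] using congrArg Matrix.transpose hAB)
  hg_top := isBigO_latTheta_sub (-H) μ hD hDm hAB

end Theta

section ThetaMellin

open scoped ENNReal NNReal

lemma lintegral_Ioi_zero_eq_lintegral_exp (g : ℝ → ℝ≥0∞) :
    ∫⁻ t in Set.Ioi 0, g t = ∫⁻ x, ENNReal.ofReal (Real.exp x) * g (Real.exp x) := by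
  have h := lintegral_image_eq_lintegral_abs_deriv_mul (f := Real.exp) (f' := Real.exp)
    MeasurableSet.univ (fun x _ => (Real.hasDerivAt_exp x).hasDerivWithinAt)
    Real.exp_injective.injOn g
  rw [Set.image_univ, Real.range_exp] at h
  simpa [abs_of_pos (Real.exp_pos _)] using h

lemma lintegral_exp_mul_exp_neg {s r : ℝ} (hs : 0 < s) (hr : 0 < r) :
    ∫⁻ x : ℝ, ENNReal.ofReal (Real.exp (s * x) * Real.exp (-π * (Real.exp x * r))) =
      ENNReal.ofReal ((π * r) ^ (-s) * Real.Gamma s) := by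
  have hpr : 0 < π * r := by positivity
  have hfint : IntegrableOn (fun t : ℝ => t ^ (s - 1) * Real.exp (-(π * r * t))) (Set.Ioi 0) := by
    have := integrableOn_rpow_mul_exp_neg_mul_rpow (p := 1) (s := s - 1) (b := π * r)
      (by linarith) one_pos hpr
    simpa using this
  have h := Real.integral_rpow_mul_exp_neg_mul_Ioi hs hpr
  rw [one_div, Real.inv_rpow hpr.le, ← Real.rpow_neg hpr.le] at h
  rw [← h, ofReal_integral_eq_lintegral_ofReal hfint
    ((ae_restrict_iff' measurableSet_Ioi).2 (ae_of_all _ fun t ht => mul_nonneg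
      (Real.rpow_nonneg (le_of_lt ht) _) (Real.exp_pos _).le)),
    lintegral_Ioi_zero_eq_lintegral_exp]
  refine lintegral_congr fun x => ?_
  rw [← ENNReal.ofReal_mul (Real.exp_pos _).le, ← Real.exp_mul, ← Real.exp_add, ← Real.exp_add,
    ← Real.exp_add]
  congr 2
  ring

variable {ι : Type*} [Fintype ι]

lemma lintegral_pi_prod_exp {s : ℝ} {r : ι → ℝ} (hs : 0 < s) (hr : ∀ w, 0 < r w) :
    ∫⁻ x : ι → ℝ, ENNReal.ofReal (∏ w, Real.exp (s * x w) * Real.exp (-π * (Real.exp (x w) * r w)))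
      = ∏ w, ENNReal.ofReal ((π * r w) ^ (-s) * Real.Gamma s) := by
  have hf : ∀ w, Integrable
      (fun x : ℝ => Real.exp (s * x) * Real.exp (-π * (Real.exp x * r w))) := fun w => by
    refine ⟨by fun_prop, ?_⟩
    rw [hasFiniteIntegral_iff_ofReal (ae_of_all _ fun x => by positivity),
      lintegral_exp_mul_exp_neg hs (hr w)]
    exact ENNReal.ofReal_lt_top
  have h1 := Integrable.fintype_prod (μ := fun _ : ι => (volume : Measure ℝ)) hf
  rw [← volume_pi] at h1
  rw [← ofReal_integral_eq_lintegral_ofReal h1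
    (ae_of_all _ fun x => Finset.prod_nonneg fun w _ => by positivity), volume_pi,
    integral_fintype_prod_eq_prod
      (fun (w : ι) (x : ℝ) => Real.exp (s * x) * Real.exp (-π * (Real.exp x * r w))),
    ENNReal.ofReal_prod_of_nonneg fun w _ => integral_nonneg fun x => by positivity]
  refine Finset.prod_congr rfl fun w _ => ?_
  rw [ofReal_integral_eq_lintegral_ofReal (hf w) (ae_of_all _ fun x => by positivity),
    lintegral_exp_mul_exp_neg hs (hr w)]

variable {V : Type*} [NormedAddCommGroup V] [NormedSpace ℝ V] [FiniteDimensional ℝ V]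
  [MeasurableSpace V] [BorelSpace V]

/-- The coordinates `τ / n + 2 h_w(v)` on `ℝ × V`. -/
noncomputable def logCoord (H : V →ₗ[ℝ] ι → ℝ) : ℝ × V →ₗ[ℝ] ι → ℝ :=
  LinearMap.coprod (LinearMap.pi fun _ => (1 / Fintype.card ι : ℝ) • LinearMap.id) ((2 : ℝ) • H)

lemma logCoord_apply (H : V →ₗ[ℝ] ι → ℝ) (τ : ℝ) (v : V) (w : ι) :
    logCoord H (τ, v) w = τ / Fintype.card ι + 2 * H v w := by
  simp [logCoord]
  ring

lemma sum_logCoord [Nonempty ι] {H : V →ₗ[ℝ] ι → ℝ} (hsum : ∀ v, ∑ w, H v w = 0) (τ : ℝ) (v : V) :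
    ∑ w, logCoord H (τ, v) w = τ := by
  simp only [logCoord_apply, Finset.sum_add_distrib, ← Finset.mul_sum, hsum]
  simp
  field_simp

lemma logCoord_injective [Nonempty ι] {H : V →ₗ[ℝ] ι → ℝ} (hsum : ∀ v, ∑ w, H v w = 0)
    (hinj : Function.Injective H) : Function.Injective (logCoord H) := by
  rw [← LinearMap.ker_eq_bot, LinearMap.ker_eq_bot']
  rintro ⟨τ, v⟩ h
  have h1 := sum_logCoord hsum τ v
  rw [h] at h1
  simp only [Pi.zero_apply, Finset.sum_const_zero] at h1
  have h2 : H v = 0 := by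
    funext w
    have := congrFun h w
    rw [logCoord_apply, ← h1] at this
    simpa using this
  rw [(map_eq_zero_iff H hinj).1 h2, ← h1]
  rfl

lemma exists_lintegral_twGauss [Nonempty ι] {H : V →ₗ[ℝ] ι → ℝ} (hsum : ∀ v, ∑ w, H v w = 0)
    (hinj : Function.Injective H) (hdim : Module.finrank ℝ V + 1 = Fintype.card ι)
    (μ : Measure V) [μ.IsAddHaarMeasure] :
    ∃ c : ℝ≥0, c ≠ 0 ∧ ∀ (s : ℝ) (r : ι → ℝ), 0 < s → (∀ w, 0 < r w) →
      ∫⁻ t in Set.Ioi 0, ∫⁻ v, ENNReal.ofReal (t ^ (s - 1) * twGauss H t v r) ∂μ =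
        c * ∏ w, ENNReal.ofReal ((π * r w) ^ (-s) * Real.Gamma s) := by
  have hd : Module.finrank ℝ (ℝ × V) = Module.finrank ℝ (ι → ℝ) := by
    simp [← hdim, add_comm]
  let L : (ℝ × V) ≃L[ℝ] (ι → ℝ) :=
    (LinearEquiv.ofInjectiveOfFinrankEq (logCoord H) (logCoord_injective hsum hinj)
      hd).toContinuousLinearEquiv
  have hL : ∀ p, L p = logCoord H p := fun p => rfl
  have hmap := L.isAddHaarMeasure_map ((volume : Measure ℝ).prod μ)
  set c := Measure.addHaarScalarFactor (((volume : Measure ℝ).prod μ).map L)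
    (volume : Measure (ι → ℝ)) with hc
  have hc' : ((volume : Measure ℝ).prod μ).map L = c • (volume : Measure (ι → ℝ)) :=
    Measure.isAddLeftInvariant_eq_smul _ _
  refine ⟨c, (Measure.addHaarScalarFactor_pos_of_isAddHaarMeasure _ _).ne', fun s r hs hr => ?_⟩
  have hcH : Continuous H := H.continuous_of_finiteDimensional
  have hmeas : Measurable fun x : ι → ℝ => ENNReal.ofReal
      (∏ w, Real.exp (s * x w) * Real.exp (-π * (Real.exp (x w) * r w))) := by fun_prop
  have h1 : ∫⁻ x, ENNReal.ofReal (∏ w, Real.exp (s * x w) * Real.exp (-π * (Real.exp (x w) * r w)))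
      ∂(((volume : Measure ℝ).prod μ).map L) =
      c * ∏ w, ENNReal.ofReal ((π * r w) ^ (-s) * Real.Gamma s) := by
    rw [hc', lintegral_smul_measure, lintegral_pi_prod_exp hs hr]
    rfl
  rw [← h1, lintegral_map hmeas L.continuous.measurable,
    lintegral_prod (fun a : ℝ × V => ENNReal.ofReal
      (∏ w, Real.exp (s * L a w) * Real.exp (-π * (Real.exp (L a w) * r w))))
      (hmeas.comp L.continuous.measurable).aemeasurable,
    lintegral_Ioi_zero_eq_lintegral_exp]
  refine lintegral_congr fun τ => ?_
  rw [← lintegral_const_mul']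
  swap
  · exact ENNReal.ofReal_ne_top
  refine lintegral_congr fun v => ?_
  rw [← ENNReal.ofReal_mul (Real.exp_pos _).le, Finset.prod_mul_distrib, ← Real.exp_sum,
    ← Real.exp_sum, ← Finset.mul_sum]
  simp only [hL, sum_logCoord hsum]
  rw [twGauss, ← Finset.mul_sum, ← mul_assoc, ← Real.exp_mul, ← Real.exp_add]
  congr 3
  · ring
  · congr 1
    refine Finset.sum_congr rfl fun w _ => ?_
    rw [logCoord_apply, Real.exp_add, ← Real.exp_mul]
    congr 3
    ring

lemma twGauss_add (H : V →ₗ[ℝ] ι → ℝ) (t : ℝ) (v u : V) (r : ι → ℝ) :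
    twGauss H t v (fun w => Real.exp (2 * H u w) * r w) = twGauss H t (v + u) r := by
  simp only [twGauss]
  congr 2
  refine Finset.sum_congr rfl fun w _ => ?_
  rw [map_add, Pi.add_apply, mul_add, Real.exp_add]
  ring

lemma measurable_twGauss_uncurry (H : V →ₗ[ℝ] ι → ℝ) (r : ι → ℝ) :
    Measurable fun p : ℝ × V => twGauss H p.1 p.2 r := by
  have hcH : Continuous H := H.continuous_of_finiteDimensional
  have : Measurable fun p : ℝ × V => H p.2 := hcH.measurable.comp measurable_snd
  unfold twGauss
  fun_prop

lemma measurable_lintegral_twGauss (H : V →ₗ[ℝ] ι → ℝ) (μ : Measure V) [SFinite μ] (s : ℝ)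
    (r : ι → ℝ) :
    Measurable fun t : ℝ => ∫⁻ v, ENNReal.ofReal (t ^ (s - 1) * twGauss H t v r) ∂μ := by
  refine Measurable.lintegral_prod_right' (f := fun p : ℝ × V =>
    ENNReal.ofReal (p.1 ^ (s - 1) * twGauss H p.1 p.2 r)) ?_
  exact ((measurable_fst.pow_const _).mul (measurable_twGauss_uncurry H r)).ennreal_ofReal

lemma ofReal_thetaTerm (H : V →ₗ[ℝ] ι → ℝ) {D : Set V} (hD : Bornology.IsBounded D)
    (μ : Measure V) [IsFiniteMeasureOnCompacts μ] (t : ℝ) (r : ι → ℝ) :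
    ENNReal.ofReal (thetaTerm H D μ t r) = ∫⁻ v in D, ENNReal.ofReal (twGauss H t v r) ∂μ :=
  ofReal_integral_eq_lintegral_ofReal (integrableOn_twGauss H hD μ t r)
    (ae_of_all _ fun _ => (twGauss_pos ..).le)

/-- The Mellin transform of the averaged theta function as a sum over orbit representatives. -/
lemma exists_lintegral_latTheta [Nonempty ι] {H : V →ₗ[ℝ] ι → ℝ} (hsum : ∀ v, ∑ w, H v w = 0)
    (hinj : Function.Injective H) (hdim : Module.finrank ℝ V + 1 = Fintype.card ι)
    (μ : Measure V) [μ.IsAddHaarMeasure] {D : Set V} (hD : Bornology.IsBounded D)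
    (hDm : MeasurableSet D) {Γ : Type*} [Countable Γ] {ℓ : Γ → V} {N : ℝ≥0} (hN : N ≠ 0)
    (hU : ∀ G : V → ℝ≥0∞, Measurable G →
      ∑' γ, ∫⁻ v in D, G (v + ℓ γ) ∂μ = N * ∫⁻ v, G v ∂μ) :
    ∃ c : ℝ≥0, c ≠ 0 ∧ ∀ (A B : Matrix ι ι ℝ), B * A = 1 → ∀ (κ : Type*) (r : κ → ι → ℝ)
      (e : κ × Γ ≃ {m : ι → ℤ // m ≠ 0}), Countable κ → (∀ k w, 0 < r k w) →
      (∀ k γ w, sqCoord A (e (k, γ)) w = Real.exp (2 * H (ℓ γ) w) * r k w) → ∀ s : ℝ, 0 < s →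
      ∫⁻ t in Set.Ioi 0, ENNReal.ofReal (t ^ (s - 1) * (latTheta H D μ A t - μ.real D)) =
        c * ∑' k, ∏ w, ENNReal.ofReal ((π * r k w) ^ (-s) * Real.Gamma s) := by
  obtain ⟨c, hc, h⟩ := exists_lintegral_twGauss hsum hinj hdim μ
  refine ⟨N * c, mul_ne_zero hN hc, fun A B hAB κ r e hκ hr he s hs => ?_⟩
  have key : ∀ t ∈ Set.Ioi (0 : ℝ),
      ENNReal.ofReal (t ^ (s - 1) * (latTheta H D μ A t - μ.real D)) =
      ∑' k, N * ∫⁻ v, ENNReal.ofReal (t ^ (s - 1) * twGauss H t v (r k)) ∂μ := fun t ht => by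
    have ht0 : (0 : ℝ) < t := ht
    have hts : 0 ≤ t ^ (s - 1) := Real.rpow_nonneg ht0.le _
    rw [latTheta_sub_eq H μ hD hDm hAB ht0, ENNReal.ofReal_mul hts,
      ENNReal.ofReal_tsum_of_nonneg (fun _ => thetaTerm_nonneg ..)
        ((summable_thetaTerm H μ hD hDm hAB ht0).subtype _), ← e.tsum_eq, ENNReal.tsum_prod',
      ← ENNReal.tsum_mul_left]
    refine tsum_congr fun k => ?_
    simp only [ENNReal.ofReal_mul hts]
    rw [lintegral_const_mul' _ _ ENNReal.ofReal_ne_top, mul_left_comm]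
    congr 1
    rw [← hU (fun v => ENNReal.ofReal (twGauss H t v (r k)))
      (continuous_twGauss H t (r k)).measurable.ennreal_ofReal]
    refine tsum_congr fun γ => ?_
    rw [ofReal_thetaTerm H hD μ]
    refine lintegral_congr fun v => ?_
    rw [show sqCoord A (e (k, γ)) = fun w => Real.exp (2 * H (ℓ γ) w) * r k w from
      funext (he k γ), twGauss_add]
  rw [setLIntegral_congr_fun measurableSet_Ioi key, lintegral_tsum]
  · rw [ENNReal.coe_mul, mul_assoc, ← ENNReal.tsum_mul_left, ← ENNReal.tsum_mul_left]
    refine tsum_congr fun k => ?_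
    rw [lintegral_const_mul' _ _ ENNReal.coe_ne_top, h s (r k) hs (hr k)]
  · exact fun k => ((measurable_lintegral_twGauss H μ s (r k)).const_mul _).aemeasurable

end ThetaMellin

section DirichletIdentity

lemma isOpen_halfPlane (a : ℝ) : IsOpen {w : ℂ | a < w.re} :=
  isOpen_lt continuous_const Complex.continuous_re

/-- Two holomorphic functions on a half plane agreeing on its real points are equal. -/
lemma eqOn_halfPlane_of_real {a : ℝ} {f g : ℂ → ℂ} (hf : DifferentiableOn ℂ f {w | a < w.re})
    (hg : DifferentiableOn ℂ g {w | a < w.re}) (h : ∀ s : ℝ, a < s → f s = g s) :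
    Set.EqOn f g {w | a < w.re} := by
  have hconv : Convex ℝ {w : ℂ | a < w.re} := convex_halfSpace_re_gt a
  refine AnalyticOnNhd.eqOn_of_preconnected_of_frequently_eq
    (hf.analyticOnNhd (isOpen_halfPlane a)) (hg.analyticOnNhd (isOpen_halfPlane a))
    hconv.isPreconnected (z₀ := ((a + 1 : ℝ) : ℂ)) (by simp) ?_
  have ht : Tendsto (fun x : ℝ => (x : ℂ)) (nhdsWithin (a + 1) {a + 1}ᶜ)
      (nhdsWithin ((a + 1 : ℝ) : ℂ) {((a + 1 : ℝ) : ℂ)}ᶜ) := by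
    refine tendsto_nhdsWithin_iff.2 ⟨?_, ?_⟩
    · exact (Complex.continuous_ofReal.tendsto _).mono_left nhdsWithin_le_nhds
    · filter_upwards [self_mem_nhdsWithin] with x hx
      exact fun h => hx (Complex.ofReal_injective h)
  refine ht.frequently (Eventually.frequently ?_)
  filter_upwards [nhdsWithin_le_nhds (lt_mem_nhds (show a < a + 1 by linarith))] with x hx
  exact h x hx

variable {κ : Type*}

lemma norm_ofReal_cpow_neg {p : ℝ} (hp : 0 < p) (w : ℂ) : ‖(p : ℂ) ^ (-w)‖ = p ^ (-w.re) := by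
  rw [Complex.norm_cpow_eq_rpow_re_of_pos hp]
  simp

lemma differentiableOn_tsum_cpow {a : ℝ} {p : κ → ℝ} (hp : ∀ k, 0 < p k)
    (hs : ∀ s : ℝ, a < s → Summable fun k => p k ^ (-s)) :
    DifferentiableOn ℂ (fun w : ℂ => ∑' k, (p k : ℂ) ^ (-w)) {w | a < w.re} := by
  intro w hw
  have hw : a < w.re := hw
  refine DifferentiableAt.differentiableWithinAt ?_
  have h1 := hs ((a + w.re) / 2) (by linarith)
  have h2 := hs (w.re + 1) (by linarith)
  have hopen : IsOpen {z : ℂ | (a + w.re) / 2 < z.re ∧ z.re < w.re + 1} :=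
    (isOpen_halfPlane _).inter (isOpen_lt Complex.continuous_re continuous_const)
  refine (Complex.differentiableOn_tsum_of_summable_norm (h1.add h2) (fun k => ?_) hopen
    (fun k z hz => ?_)).differentiableAt (hopen.mem_nhds ⟨by linarith, by linarith⟩)
  · have : (p k : ℂ) ≠ 0 := by exact_mod_cast (hp k).ne'
    exact fun z _ => ((differentiableAt_id.neg).const_cpow (Or.inl this)).differentiableWithinAt
  · rw [norm_ofReal_cpow_neg (hp k)]
    have hz : (a + w.re) / 2 < z.re ∧ z.re < w.re + 1 := hz
    rcases le_total 1 (p k) with h | h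
    · have := Real.rpow_le_rpow_of_exponent_le h (show -z.re ≤ -((a + w.re) / 2) by linarith)
      have := Real.rpow_pos_of_pos (hp k) (-(w.re + 1))
      linarith
    · have := Real.rpow_le_rpow_of_exponent_ge (hp k) h (show -(w.re + 1) ≤ -z.re by linarith)
      have := Real.rpow_pos_of_pos (hp k) (-((a + w.re) / 2))
      linarith

end DirichletIdentity

section ThetaLambda

open scoped ENNReal NNReal

variable {ι : Type*} [Fintype ι]
  {V : Type*} [NormedAddCommGroup V] [NormedSpace ℝ V] [FiniteDimensional ℝ V]
  [MeasurableSpace V] [BorelSpace V]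

lemma latFEPair_Λ_ofReal [Nonempty ι] {H : V →ₗ[ℝ] ι → ℝ} (hsum : ∀ v, ∑ w, H v w = 0)
    (μ : Measure V) [μ.IsAddHaarMeasure] {D : Set V} (hD : Bornology.IsBounded D)
    (hDm : MeasurableSet D) {A B : Matrix ι ι ℝ} (hAB : A.transpose * B = 1) {s : ℝ}
    (hs : 1 / 2 < s) :
    ∃ x : ℝ, 0 ≤ x ∧ (latFEPair H μ hD hDm hsum hAB).Λ s = x ∧
      ∫⁻ t in Set.Ioi 0, ENNReal.ofReal (t ^ (s - 1) * (latTheta H D μ A t - μ.real D)) =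
        ENNReal.ofReal x := by
  have hBA : B.transpose * A = 1 := by
    simpa [Matrix.transpose_mul] using congrArg Matrix.transpose hAB
  set P := latFEPair H μ hD hDm hsum hAB with hP
  have hM := P.hasMellin (s := (s : ℂ)) (by
    rw [Complex.ofReal_re]
    exact hs)
  have hfun : Set.EqOn (fun t : ℝ => (t : ℂ) ^ ((s : ℂ) - 1) • (P.f t - P.f₀))
      (fun t => ((t ^ (s - 1) * (latTheta H D μ A t - μ.real D) : ℝ) : ℂ)) (Set.Ioi 0) := by
    intro t ht
    have ht0 : (0 : ℝ) < t := ht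
    change (t : ℂ) ^ ((s : ℂ) - 1) • (((latTheta H D μ A t : ℝ) : ℂ) - ((μ.real D : ℝ) : ℂ)) = _
    simp only [smul_eq_mul, Complex.ofReal_mul, Complex.ofReal_cpow ht0.le, Complex.ofReal_sub,
      Complex.ofReal_one]
  have hfint : IntegrableOn
      (fun t : ℝ => t ^ (s - 1) * (latTheta H D μ A t - μ.real D)) (Set.Ioi 0) := by
    have h1 := (integrableOn_congr_fun hfun measurableSet_Ioi).1 hM.1
    simpa [IntegrableOn] using h1.re
  have hnn : ∀ t ∈ Set.Ioi (0 : ℝ), 0 ≤ t ^ (s - 1) * (latTheta H D μ A t - μ.real D) := by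
    intro t ht
    rw [latTheta_sub_eq H μ hD hDm hBA ht]
    exact mul_nonneg (Real.rpow_nonneg (le_of_lt ht) _) (tsum_nonneg fun _ => thetaTerm_nonneg ..)
  refine ⟨∫ t in Set.Ioi 0, t ^ (s - 1) * (latTheta H D μ A t - μ.real D),
    setIntegral_nonneg measurableSet_Ioi hnn, ?_, ?_⟩
  · rw [← hM.2, mellin, setIntegral_congr_fun measurableSet_Ioi hfun, integral_complex_ofReal]
  · rw [ofReal_integral_eq_lintegral_ofReal hfint
      ((ae_restrict_iff' measurableSet_Ioi).2 (ae_of_all _ hnn))]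

/-- The completed zeta function of a lattice with a free action of units, as a Dirichlet series
over orbit representatives. -/
theorem exists_latFEPair_Λ_eq [Nonempty ι] {H : V →ₗ[ℝ] ι → ℝ} (hsum : ∀ v, ∑ w, H v w = 0)
    (hinj : Function.Injective H) (hdim : Module.finrank ℝ V + 1 = Fintype.card ι)
    (μ : Measure V) [μ.IsAddHaarMeasure] {D : Set V} (hD : Bornology.IsBounded D)
    (hDm : MeasurableSet D) {Γ : Type*} [Countable Γ] {ℓ : Γ → V} {N : ℝ≥0} (hN : N ≠ 0)
    (hU : ∀ G : V → ℝ≥0∞, Measurable G →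
      ∑' γ, ∫⁻ v in D, G (v + ℓ γ) ∂μ = N * ∫⁻ v, G v ∂μ) :
    ∃ c : ℝ, 0 < c ∧ ∀ (A B : Matrix ι ι ℝ) (hAB : A.transpose * B = 1) (κ : Type*)
      (r : κ → ι → ℝ) (e : κ × Γ ≃ {m : ι → ℤ // m ≠ 0}), Countable κ → (∀ k w, 0 < r k w) →
      (∀ k γ w, sqCoord A (e (k, γ)) w = Real.exp (2 * H (ℓ γ) w) * r k w) →
      (∀ s : ℝ, 1 / 2 < s → Summable fun k => (∏ w, r k w) ^ (-s)) ∧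
      ∀ w : ℂ, 1 / 2 < w.re → (latFEPair H μ hD hDm hsum hAB).Λ w =
        c * ((π : ℂ) ^ (-w) * Complex.Gamma w) ^ Fintype.card ι *
          ∑' k, ((∏ w, r k w : ℝ) : ℂ) ^ (-w) := by
  obtain ⟨c, hc, h⟩ := exists_lintegral_latTheta hsum hinj hdim μ hD hDm hN hU
  refine ⟨c, NNReal.coe_pos.2 (pos_iff_ne_zero.2 hc), fun A B hAB κ r e hκ hr he => ?_⟩
  have hBA : B.transpose * A = 1 := by
    simpa [Matrix.transpose_mul] using congrArg Matrix.transpose hAB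
  set P := latFEPair H μ hD hDm hsum hAB with hP
  set n := Fintype.card ι with hn
  have hp : ∀ k, 0 < ∏ w, r k w := fun k => Finset.prod_pos fun w _ => hr k w
  have hprod : ∀ s : ℝ, 1 / 2 < s → ∀ k,
      ∏ w, ENNReal.ofReal ((π * r k w) ^ (-s) * Real.Gamma s) =
      ENNReal.ofReal ((π ^ (-s) * Real.Gamma s) ^ n * (∏ w, r k w) ^ (-s)) := fun s hs k => by
    have hG := Real.Gamma_pos_of_pos (show 0 < s by linarith)
    rw [← ENNReal.ofReal_prod_of_nonneg fun w _ => mul_nonneg (Real.rpow_nonneg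
      (mul_nonneg Real.pi_pos.le (hr k w).le) _) hG.le]
    congr 1
    rw [← Real.finsetProd_rpow _ _ fun w _ => (hr k w).le, hn, ← Finset.card_univ,
      ← Finset.prod_const,
      ← Finset.prod_mul_distrib]
    refine Finset.prod_congr rfl fun w _ => ?_
    rw [Real.mul_rpow Real.pi_pos.le (hr k w).le]
    ring
  have hreal : ∀ s : ℝ, 1 / 2 < s → (Summable fun k => (∏ w, r k w) ^ (-s)) ∧
      P.Λ s = ((c * (π ^ (-s) * Real.Gamma s) ^ n * ∑' k, (∏ w, r k w) ^ (-s) : ℝ) : ℂ) := by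
    intro s hs
    have hs0 : 0 < s := by linarith
    obtain ⟨x, hx0, hx1, hx2⟩ := latFEPair_Λ_ofReal hsum μ hD hDm hAB hs
    rw [h A _ hBA κ r e hκ hr he s hs0, tsum_congr (hprod s hs)] at hx2
    have hG := Real.Gamma_pos_of_pos hs0
    have hpg : 0 < π ^ (-s) * Real.Gamma s := mul_pos (Real.rpow_pos_of_pos Real.pi_pos _) hG
    have hnn : ∀ k, 0 ≤ (π ^ (-s) * Real.Gamma s) ^ n * (∏ w, r k w) ^ (-s) := fun k =>
      mul_nonneg (pow_pos hpg _).le (Real.rpow_nonneg (hp k).le _)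
    have hfin : ∑' k, ENNReal.ofReal ((π ^ (-s) * Real.Gamma s) ^ n * (∏ w, r k w) ^ (-s)) ≠ ⊤ := by
      intro htop
      rw [htop, ENNReal.mul_top (by simpa using hc)] at hx2
      exact ENNReal.ofReal_ne_top hx2.symm
    have hsumm : Summable fun k => (π ^ (-s) * Real.Gamma s) ^ n * (∏ w, r k w) ^ (-s) := by
      have := ENNReal.summable_toReal hfin
      simpa only [ENNReal.toReal_ofReal (hnn _)] using this
    refine ⟨(summable_mul_left_iff (pow_pos hpg n).ne').1 hsumm, ?_⟩
    rw [hx1]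
    congr 1
    rw [← ENNReal.ofReal_tsum_of_nonneg hnn hsumm, ← ENNReal.ofReal_coe_nnreal,
      ← ENNReal.ofReal_mul c.coe_nonneg,
      ENNReal.ofReal_eq_ofReal_iff (mul_nonneg c.coe_nonneg (tsum_nonneg hnn)) hx0,
      tsum_mul_left] at hx2
    rw [← hx2, mul_assoc]
  refine ⟨fun s hs => (hreal s hs).1, ?_⟩
  have hG : DifferentiableOn ℂ Complex.Gamma {w | (1 / 2 : ℝ) < w.re} := fun w hw =>
    (Complex.differentiableAt_Gamma w fun m hm => by
      have hw : (1 / 2 : ℝ) < w.re := hw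
      rw [hm, Complex.neg_re, Complex.natCast_re] at hw
      have : (0 : ℝ) ≤ m := Nat.cast_nonneg m
      linarith).differentiableWithinAt
  have hpi : DifferentiableOn ℂ (fun w : ℂ => (π : ℂ) ^ (-w)) {w | (1 / 2 : ℝ) < w.re} := fun w _ =>
    ((differentiableAt_id.neg).const_cpow
      (Or.inl (by exact_mod_cast Real.pi_ne_zero))).differentiableWithinAt
  refine eqOn_halfPlane_of_real (f := P.Λ) (a := 1 / 2) (fun w hw => ?_) ?_ fun s hs => ?_
  · have hw : (1 / 2 : ℝ) < w.re := hw
    refine (P.differentiableAt_Λ (Or.inl fun h0 => ?_) (Or.inl fun h0 => ?_)).differentiableWithinAt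
    · rw [h0] at hw
      norm_num at hw
    · rw [h0] at hw
      have : P.k = 1 / 2 := rfl
      simp [this] at hw
  · exact (((hpi.mul hG).pow n).const_mul (c : ℂ)).mul
      (differentiableOn_tsum_cpow hp fun s hs => (hreal s hs).1)
  · rw [(hreal s hs).2]
    push_cast
    rw [Complex.ofReal_cpow Real.pi_pos.le, ← Complex.Gamma_ofReal]
    push_cast
    congr 1
    refine tsum_congr fun k => ?_
    have := Complex.ofReal_cpow (hp k).le (-s)
    push_cast at this ⊢
    exact this

end ThetaLambda

section UnitTheta

open scoped ENNReal NNReal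
open NumberField.Units NumberField.Units.dirichletUnitTheorem

variable (K : Type*) [Field K] [NumberField K]

/-- The extension of a vector of the logarithmic space to all places, with coordinates of sum
zero. -/
noncomputable def logSpaceExtend : logSpace K →ₗ[ℝ] InfinitePlace K → ℝ :=
  LinearMap.pi fun w => if h : w ≠ w₀ then LinearMap.proj (⟨w, h⟩ : {w : InfinitePlace K // w ≠ w₀})
    else -∑ v : {w : InfinitePlace K // w ≠ w₀}, LinearMap.proj v

lemma logSpaceExtend_of_ne (v : logSpace K) (w : {w : InfinitePlace K // w ≠ w₀}) :
    logSpaceExtend K v w = v w := by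
  simp [logSpaceExtend, w.2]

lemma logSpaceExtend_w₀ (v : logSpace K) : logSpaceExtend K v w₀ = -∑ w, v w := by
  simp [logSpaceExtend]

lemma sum_logSpaceExtend (v : logSpace K) : ∑ w, logSpaceExtend K v w = 0 := by
  rw [Fintype.sum_eq_add_sum_subtype_ne _ w₀, logSpaceExtend_w₀]
  simp [logSpaceExtend_of_ne]

lemma logSpaceExtend_injective : Function.Injective (logSpaceExtend K) := fun v v' h => by
  ext w
  rw [← logSpaceExtend_of_ne K v, h, logSpaceExtend_of_ne]

lemma finrank_logSpace_add_one :
    Module.finrank ℝ (logSpace K) + 1 = Fintype.card (InfinitePlace K) := by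
  have h : 0 < Fintype.card (InfinitePlace K) := Fintype.card_pos
  have h1 := NumberField.Units.finrank_eq_rank K
  rw [NumberField.Units.rank] at h1
  omega

lemma logSpaceExtend_logEmbedding [IsTotallyReal K] (u : (𝓞 K)ˣ) (w : InfinitePlace K) :
    logSpaceExtend K (logEmbedding K (Additive.ofMul u)) w = Real.log (w (u : K)) := by
  by_cases h : w = w₀
  · subst h
    rw [logSpaceExtend_w₀, sum_logEmbedding_component, IsTotallyReal.mult_eq]
    simp
  · rw [logSpaceExtend_of_ne K _ ⟨w, h⟩, logEmbedding_component, IsTotallyReal.mult_eq]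
    simp

/-- A fundamental domain of the unit lattice. -/
noncomputable def unitDomain : Set (logSpace K) :=
  ZSpan.fundamentalDomain ((basisUnitLattice K).ofZLatticeBasis ℝ (unitLattice K))

lemma isBounded_unitDomain : Bornology.IsBounded (unitDomain K) :=
  ZSpan.fundamentalDomain_isBounded _

lemma measurableSet_unitDomain : MeasurableSet (unitDomain K) :=
  ZSpan.fundamentalDomain_measurableSet _

lemma tsum_lintegral_unitDomain (G : logSpace K → ℝ≥0∞) :
    ∑' u : (𝓞 K)ˣ, ∫⁻ v in unitDomain K, G (v + logEmbedding K (Additive.ofMul u)) =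
      (torsionOrder K : ℝ≥0) * ∫⁻ v, G v := by
  have : VAddInvariantMeasure (unitLattice K) (logSpace K) volume :=
    ⟨fun c s _ => measure_preimage_add volume (c : logSpace K) s⟩
  have h0 : IsAddFundamentalDomain (unitLattice K) (unitDomain K) volume :=
    ZLattice.isAddFundamentalDomain (basisUnitLattice K) volume
  have h1 := h0.lintegral_eq_tsum'' G
  rw [h1]
  rw [← (Subgroup.groupEquivQuotientProdSubgroup (s := torsion K)).symm.tsum_eq, ENNReal.tsum_prod']
  have h2 : ∀ (a : (𝓞 K)ˣ ⧸ torsion K) (b : torsion K),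
      logEmbedding K (Additive.ofMul
        ((Subgroup.groupEquivQuotientProdSubgroup (s := torsion K)).symm (a, b))) =
      (logEmbeddingEquiv K (Additive.ofMul a) : logSpace K) := by
    intro a b
    set u := (Subgroup.groupEquivQuotientProdSubgroup (s := torsion K)).symm (a, b) with hu
    have : QuotientGroup.mk u = a := by
      have := congrArg Prod.fst
        ((Subgroup.groupEquivQuotientProdSubgroup (s := torsion K)).apply_symm_apply (a, b))
      rw [← hu] at this
      exact this
    rw [← this]
    rfl
  simp_rw [h2, ENNReal.tsum_const]
  rw [ENNReal.tsum_mul_left]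
  rw [← (Additive.ofMul.trans (logEmbeddingEquiv K).toEquiv).tsum_eq]
  congr 1
  · simp [torsionOrder, ENat.card_eq_coe_natCard]
  · refine tsum_congr fun a => ?_
    simp [add_comm, Submodule.vadd_def]

section Orbits

variable {K} [IsTotallyReal K]

lemma abs_embedding_of_isReal {w : InfinitePlace K} (hw : w.IsReal) (x : K) :
    |InfinitePlace.embedding_of_isReal hw x| = w x := by
  rw [← Real.norm_eq_abs, InfinitePlace.norm_embedding_of_isReal]

/-- The matrix of the real embeddings of a basis. -/
noncomputable def embMatrix {ι : Type*} (b : Module.Basis ι ℚ K) :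
    Matrix (InfinitePlace K) ι ℝ :=
  Matrix.of fun w i => InfinitePlace.embedding_of_isReal (IsTotallyReal.isReal w) (b i)

variable (b : Module.Basis (InfinitePlace K) ℚ K)

lemma sqCoord_embMatrix (x : Submodule.span ℤ (Set.range b)) (w : InfinitePlace K) :
    sqCoord (embMatrix b) ((b.restrictScalars ℤ).equivFun x) w = w (x : K) ^ 2 := by
  have h := congrArg (fun y : Submodule.span ℤ (Set.range b) =>
    InfinitePlace.embedding_of_isReal (IsTotallyReal.isReal w) (y : K))
    ((b.restrictScalars ℤ).sum_equivFun x)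
  simp only [AddSubmonoidClass.coe_finsetSum, Submodule.coe_smul, map_sum, map_zsmul,
    Module.Basis.restrictScalars_apply] at h
  rw [← abs_embedding_of_isReal (IsTotallyReal.isReal w), sq_abs, sqCoord, ← h]
  congr 1
  refine Finset.sum_congr rfl fun i _ => ?_
  rw [zsmul_eq_mul, mul_comm]
  rfl

/-- Orbit representatives for the units acting on a lattice in `K`, read in coordinates. -/
lemma exists_orbit_equiv {S : Submodule ℤ K} (hS : S = Submodule.span ℤ (Set.range b))
    (hb : ∀ (u : (𝓞 K)ˣ), ∀ x ∈ S, (u : K) * x ∈ S) {κ : Type*}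
    {f : {x : K // x ∈ S ∧ x ≠ 0} → κ} (hf : Function.Surjective f)
    (hfu : ∀ x y, f x = f y ↔ ∃ u : (𝓞 K)ˣ, (y : K) = (u : K) * x)
    (σ : (𝓞 K)ˣ ≃ (𝓞 K)ˣ) :
    ∃ (r : κ → InfinitePlace K → ℝ)
      (e : κ × (𝓞 K)ˣ ≃ {m : InfinitePlace K → ℤ // m ≠ 0}),
      (∀ k w, 0 < r k w) ∧
      (∀ k u w, sqCoord (embMatrix b) (e (k, u)) w = w (σ u : K) ^ 2 * r k w) ∧
      ∀ x, ∏ w, r (f x) w = (Algebra.norm ℚ (x : K) : ℝ) ^ 2 := by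
  obtain ⟨g, hg⟩ := hf.hasRightInverse
  have hu0 : ∀ u : (𝓞 K)ˣ, (u : K) ≠ 0 := fun u => by simp
  let X := {x : K // x ∈ S ∧ x ≠ 0}
  let e₁ : κ × (𝓞 K)ˣ → X := fun p =>
    ⟨(σ p.2 : K) * g p.1, hb _ _ (g p.1).2.1, mul_ne_zero (hu0 _) (g p.1).2.2⟩
  have he₁ : Function.Bijective e₁ := by
    constructor
    · rintro ⟨k, u⟩ ⟨k', u'⟩ h
      have h0 : (σ u : K) * g k = (σ u' : K) * g k' := congrArg Subtype.val h
      have hk : k = k' := by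
        rw [← hg k, ← hg k']
        refine (hfu _ _).2 ⟨(σ u')⁻¹ * σ u, ?_⟩
        apply mul_left_cancel₀ (hu0 (σ u'))
        rw [← h0, ← mul_assoc]
        congr 1
        rw [← NumberField.Units.coe_mul, mul_inv_cancel_left]
      subst hk
      have h1 := mul_right_cancel₀ (g k).2.2 h0
      have h2 : σ u = σ u' := Units.ext (RingOfIntegers.ext h1)
      rw [σ.injective h2]
    · intro x
      obtain ⟨u, hu⟩ := (hfu (g (f x)) x).1 (hg (f x))
      exact ⟨(f x, σ.symm u), Subtype.ext (by simp [e₁, hu])⟩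
  let e₀ : S ≃ₗ[ℤ] (InfinitePlace K → ℤ) :=
    (LinearEquiv.ofEq _ _ hS).trans (b.restrictScalars ℤ).equivFun
  let e₂ : X ≃ {m : InfinitePlace K → ℤ // m ≠ 0} :=
    { toFun := fun x => ⟨e₀ ⟨x, x.2.1⟩, fun h => x.2.2
        (congrArg Subtype.val ((map_eq_zero_iff e₀ e₀.injective).1 h))⟩
      invFun := fun m => ⟨e₀.symm m, Submodule.coe_mem _, fun h => m.2
        ((map_eq_zero_iff e₀.symm e₀.symm.injective).1 (Subtype.ext h))⟩
      left_inv := fun x => Subtype.ext (by simp only [e₀.symm_apply_apply])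
      right_inv := fun m => Subtype.ext (by simp only [e₀.apply_symm_apply]) }
  refine ⟨fun k w => w (g k : K) ^ 2, (Equiv.ofBijective e₁ he₁).trans e₂, fun k w => ?_,
    fun k u w => ?_, fun x => ?_⟩
  · exact pow_pos (InfinitePlace.pos_iff.2 (g k).2.2) 2
  · change sqCoord (embMatrix b) ((b.restrictScalars ℤ).equivFun
      ⟨(σ u : K) * g k, hS ▸ hb _ _ (g k).2.1⟩) w = _
    rw [sqCoord_embMatrix, map_mul, mul_pow]
  · obtain ⟨u, hu⟩ := (hfu (g (f x)) x).1 (hg (f x))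
    have h1 := InfinitePlace.prod_eq_abs_norm (g (f x) : K)
    simp only [IsTotallyReal.mult_eq, pow_one] at h1
    rw [Finset.prod_pow, h1, hu, map_mul]
    have h2 := NumberField.Units.norm K u
    rw [show ((Algebra.norm ℚ (u : K) * Algebra.norm ℚ (g (f x) : K) : ℚ) : ℝ) ^ 2 =
      |(Algebra.norm ℚ (u : K) : ℝ)| ^ 2 * |(Algebra.norm ℚ (g (f x) : K) : ℝ)| ^ 2 by
        rw [sq_abs, sq_abs]; push_cast; ring]
    rw [← Rat.cast_abs, show |Algebra.norm ℚ (u : K)| = 1 from h2]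
    push_cast
    ring

end Orbits

end UnitTheta

section DualLattice

open NumberField.Units NumberField.Units.dirichletUnitTheorem

lemma latFEPair_symm {ι : Type*} [Fintype ι]
  {V : Type*} [NormedAddCommGroup V] [NormedSpace ℝ V] [FiniteDimensional ℝ V]
  [MeasurableSpace V] [BorelSpace V] [Nonempty ι] {H : V →ₗ[ℝ] ι → ℝ}
    (hsum : ∀ v, ∑ w, H v w = 0) (hsum' : ∀ v, ∑ w, (-H) v w = 0)
    (μ : Measure V) [μ.IsAddHaarMeasure] {D : Set V} (hD : Bornology.IsBounded D)
    (hDm : MeasurableSet D) {A B : Matrix ι ι ℝ} (hAB : A.transpose * B = 1)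
    (hBA : B.transpose * A = 1) :
    (latFEPair H μ hD hDm hsum hAB).symm = latFEPair (-H) μ hD hDm hsum' hBA := by
  have h : |A.det| * |B.det| = 1 := by
    rw [← abs_mul, ← Matrix.det_transpose A, ← Matrix.det_mul, hAB, Matrix.det_one, abs_one]
  simp only [latFEPair, WeakFEPair.symm, WeakFEPair.mk.injEq, neg_neg, true_and, and_true]
  rw [← Complex.ofReal_inv, inv_inv, eq_inv_of_mul_eq_one_left h]

universe u

variable {K : Type u} [Field K] [NumberField K] [IsTotallyReal K]

/-- The infinite places of a totally real field correspond to its complex embeddings. -/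
noncomputable def placeEquivEmbedding : InfinitePlace K ≃ (K →+* ℂ) where
  toFun w := w.embedding
  invFun φ := InfinitePlace.mk φ
  left_inv w := InfinitePlace.mk_embedding w
  right_inv φ := InfinitePlace.embedding_mk_eq_of_isReal
    (IsTotallyReal.complexEmbedding_isReal φ)

lemma trace_eq_sum_embedding_of_isReal (x : K) :
    (Algebra.trace ℚ K x : ℝ) =
      ∑ w : InfinitePlace K, InfinitePlace.embedding_of_isReal (IsTotallyReal.isReal w) x := by
  have h := trace_eq_sum_embeddings ℂ (K := ℚ) (L := K) (x := x)
  rw [← (RingHom.equivRatAlgHom (R := K) (S := ℂ)).sum_comp, ← placeEquivEmbedding.sum_comp] at h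
  apply Complex.ofReal_injective
  rw [Complex.ofReal_sum]
  simp only [InfinitePlace.embedding_of_isReal_apply]
  simpa [placeEquivEmbedding] using h

lemma embMatrix_transpose_mul (b b' : Module.Basis (InfinitePlace K) ℚ K)
    (h : ∀ i j, Algebra.trace ℚ K (b i * b' j) = if i = j then 1 else 0) :
    (embMatrix b).transpose * embMatrix b' = 1 := by
  ext i j
  have h1 := trace_eq_sum_embedding_of_isReal (b i * b' j)
  rw [h] at h1
  rw [Matrix.mul_apply, Matrix.one_apply]
  simp only [map_mul] at h1
  simp only [Matrix.transpose_apply, embMatrix, Matrix.of_apply]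
  rw [← h1]
  split_ifs <;> simp

/-- The factor `(π ^ (-w) Γ(w)) ^ n` completing a zeta function of degree `n`. -/
noncomputable def zetaFactor (n : ℕ) (w : ℂ) : ℂ := ((π : ℂ) ^ (-w) * Complex.Gamma w) ^ n

lemma two_mul_log_place (u : (𝓞 K)ˣ) (w : InfinitePlace K) :
    Real.exp (2 * Real.log (w (u : K))) = w (u : K) ^ 2 := by
  rw [mul_comm, Real.exp_mul, Real.exp_log (NumberField.Units.pos_at_place u w)]
  norm_cast

variable (K) in
lemma NumberField.countable : Countable K :=
  (Module.finBasis ℚ K).equivFun.toEquiv.countable_iff.2 inferInstance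

variable (K) in
lemma NumberField.countable_units : Countable (𝓞 K)ˣ :=
  have := NumberField.countable K
  (show Function.Injective (fun u : (𝓞 K)ˣ => (u : K)) from
    fun _ _ h => Units.ext (RingOfIntegers.ext h)).countable

variable (K) in
/-- The zeta function of a lattice stable under the units, summed over nonzero elements up to
units, is given by a functional equation pair. -/
theorem exists_fePair_lattice : ∃ c c' : ℝ, 0 < c ∧ ∀ (S : Submodule ℤ K)
    (b : Module.Basis (InfinitePlace K) ℚ K), S = Submodule.span ℤ (Set.range b) →
    (∀ (u : (𝓞 K)ˣ), ∀ x ∈ S, (u : K) * x ∈ S) →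
    ∀ (κ : Type*) (f : {x : K // x ∈ S ∧ x ≠ 0} → κ), Countable κ → Function.Surjective f →
    (∀ x y, f x = f y ↔ ∃ u : (𝓞 K)ˣ, (y : K) = (u : K) * x) →
    ∃ (P : WeakFEPair ℂ) (p : κ → ℝ) (κ' : Type u) (p' : κ' → ℝ), P.k = 1 / 2 ∧ Countable κ' ∧
      (∀ x, p (f x) = (Algebra.norm ℚ (x : K) : ℝ) ^ 2) ∧
      (∀ k, 0 < p k) ∧ (∀ k, 0 < p' k) ∧
      (∀ s : ℝ, 1 / 2 < s → Summable fun k => p k ^ (-s)) ∧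
      (∀ s : ℝ, 1 / 2 < s → Summable fun k => p' k ^ (-s)) ∧
      (∀ w : ℂ, 1 / 2 < w.re → P.Λ w = c * zetaFactor (Module.finrank ℚ K) w *
        ∑' k, (p k : ℂ) ^ (-w)) ∧
      (∀ w : ℂ, 1 / 2 < w.re → P.symm.Λ w = c' * zetaFactor (Module.finrank ℚ K) w *
        ∑' k, (p' k : ℂ) ^ (-w)) := by
  have hN : ((torsionOrder K : NNReal)) ≠ 0 := by
    exact_mod_cast torsionOrder_ne_zero K
  have hcK := NumberField.countable K
  have hcU := NumberField.countable_units K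
  have hsum := sum_logSpaceExtend K
  have hsum' : ∀ v, ∑ w, (-logSpaceExtend K) v w = 0 := fun v => by simp [hsum v]
  have hinj := logSpaceExtend_injective K
  have hinj' : Function.Injective (-logSpaceExtend K) := fun v v' h => hinj (by simpa using h)
  have hU := fun G (_ : Measurable G) => tsum_lintegral_unitDomain K G
  have hcard : Fintype.card (InfinitePlace K) = Module.finrank ℚ K := by
    rw [IsTotallyReal.finrank, InfinitePlace.card_eq_nrRealPlaces_add_nrComplexPlaces,
      IsTotallyReal.nrComplexPlaces_eq_zero, add_zero]
  obtain ⟨c, hc, h⟩ := exists_latFEPair_Λ_eq hsum hinj (finrank_logSpace_add_one K) volume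
    (isBounded_unitDomain K) (measurableSet_unitDomain K)
    (ℓ := fun u : (𝓞 K)ˣ => logEmbedding K (Additive.ofMul u)) hN hU
  obtain ⟨c', hc', h'⟩ := exists_latFEPair_Λ_eq hsum' hinj' (finrank_logSpace_add_one K) volume
    (isBounded_unitDomain K) (measurableSet_unitDomain K)
    (ℓ := fun u : (𝓞 K)ˣ => logEmbedding K (Additive.ofMul u)) hN hU
  refine ⟨c, c', hc, fun S b hS hb κ f hκ hf hfu => ?_⟩
  have hnd := traceForm_nondegenerate ℚ K
  set b' := (Algebra.traceForm ℚ K).dualBasis hnd b with hb'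
  have hAB : (embMatrix b).transpose * embMatrix b' = 1 := embMatrix_transpose_mul b b'
    fun i j => LinearMap.BilinForm.apply_dualBasis_right hnd (Algebra.traceForm_isSymm ℚ) b i j
  have hBA : (embMatrix b').transpose * embMatrix b = 1 := by
    simpa [Matrix.transpose_mul] using congrArg Matrix.transpose hAB
  set S' := Submodule.span ℤ (Set.range b') with hS'
  have hdual : (Algebra.traceForm ℚ K).dualSubmodule S = S' := by
    rw [hS, hS', hb']
    exact LinearMap.BilinForm.dualSubmodule_span_of_basis _ hnd b
  have hb2 : ∀ (u : (𝓞 K)ˣ), ∀ x ∈ S', (u : K) * x ∈ S' := fun u x hx => by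
    rw [← hdual, LinearMap.BilinForm.mem_dualSubmodule] at hx ⊢
    intro y hy
    have h1 := hx _ (hb u y hy)
    rw [Algebra.traceForm_apply] at h1 ⊢
    rwa [show (u : K) * x * y = x * ((u : K) * y) by ring]
  let X' := {x : K // x ∈ S' ∧ x ≠ 0}
  let R : Setoid X' :=
    { r := fun x y => ∃ u : (𝓞 K)ˣ, (y : K) = (u : K) * x
      iseqv :=
        { refl := fun x => ⟨1, by simp⟩
          symm := fun {x y} ⟨u, hu⟩ => ⟨u⁻¹, by
            rw [hu, ← mul_assoc, ← NumberField.Units.coe_mul]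
            simp⟩
          trans := fun {x y z} ⟨u, hu⟩ ⟨v, hv⟩ => ⟨v * u, by
            rw [hv, hu, NumberField.Units.coe_mul, mul_assoc]⟩ } }
  obtain ⟨r, e, hr, he, hp⟩ := exists_orbit_equiv b hS hb hf hfu (Equiv.refl _)
  obtain ⟨r', e', hr', he', hp'⟩ := exists_orbit_equiv b' hS' hb2 (Quotient.mk_surjective (s := R))
    (fun x y => Quotient.eq) (Equiv.inv _)
  obtain ⟨hs1, hΛ1⟩ := h (embMatrix b) (embMatrix b') hAB κ r e hκ hr fun k u w => by
    rw [he, logSpaceExtend_logEmbedding, two_mul_log_place]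
    rfl
  obtain ⟨hs2, hΛ2⟩ := h' (embMatrix b') (embMatrix b) hBA (Quotient R) r' e' inferInstance hr'
    fun k u w => by
      rw [he', LinearMap.neg_apply, Pi.neg_apply, logSpaceExtend_logEmbedding, mul_neg,
        Real.exp_neg, two_mul_log_place, Equiv.inv_apply]
      rw [← inv_pow, ← map_inv₀, show ((u⁻¹ : (𝓞 K)ˣ) : K) = (u : K)⁻¹ from
        eq_inv_of_mul_eq_one_left (by
          rw [← NumberField.Units.coe_mul, inv_mul_cancel, NumberField.Units.coe_one])]
  refine ⟨latFEPair (logSpaceExtend K) volume (isBounded_unitDomain K) (measurableSet_unitDomain K)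
    hsum hAB, fun k => ∏ w, r k w, Quotient R, fun k => ∏ w, r' k w, rfl, inferInstance, hp,
    fun k => Finset.prod_pos fun w _ => hr k w, fun k => Finset.prod_pos fun w _ => hr' k w,
    hs1, hs2, fun w hw => ?_, fun w hw => ?_⟩
  · rw [hΛ1 w hw, zetaFactor, hcard]
  · rw [latFEPair_symm hsum hsum' _ _ _ hAB hBA, hΛ2 w hw, zetaFactor, hcard]

end DualLattice

section IdealClass

lemma norm_cpow_smul_le_add {a b : ℝ} {w : ℂ} (ha : a ≤ w.re) (hb : w.re ≤ b) {t : ℝ} (ht : 0 < t)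
    (z : ℂ) : ‖(t : ℂ) ^ (w - 1) • z‖ ≤
      ‖(t : ℂ) ^ ((a : ℂ) - 1) • z‖ + ‖(t : ℂ) ^ ((b : ℂ) - 1) • z‖ := by
  simp only [norm_smul, Complex.norm_cpow_eq_rpow_re_of_pos ht, Complex.sub_re, Complex.one_re,
    Complex.ofReal_re, ← add_mul]
  refine mul_le_mul_of_nonneg_right ?_ (norm_nonneg z)
  have h1 := Real.rpow_nonneg ht.le (a - 1)
  have h2 := Real.rpow_nonneg ht.le (b - 1)
  rcases le_total 1 t with h | h
  · have := Real.rpow_le_rpow_of_exponent_le h (show w.re - 1 ≤ b - 1 by linarith)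
    linarith
  · have := Real.rpow_le_rpow_of_exponent_ge ht h (show a - 1 ≤ w.re - 1 by linarith)
    linarith

lemma WeakFEPair.exists_norm_Λ₀_le (P : WeakFEPair ℂ) (a b : ℝ) :
    ∃ C, ∀ w : ℂ, a ≤ w.re → w.re ≤ b → ‖P.Λ₀ w‖ ≤ C := by
  have hs := P.isStrongFEPair_toStrongFEPair
  have ha : IntegrableOn (fun t : ℝ => (t : ℂ) ^ ((a : ℂ) - 1) • P.f_modif t) (Set.Ioi 0) :=
    (hs.hasMellin (a : ℂ)).1
  have hb : IntegrableOn (fun t : ℝ => (t : ℂ) ^ ((b : ℂ) - 1) • P.f_modif t) (Set.Ioi 0) :=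
    (hs.hasMellin (b : ℂ)).1
  refine ⟨∫ t in Set.Ioi (0 : ℝ), (‖(t : ℂ) ^ ((a : ℂ) - 1) • P.f_modif t‖ +
    ‖(t : ℂ) ^ ((b : ℂ) - 1) • P.f_modif t‖), fun w hwa hwb => ?_⟩
  refine norm_integral_le_of_norm_le (ha.norm.add hb.norm) ?_
  filter_upwards [ae_restrict_mem measurableSet_Ioi] with t ht
  exact norm_cpow_smul_le_add hwa hwb ht _

open scoped nonZeroDivisors

universe u

variable (K : Type u) [Field K] [NumberField K] [IsTotallyReal K]

lemma exists_basis_ideal (J : (Ideal (𝓞 K))⁰) :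
    ∃ b : Module.Basis (InfinitePlace K) ℚ K, ∀ x, x ∈ Submodule.span ℤ (Set.range b) ↔
      ∃ a ∈ (J : Ideal (𝓞 K)), (a : K) = x := by
  have hcard : Fintype.card (InfinitePlace K) = Module.finrank ℚ K := by
    rw [IsTotallyReal.finrank, InfinitePlace.card_eq_nrRealPlaces_add_nrComplexPlaces,
      IsTotallyReal.nrComplexPlaces_eq_zero, add_zero]
  let b₀ := basisOfFractionalIdeal K (FractionalIdeal.mk0 K J)
  have h : Fintype.card (Module.Free.ChooseBasisIndex ℤ (FractionalIdeal.mk0 K J)) =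
      Fintype.card (InfinitePlace K) := by
    rw [hcard, ← Module.finrank_eq_card_basis b₀]
  refine ⟨b₀.reindex (Fintype.equivOfCardEq h), fun x => ?_⟩
  rw [Module.Basis.range_reindex, mem_span_basisOfFractionalIdeal]
  simp [FractionalIdeal.mem_coeIdeal]

lemma mk0_mul_mk0_eq_one_iff (J I : (Ideal (𝓞 K))⁰) :
    ClassGroup.mk0 J * ClassGroup.mk0 I = 1 ↔
      ∃ a : 𝓞 K, Ideal.span {a} = (J : Ideal (𝓞 K)) * (I : Ideal (𝓞 K)) := by
  rw [← map_mul]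
  have h := ClassGroup.mk0_eq_one_iff (J * I).2
  rw [show (⟨((J * I : (Ideal (𝓞 K))⁰) : Ideal (𝓞 K)), (J * I).2⟩ : (Ideal (𝓞 K))⁰) = J * I
      from rfl,
    Submodule.isPrincipal_iff] at h
  simp only [Submonoid.coe_mul, Ideal.submodule_span_eq] at h
  exact h.trans ⟨fun ⟨a, ha⟩ => ⟨a, ha.symm⟩, fun ⟨a, ha⟩ => ⟨a, ha.symm⟩⟩

lemma exists_ideal_of_mem (J : (Ideal (𝓞 K))⁰) {S : Submodule ℤ K}
    (hb : ∀ x, x ∈ S ↔ ∃ a ∈ (J : Ideal (𝓞 K)), (a : K) = x) :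
    ∃ f : {x : K // x ∈ S ∧ x ≠ 0} →
        {I : (Ideal (𝓞 K))⁰ // ClassGroup.mk0 J * ClassGroup.mk0 I = 1},
      ∃ a : {x : K // x ∈ S ∧ x ≠ 0} → 𝓞 K, (∀ x, (a x : K) = x) ∧
        (∀ x, Ideal.span {a x} = (J : Ideal (𝓞 K)) * ((f x : (Ideal (𝓞 K))⁰) : Ideal (𝓞 K))) ∧
        Function.Surjective f ∧ ∀ x y, f x = f y ↔ ∃ u : (𝓞 K)ˣ, (y : K) = (u : K) * x := by
  have hJ0 : (J : Ideal (𝓞 K)) ≠ 0 := nonZeroDivisors.ne_zero J.2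
  have hex : ∀ x : {x : K // x ∈ S ∧ x ≠ 0},
      ∃ (I : {I : (Ideal (𝓞 K))⁰ // ClassGroup.mk0 J * ClassGroup.mk0 I = 1}) (a : 𝓞 K),
        (a : K) = x ∧
        Ideal.span {a} = (J : Ideal (𝓞 K)) * ((I : (Ideal (𝓞 K))⁰) : Ideal (𝓞 K)) := by
    intro ⟨x, hx, hx0⟩
    obtain ⟨a, ha, rfl⟩ := (hb x).1 hx
    have ha0 : a ≠ 0 := fun h => hx0 (by simp [h])
    obtain ⟨I, hI⟩ := Ideal.dvd_span_singleton.2 ha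
    have hI0 : I ≠ 0 := by
      rintro rfl
      rw [mul_zero, Ideal.zero_eq_bot, Ideal.span_singleton_eq_bot] at hI
      exact ha0 hI
    exact ⟨⟨⟨I, mem_nonZeroDivisors_iff_ne_zero.2 hI0⟩,
      (mk0_mul_mk0_eq_one_iff K J _).2 ⟨a, hI⟩⟩, a, rfl, hI⟩
  choose f a hfa hf using hex
  refine ⟨f, a, hfa, hf, ?_, fun x y => ?_⟩
  · intro ⟨I, hI⟩
    obtain ⟨y, hy⟩ := (mk0_mul_mk0_eq_one_iff K J I).1 hI
    have hyJI : y ∈ (J : Ideal (𝓞 K)) * (I : Ideal (𝓞 K)) := by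
      rw [← hy]
      exact Ideal.mem_span_singleton_self y
    have hyJ : y ∈ (J : Ideal (𝓞 K)) :=
      (Ideal.mul_le_left : (J : Ideal (𝓞 K)) * (I : Ideal (𝓞 K)) ≤ (J : Ideal (𝓞 K))) hyJI
    have hy0 : (y : K) ≠ 0 := by
      intro h
      have h : y = 0 := by simpa using h
      rw [h, Ideal.span_singleton_eq_bot.2 rfl] at hy
      exact mul_ne_zero hJ0 (nonZeroDivisors.ne_zero I.2) hy.symm
    obtain ⟨x, hx⟩ : ∃ x : {x : K // x ∈ S ∧ x ≠ 0}, (x : K) = y :=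
      ⟨⟨y, (hb y).2 ⟨y, hyJ, rfl⟩, hy0⟩, rfl⟩
    refine ⟨x, ?_⟩
    have h1 := hf x
    rw [RingOfIntegers.ext ((hfa x).trans hx), hy] at h1
    exact Subtype.ext (Subtype.ext (mul_left_cancel₀ hJ0 h1).symm)
  · have h1 : f x = f y ↔ Ideal.span {a x} = Ideal.span {a y} := by
      rw [hf, hf]
      exact ⟨fun h => by rw [h], fun h => Subtype.ext (Subtype.ext (mul_left_cancel₀ hJ0 h))⟩
    rw [h1, Ideal.span_singleton_eq_span_singleton, ← hfa, ← hfa]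
    constructor
    · intro ⟨u, hu⟩
      exact ⟨u, by rw [← hu, mul_comm]; simp⟩
    · intro ⟨u, hu⟩
      exact ⟨u, RingOfIntegers.ext (by rw [hu, mul_comm]; simp)⟩

lemma ofReal_cpow_eq_exp {z : ℝ} (hz : 0 < z) (s : ℂ) :
    (z : ℂ) ^ s = Complex.exp (Real.log z * s) := by
  rw [Complex.cpow_def_of_ne_zero (by exact_mod_cast hz.ne'), Complex.ofReal_log hz.le]

lemma ofReal_sq_cpow_neg {x y : ℝ} (hx : 0 < x) (hy : 0 < y) (w : ℂ) :
    (x : ℂ) ^ (2 * w) * (((x * y) ^ 2 : ℝ) : ℂ) ^ (-w) = (y : ℂ) ^ (-2 * w) := by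
  rw [ofReal_cpow_eq_exp hx, ofReal_cpow_eq_exp hy, ofReal_cpow_eq_exp (by positivity),
    ← Complex.exp_add, Real.log_pow, Real.log_mul hx.ne' hy.ne']
  congr 1
  push_cast
  ring

/-- The zeta function of an ideal class is given by a functional equation pair. -/
theorem exists_fePair_idealClass : ∃ c c' : ℝ, 0 < c ∧ ∀ J : (Ideal (𝓞 K))⁰,
    ∃ (P : WeakFEPair ℂ) (κ' : Type u) (p' : κ' → ℝ), P.k = 1 / 2 ∧ Countable κ' ∧
      (∀ k, 0 < p' k) ∧
      (∀ s : ℝ, 1 / 2 < s → Summable fun I : {I : (Ideal (𝓞 K))⁰ //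
        ClassGroup.mk0 J * ClassGroup.mk0 I = 1} =>
          (Ideal.absNorm (I : Ideal (𝓞 K)) : ℝ) ^ (-2 * s)) ∧
      (∀ s : ℝ, 1 / 2 < s → Summable fun k => p' k ^ (-s)) ∧
      (∀ w : ℂ, 1 / 2 < w.re → (Ideal.absNorm (J : Ideal (𝓞 K)) : ℂ) ^ (2 * w) * P.Λ w =
        c * zetaFactor (Module.finrank ℚ K) w * ∑' I : {I : (Ideal (𝓞 K))⁰ //
          ClassGroup.mk0 J * ClassGroup.mk0 I = 1},
            (Ideal.absNorm (I : Ideal (𝓞 K)) : ℂ) ^ (-2 * w)) ∧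
      (∀ w : ℂ, 1 / 2 < w.re → P.symm.Λ w = c' * zetaFactor (Module.finrank ℚ K) w *
        ∑' k, (p' k : ℂ) ^ (-w)) := by
  obtain ⟨c, c', hc, h⟩ := exists_fePair_lattice K
  refine ⟨c, c', hc, fun J => ?_⟩
  obtain ⟨b, hb⟩ := exists_basis_ideal K J
  set S := Submodule.span ℤ (Set.range b) with hS
  obtain ⟨f, a, hfa, hf, hfsurj, hfu⟩ := exists_ideal_of_mem K J hb
  have := NumberField.countable K
  have hcountI := hfsurj.countable
  obtain ⟨P, p, κ', p', hPk, hκ', hp, hp0, hp'0, hs, hs', hΛ, hΛ'⟩ := h S b hS (fun u x hx => by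
    obtain ⟨y, hy, rfl⟩ := (hb x).1 hx
    exact (hb _).2 ⟨u * y, Ideal.mul_mem_left _ _ hy, by simp⟩) _ f hcountI hfsurj hfu
  have hpI : ∀ I, p I = ((Ideal.absNorm (J : Ideal (𝓞 K)) : ℝ) *
      Ideal.absNorm ((I : (Ideal (𝓞 K))⁰) : Ideal (𝓞 K))) ^ 2 := fun I => by
    obtain ⟨x, rfl⟩ := hfsurj I
    rw [hp, ← Nat.cast_mul, ← map_mul, ← hf, Ideal.absNorm_span_singleton, ← hfa, Nat.cast_natAbs,
      Int.cast_abs, sq_abs, ← Algebra.coe_norm_int, Rat.cast_intCast]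
  have hJ1 : (0 : ℝ) < Ideal.absNorm (J : Ideal (𝓞 K)) := by
    exact_mod_cast Nat.pos_of_ne_zero (Ideal.absNorm_ne_zero_of_nonZeroDivisors J)
  have hI1 : ∀ I : (Ideal (𝓞 K))⁰, (0 : ℝ) < Ideal.absNorm (I : Ideal (𝓞 K)) := fun I => by
    exact_mod_cast Nat.pos_of_ne_zero
      (Ideal.absNorm_ne_zero_of_nonZeroDivisors (I : (Ideal (𝓞 K))⁰))
  refine ⟨P, κ', p', hPk, hκ', hp'0, fun s hs1 => ?_, hs', fun w hw => ?_, hΛ'⟩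
  · refine ((hs s hs1).mul_left ((Ideal.absNorm (J : Ideal (𝓞 K)) : ℝ) ^ (2 * s))).congr fun I => ?_
    rw [hpI, ← Real.rpow_natCast, ← Real.rpow_mul (by positivity), Real.mul_rpow hJ1.le (hI1 _).le,
      ← mul_assoc, ← Real.rpow_add hJ1]
    norm_num
  · rw [hΛ w hw, mul_left_comm, ← tsum_mul_left]
    congr 1
    refine tsum_congr fun I => ?_
    rw [hpI, ← Complex.ofReal_natCast, ← Complex.ofReal_natCast, ofReal_sq_cpow_neg hJ1 (hI1 _)]

end IdealClass

section DedekindCompleted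

open scoped nonZeroDivisors

/-- The entire function `w (w - 1/2) Λ(w)` attached to a functional equation pair of weight
`1/2`. -/
noncomputable def WeakFEPair.entireΛ (P : WeakFEPair ℂ) (w : ℂ) : ℂ :=
  w * (w - 1 / 2) * P.Λ₀ w - (w - 1 / 2) * P.f₀ + w * P.ε * P.g₀

lemma WeakFEPair.differentiable_entireΛ (P : WeakFEPair ℂ) : Differentiable ℂ P.entireΛ := by
  have := P.differentiable_Λ₀
  unfold WeakFEPair.entireΛ
  fun_prop

lemma WeakFEPair.entireΛ_eq (P : WeakFEPair ℂ) (hk : P.k = 1 / 2) {w : ℂ} (h0 : w ≠ 0)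
    (h1 : w ≠ 1 / 2) : P.entireΛ w = w * (w - 1 / 2) * P.Λ w := by
  have h2 : w - 1 / 2 ≠ 0 := sub_ne_zero.2 h1
  have h3 : (1 / 2 - w : ℂ) = -(w - 1 / 2) := by ring
  rw [WeakFEPair.entireΛ, WeakFEPair.Λ, hk]
  push_cast
  rw [h3, smul_eq_mul, smul_eq_mul, div_neg, div_eq_mul_inv, div_eq_mul_inv, one_mul]
  linear_combination (w - 1 / 2) * P.f₀ * mul_inv_cancel₀ h0 -
    w * P.ε * P.g₀ * mul_inv_cancel₀ h2

lemma WeakFEPair.exists_norm_entireΛ_le (P : WeakFEPair ℂ) (a b : ℝ) :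
    ∃ C, ∀ w : ℂ, a ≤ w.re → w.re ≤ b → ‖P.entireΛ w‖ ≤ C * (1 + ‖w‖) ^ 2 := by
  obtain ⟨C, hC⟩ := P.exists_norm_Λ₀_le a b
  refine ⟨C + ‖P.f₀‖ + ‖P.ε‖ * ‖P.g₀‖, fun w ha hb => ?_⟩
  have h1 := hC w ha hb
  have h2 : ‖w - 1 / 2‖ ≤ 1 + ‖w‖ := by
    refine (norm_sub_le _ _).trans ?_
    norm_num
    linarith
  have h3 := norm_nonneg w
  have h4 : ‖P.entireΛ w‖ ≤ ‖w‖ * ‖w - 1 / 2‖ * ‖P.Λ₀ w‖ + ‖w - 1 / 2‖ * ‖P.f₀‖ +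
      ‖w‖ * ‖P.ε‖ * ‖P.g₀‖ := by
    rw [WeakFEPair.entireΛ]
    refine (norm_add_le _ _).trans ?_
    gcongr
    · refine (norm_sub_le _ _).trans ?_
      simp
    · simp
  refine h4.trans ?_
  have h5 : ‖w‖ * ‖w - 1 / 2‖ * ‖P.Λ₀ w‖ ≤ (1 + ‖w‖) * (1 + ‖w‖) * C := by
    gcongr
    · linarith
  have h6 : ‖w - 1 / 2‖ * ‖P.f₀‖ ≤ (1 + ‖w‖) ^ 2 * ‖P.f₀‖ := by
    gcongr
    nlinarith
  have h7 : ‖w‖ * (‖P.ε‖ * ‖P.g₀‖) ≤ (1 + ‖w‖) ^ 2 * (‖P.ε‖ * ‖P.g₀‖) := by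
    gcongr
    nlinarith
  nlinarith

universe u

variable (K : Type u) [Field K] [NumberField K] [IsTotallyReal K]

/-- The completed Dedekind zeta function of a totally real field, with its poles removed. -/
theorem exists_completed_dedekind : ∃ (Ξ : ℂ → ℂ) (κ : Type u) (β : κ → ℂ) (l : κ → ℝ),
    Differentiable ℂ Ξ ∧ Countable κ ∧ (∀ k, 0 < l k) ∧
    (∀ s : ℝ, 1 / 2 < s → Summable fun k => ‖β k‖ * l k ^ (-s)) ∧
    (∀ a b : ℝ, ∃ C, ∀ w : ℂ, a ≤ w.re → w.re ≤ b → ‖Ξ w‖ ≤ C * (1 + ‖w‖) ^ 2) ∧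
    (∀ s : ℝ, 1 / 2 < s → Summable fun I : (Ideal (𝓞 K))⁰ =>
      (Ideal.absNorm (I : Ideal (𝓞 K)) : ℝ) ^ (-2 * s)) ∧
    (∀ w : ℂ, 1 / 2 < w.re → Ξ w = w * (w - 1 / 2) * (zetaFactor (Module.finrank ℚ K) w *
      ∑' I : (Ideal (𝓞 K))⁰, (Ideal.absNorm (I : Ideal (𝓞 K)) : ℂ) ^ (-2 * w))) ∧
    (∀ w : ℂ, w.re < 0 → Ξ w = w * (w - 1 / 2) * (zetaFactor (Module.finrank ℚ K) (1 / 2 - w) *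
      ∑' k, β k * (l k : ℂ) ^ (-(1 / 2 - w)))) := by
  obtain ⟨c, c', hc, h⟩ := exists_fePair_idealClass K
  choose J hJ using ClassGroup.mk0_surjective (R := 𝓞 K)
  choose P κ' p' hPk hκ' hp' hs hs' hΛ hΛ' using fun C => h (J C)
  have hc0 : (c : ℂ) ≠ 0 := by exact_mod_cast hc.ne'
  let N : ClassGroup (𝓞 K) → ℝ := fun C => Ideal.absNorm (J C : Ideal (𝓞 K))
  have hN : ∀ C, 0 < N C := fun C => by
    exact Nat.cast_pos.2 (Nat.pos_of_ne_zero (Ideal.absNorm_ne_zero_of_nonZeroDivisors (J C)))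
  have hNC : ∀ C, (N C : ℂ) ≠ 0 := fun C => by exact_mod_cast (hN C).ne'
  let e : (Σ C, {I : (Ideal (𝓞 K))⁰ // ClassGroup.mk0 (J C) * ClassGroup.mk0 I = 1}) ≃
      (Ideal (𝓞 K))⁰ :=
    (Equiv.sigmaCongrRight fun C => Equiv.subtypeEquivRight fun I => by
      rw [hJ, mul_eq_one_iff_eq_inv, eq_comm, inv_eq_iff_eq_inv, eq_comm (a := ClassGroup.mk0 I),
        eq_comm]).trans (Equiv.sigmaFiberEquiv fun I => (ClassGroup.mk0 I)⁻¹)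
  have hsI : ∀ s : ℝ, 1 / 2 < s → Summable fun I : (Ideal (𝓞 K))⁰ =>
      (Ideal.absNorm (I : Ideal (𝓞 K)) : ℝ) ^ (-2 * s) := fun s hs1 => by
    rw [← e.summable_iff]
    refine (summable_sigma_of_nonneg fun x => Real.rpow_nonneg (Nat.cast_nonneg _) _).2 ?_
    exact ⟨fun C => hs C s hs1, Summable.of_finite⟩
  have hNn : ∀ C, (N C : ℂ) = (Ideal.absNorm (J C : Ideal (𝓞 K)) : ℂ) := fun C =>
    Complex.ofReal_natCast _
  have hl0 : ∀ k : Σ C, κ' C, 0 < N k.1 ^ 2 * p' k.1 k.2 := fun k =>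
    mul_pos (pow_pos (hN _) 2) (hp' _ _)
  have hsl : ∀ s : ℝ, 1 / 2 < s → Summable fun k : Σ C, κ' C =>
      ‖(N k.1 * (P k.1).ε * c' * (c : ℂ)⁻¹ : ℂ)‖ *
        (N k.1 ^ 2 * p' k.1 k.2) ^ (-s) := fun s hs1 => by
    have h0 : ∀ k : Σ C, κ' C, 0 ≤ ‖(N k.1 * (P k.1).ε * c' * (c : ℂ)⁻¹ : ℂ)‖ *
        (N k.1 ^ 2 * p' k.1 k.2) ^ (-s) := fun k =>
      mul_nonneg (norm_nonneg _) (Real.rpow_nonneg (hl0 k).le _)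
    rw [summable_sigma_of_nonneg h0]
    refine ⟨fun C => ?_, Summable.of_finite⟩
    refine ((hs' C s hs1).mul_left (‖(N C * (P C).ε * c' * (c : ℂ)⁻¹ : ℂ)‖ *
      (N C ^ 2) ^ (-s))).congr fun k => ?_
    rw [Real.mul_rpow (sq_nonneg _) (hp' C k).le, mul_assoc]
  refine ⟨fun w => ∑ C, (N C : ℂ) ^ (2 * w) * (c : ℂ)⁻¹ * (P C).entireΛ w, Σ C, κ' C,
    fun k => N k.1 * (P k.1).ε * c' * (c : ℂ)⁻¹, fun k => N k.1 ^ 2 * p' k.1 k.2, ?_,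
    inferInstance, hl0, hsl, fun a b => ?_,
    hsI, fun w hw => ?_, fun w hw => ?_⟩
  · have h1 : ∀ C, Differentiable ℂ fun w : ℂ => (N C : ℂ) ^ (2 * w) := fun C =>
      (differentiable_id.const_mul (2 : ℂ)).const_cpow (Or.inl (hNC C))
    have h2 : ∀ C, Differentiable ℂ (P C).entireΛ := fun C => (P C).differentiable_entireΛ
    fun_prop
  · choose M hM using fun C => (P C).exists_norm_entireΛ_le a b
    refine ⟨∑ C, (N C ^ (2 * a) + N C ^ (2 * b)) * ‖(c : ℂ)⁻¹‖ * M C, fun w ha hb => ?_⟩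
    rw [Finset.sum_mul]
    refine norm_sum_le_of_le _ fun C _ => ?_
    have h1 : ‖(N C : ℂ) ^ (2 * w)‖ ≤ N C ^ (2 * a) + N C ^ (2 * b) := by
      rw [Complex.norm_cpow_eq_rpow_re_of_pos (hN C)]
      have h2 := Real.rpow_nonneg (hN C).le (2 * a)
      have h3 := Real.rpow_nonneg (hN C).le (2 * b)
      have h4 : (2 * w).re = 2 * w.re := by simp
      rw [h4]
      rcases le_total 1 (N C) with h | h
      · have := Real.rpow_le_rpow_of_exponent_le h (show 2 * w.re ≤ 2 * b by linarith)
        linarith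
      · have := Real.rpow_le_rpow_of_exponent_ge (hN C) h (show 2 * a ≤ 2 * w.re by linarith)
        linarith
    rw [norm_mul, norm_mul, mul_assoc _ (M C)]
    exact mul_le_mul (mul_le_mul_of_nonneg_right h1 (norm_nonneg _)) (hM C w ha hb)
      (norm_nonneg _) (mul_nonneg ((norm_nonneg _).trans h1) (norm_nonneg _))
  · have hw0 : w ≠ 0 := by
      rintro rfl
      norm_num at hw
    have hw1 : w ≠ 1 / 2 := by
      rintro rfl
      norm_num at hw
    have h1 : Summable fun I : (Ideal (𝓞 K))⁰ =>
        (Ideal.absNorm (I : Ideal (𝓞 K)) : ℂ) ^ (-2 * w) := by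
      refine Summable.of_norm ((hsI w.re hw).congr fun I => ?_)
      rw [Complex.norm_natCast_cpow_of_pos
        (Nat.pos_of_ne_zero (Ideal.absNorm_ne_zero_of_nonZeroDivisors I))]
      simp
    have h3 : (∑' I : (Ideal (𝓞 K))⁰, (Ideal.absNorm (I : Ideal (𝓞 K)) : ℂ) ^ (-2 * w)) =
        ∑ C, ∑' I : {I : (Ideal (𝓞 K))⁰ // ClassGroup.mk0 (J C) * ClassGroup.mk0 I = 1},
          (Ideal.absNorm (I : Ideal (𝓞 K)) : ℂ) ^ (-2 * w) := by
      rw [← e.tsum_eq]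
      exact (e.summable_iff.2 h1).tsum_sigma.trans (tsum_fintype _)
    rw [h3, Finset.mul_sum, Finset.mul_sum]
    refine Finset.sum_congr rfl fun C _ => ?_
    have h2 := hΛ C w hw
    rw [(P C).entireΛ_eq (hPk C) hw0 hw1, hNn]
    linear_combination w * (w - 1 / 2) * (c : ℂ)⁻¹ * h2 +
      w * (w - 1 / 2) * zetaFactor (Module.finrank ℚ K) w *
        (∑' I : {I : (Ideal (𝓞 K))⁰ // ClassGroup.mk0 (J C) * ClassGroup.mk0 I = 1},
          (Ideal.absNorm (I : Ideal (𝓞 K)) : ℂ) ^ (-2 * w)) * inv_mul_cancel₀ hc0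
  · have hw0 : w ≠ 0 := by
      rintro rfl
      norm_num at hw
    have hw1 : w ≠ 1 / 2 := by
      rintro rfl
      norm_num at hw
    have hw2 : 1 / 2 < (1 / 2 - w).re := by
      simp
      linarith
    have h1 : Summable fun k : Σ C, κ' C => (N k.1 * (P k.1).ε * c' * (c : ℂ)⁻¹ : ℂ) *
        ((N k.1 ^ 2 * p' k.1 k.2 : ℝ) : ℂ) ^ (-(1 / 2 - w)) := by
      refine Summable.of_norm ((hsl _ hw2).congr fun k => ?_)
      rw [norm_mul _ (_ ^ _), norm_ofReal_cpow_neg (hl0 k)]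
    have h3 := h1.tsum_sigma.trans (tsum_fintype _)
    rw [h3, Finset.mul_sum, Finset.mul_sum]
    refine Finset.sum_congr rfl fun C _ => ?_
    have h2 := hΛ' C _ hw2
    have h4 := (P C).functional_equation (1 / 2 - w)
    rw [hPk C, h2] at h4
    rw [show (((1 / 2 : ℝ) : ℂ) - (1 / 2 - w)) = w by push_cast; ring] at h4
    rw [(P C).entireΛ_eq (hPk C) hw0 hw1, h4, smul_eq_mul, ← tsum_mul_left, ← tsum_mul_left,
      ← tsum_mul_left, ← tsum_mul_left, ← tsum_mul_left, ← tsum_mul_left]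
    refine tsum_congr fun k => ?_
    have h5 : (N C : ℂ) ^ (2 * w) = N C * (((N C) ^ 2 : ℝ) : ℂ) ^ (-(1 / 2 - w)) := by
      rw [ofReal_cpow_eq_exp (hN C), ofReal_cpow_eq_exp (pow_pos (hN C) 2), Real.log_pow]
      conv_rhs => lhs; rw [← Real.exp_log (hN C), Complex.ofReal_exp]
      rw [← Complex.exp_add]
      congr 1
      push_cast
      ring
    rw [h5, Complex.ofReal_mul, Complex.mul_cpow_ofReal_nonneg (sq_nonneg _) (hp' C k).le]
    ring

end DedekindCompleted

section Stirling

open scoped Topology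

open Complex in
lemma Complex.log_add_one_eq {z : ℂ} (hz : 0 < z.re) : log (z + 1) = log z + log (1 + 1 / z) := by
  have h0 : z ≠ 0 := by
    rintro rfl
    simp at hz
  have hinv : 0 < (1 / z).re := by
    rw [one_div, inv_re]
    exact div_pos hz (normSq_pos.2 h0)
  have h1 : 0 < (1 + 1 / z).re := by
    rw [add_re, one_re]
    linarith
  have h2 : 1 + 1 / z ≠ 0 := fun h => by
    rw [h] at h1
    simp at h1
  have e : z + 1 = z * (1 + 1 / z) := by field_simp
  rw [e, log_mul_eq_add_log_iff h0 h2]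
  have a1 := abs_lt.1 (abs_arg_lt_pi_div_two_iff.2 (Or.inl hz))
  have a2 := abs_lt.1 (abs_arg_lt_pi_div_two_iff.2 (Or.inl h1))
  constructor <;> linarith [a1.1, a1.2, a2.1, a2.2]

/-- The increment of the logarithm of the remainder in Stirling's formula. -/
noncomputable def stirlingStep (z : ℂ) : ℂ := (z + 1 / 2) * Complex.log (1 + 1 / z) - 1

lemma norm_stirlingStep_le {z : ℂ} (hz : 2 ≤ ‖z‖) : ‖stirlingStep z‖ ≤ 2 / ‖z‖ ^ 2 := by
  have h0 : z ≠ 0 := norm_pos_iff.1 (by linarith)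
  set w := 1 / z with hw
  have hwn : ‖w‖ = 1 / ‖z‖ := by rw [hw, norm_div, norm_one]
  have hw1 : ‖w‖ ≤ 1 / 2 := by
    rw [hwn]
    exact one_div_le_one_div_of_le (by norm_num) hz
  have hw0 : 0 < ‖w‖ := by
    rw [hwn]
    positivity
  have h1 := Complex.norm_log_sub_logTaylor_le 2 (show ‖w‖ < 1 by linarith)
  set e := Complex.log (1 + w) - Complex.logTaylor 3 w with he
  have hT : Complex.logTaylor 3 w = w - w ^ 2 / 2 := by
    simp [Complex.logTaylor_succ, Complex.logTaylor_zero]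
    ring
  have hzw : z * w = 1 := by
    rw [hw]
    field_simp
  have hs : stirlingStep z = -(w ^ 2) / 4 + (z + 1 / 2) * e := by
    rw [stirlingStep, ← hw, show Complex.log (1 + w) = w - w ^ 2 / 2 + e by rw [he, hT]; ring]
    linear_combination (1 - w / 2) * hzw
  have hzn : ‖z‖ * ‖w‖ = 1 := by rw [← norm_mul, hzw, norm_one]
  have he3 : ‖e‖ ≤ ‖w‖ ^ 3 * (2 / 3) := by
    refine h1.trans ?_
    have : (1 - ‖w‖)⁻¹ ≤ 2 := by
      rw [inv_le_comm₀ (by linarith) (by norm_num)]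
      linarith
    have h3 := mul_le_mul_of_nonneg_left this (pow_nonneg hw0.le 3)
    norm_num
    linarith
  have hzz : ‖z + 1 / 2‖ ≤ ‖z‖ + 1 / 2 := by
    refine (norm_add_le _ _).trans ?_
    norm_num
  have h5 : ‖stirlingStep z‖ ≤ ‖w‖ ^ 2 / 4 + (‖z‖ + 1 / 2) * (‖w‖ ^ 3 * (2 / 3)) := by
    rw [hs]
    refine (norm_add_le _ _).trans (add_le_add ?_ ?_)
    · simp
    · rw [norm_mul]
      exact mul_le_mul hzz he3 (norm_nonneg _) (by positivity)
  have h6 : 2 / ‖z‖ ^ 2 = 2 * ‖w‖ ^ 2 := by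
    rw [hwn]
    ring
  rw [h6]
  have h7 : ‖z‖ * ‖w‖ ^ 3 = ‖w‖ ^ 2 := by linear_combination ‖w‖ ^ 2 * hzn
  nlinarith [pow_pos hw0 2, pow_pos hw0 3]

/-- The remainder in Stirling's formula. -/
noncomputable def stirlingRem (z : ℂ) : ℂ :=
  Complex.Gamma z * Complex.exp (-((z - 1 / 2) * Complex.log z - z))

lemma stirlingRem_eq {z : ℂ} (hz : 0 < z.re) :
    stirlingRem z = stirlingRem (z + 1) * Complex.exp (stirlingStep z) := by
  have h0 : z ≠ 0 := by
    rintro rfl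
    simp at hz
  rw [stirlingRem, stirlingRem, Complex.Gamma_add_one z h0, stirlingStep, Complex.log_add_one_eq hz,
    mul_assoc, ← Complex.exp_add]
  conv_rhs => rw [mul_comm z, mul_assoc]; rw [← Complex.exp_log h0,
      ← Complex.exp_add, Complex.exp_log h0]
  congr 2
  ring

lemma stirlingRem_eq_mul_exp_sum {z : ℂ} (hz : 0 < z.re) (m : ℕ) :
    stirlingRem z = stirlingRem (z + m) *
      Complex.exp (∑ j ∈ Finset.range m, stirlingStep (z + j)) := by
  induction m with
  | zero => simp
  | succ m ih =>
    have h : 0 < (z + m).re := by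
      simp
      positivity
    rw [ih, stirlingRem_eq h, Finset.sum_range_succ, Complex.exp_add]
    push_cast
    ring_nf

lemma sum_one_div_sq_add_sq_le {t : ℝ} (ht : 2 ≤ t) (m : ℕ) :
    ∑ j ∈ Finset.range m, 1 / (t ^ 2 + (j : ℝ) ^ 2) ≤ 4 / t := by
  have h1 : ∀ m : ℕ, ∑ j ∈ Finset.range m, 1 / (t ^ 2 + (j : ℝ) ^ 2) ≤
      2 / (t - 1) - 2 / (t + m - 1) := fun m => by
    induction m with
    | zero => simp
    | succ m ih =>
      rw [Finset.sum_range_succ]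
      have hm : (0 : ℝ) ≤ m := Nat.cast_nonneg m
      have h2 : 1 / (t ^ 2 + (m : ℝ) ^ 2) ≤ 2 / (t + m - 1) - 2 / (t + m) := by
        rw [div_sub_div _ _ (by linarith) (by linarith),
          div_le_div_iff₀ (by nlinarith) (mul_pos (by linarith) (by linarith))]
        nlinarith [sq_nonneg (t - m)]
      push_cast
      rw [show t + ((m : ℝ) + 1) - 1 = t + m by ring]
      linarith
  refine (h1 m).trans ?_
  have hm : (0 : ℝ) ≤ m := Nat.cast_nonneg m
  have h3 : 0 ≤ 2 / (t + m - 1) := div_nonneg (by norm_num) (by linarith)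
  have h4 : 2 / (t - 1) ≤ 4 / t := by
    rw [div_le_div_iff₀ (by linarith) (by linarith)]
    linarith
  linarith

lemma Gamma_add_natCast_eq_prod {z : ℂ} (hz : 0 < z.re) (m : ℕ) :
    Complex.Gamma (z + m) = (∏ j ∈ Finset.range m, (z + j)) * Complex.Gamma z := by
  induction m with
  | zero => simp
  | succ m ih =>
    have h : z + m ≠ 0 := fun h => by
      have := congrArg Complex.re h
      simp at this
      linarith [(Nat.cast_nonneg m : (0 : ℝ) ≤ m)]
    rw [Nat.cast_succ, ← add_assoc, Complex.Gamma_add_one _ h, ih, Finset.prod_range_succ]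
    ring

lemma stirlingRem_add_natCast_eq {z : ℂ} (hz : 0 < z.re) {m : ℕ} (hm : 0 < m) :
    stirlingRem (z + (m + 1 : ℕ)) = Complex.Gamma z / Complex.GammaSeq z m *
      ((Stirling.stirlingSeq m * √2 : ℝ) : ℂ) *
      Complex.exp (-(m * Complex.log (1 + (z + 1) / m)) -
        (z + 1 / 2) * Complex.log (1 + (z + 1) / m) + (z + 1)) := by
  have hm' : (0 : ℝ) < m := Nat.cast_pos.2 hm
  have hmc : (m : ℂ) ≠ 0 := Nat.cast_ne_zero.2 hm.ne'
  have hP : ∏ j ∈ Finset.range (m + 1), (z + j) ≠ 0 := by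
    refine Finset.prod_ne_zero_iff.2 fun j _ h => ?_
    have := congrArg Complex.re h
    simp at this
    linarith [(Nat.cast_nonneg j : (0 : ℝ) ≤ j)]
  have h1 : 0 < (1 + (z + 1) / m).re := by
    have : ((z + 1) / (m : ℂ)).re = (z.re + 1) / m := by
      rw [Complex.div_natCast_re]
      simp
    rw [Complex.add_re, this, Complex.one_re]
    positivity
  have h1' : 1 + (z + 1) / m ≠ 0 := fun h => by
    rw [h] at h1
    simp at h1
  have hlog : Complex.log (z + (m + 1 : ℕ)) = (Real.log m : ℂ) + Complex.log (1 + (z + 1) / m) := by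
    rw [← Complex.log_ofReal_mul hm' h1']
    congr 1
    push_cast
    field_simp
    ring
  have hfac : ((m.factorial : ℕ) : ℂ) = ((Stirling.stirlingSeq m * √2 : ℝ) : ℂ) *
      Complex.exp ((1 / 2 + m) * (Real.log m : ℂ) - m) := by
    have : (m.factorial : ℝ) = Stirling.stirlingSeq m * √2 *
        Real.exp ((1 / 2 + m) * Real.log m - m) := by
      have e1 : Real.exp ((1 / 2 + m) * Real.log m - m) = √m * (m / Real.exp 1) ^ m := by
        rw [div_pow, ← Real.exp_nat_mul, mul_one, Real.exp_sub, add_mul, Real.exp_add,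
          Real.exp_nat_mul, Real.exp_log hm', Real.sqrt_eq_rpow, Real.rpow_def_of_pos hm',
          mul_comm (1 / 2), mul_div_assoc]
      have h2 : √(m : ℝ) ≠ 0 := (Real.sqrt_pos.2 hm').ne'
      have h3 : (m / Real.exp 1) ^ m ≠ 0 := (pow_pos (div_pos hm' (Real.exp_pos 1)) m).ne'
      rw [e1, Stirling.stirlingSeq, Real.sqrt_mul (by norm_num)]
      field_simp
    rw [show ((m.factorial : ℕ) : ℂ) = ((m.factorial : ℝ) : ℂ) by norm_cast, this]
    push_cast
    rfl
  have hs : (m : ℂ) ^ z = Complex.exp (z * (Real.log m : ℂ)) := by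
    rw [Complex.cpow_def_of_ne_zero hmc, ← Complex.ofReal_natCast, ← Complex.ofReal_log hm'.le,
      mul_comm]
  rw [stirlingRem, Gamma_add_natCast_eq_prod hz, Complex.GammaSeq, hlog, hs, hfac]
  have hS : ((Stirling.stirlingSeq m * √2 : ℝ) : ℂ) ≠ 0 := by
    intro h
    rw [h, zero_mul] at hfac
    exact Nat.cast_ne_zero.2 m.factorial_ne_zero hfac
  rw [div_div_eq_mul_div, div_mul_eq_mul_div, div_mul_eq_mul_div,
    eq_div_iff (mul_ne_zero (Complex.exp_ne_zero _) (mul_ne_zero hS (Complex.exp_ne_zero _)))]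
  set ℓ := Complex.log (1 + (z + 1) / m)
  set L := (Real.log m : ℂ)
  have key : Complex.exp (-((z + (m + 1 : ℕ) - 1 / 2) * (L + ℓ) - (z + (m + 1 : ℕ)))) *
      Complex.exp (z * L) * Complex.exp ((1 / 2 + m) * L - m) =
      Complex.exp (-(m * ℓ) - (z + 1 / 2) * ℓ + (z + 1)) := by
    rw [← Complex.exp_add, ← Complex.exp_add]
    congr 1
    push_cast
    ring
  rw [← key]
  ring

lemma tendsto_stirlingRem_add_natCast {z : ℂ} (hz : 0 < z.re) :
    Tendsto (fun m : ℕ => stirlingRem (z + m)) atTop (𝓝 ((√π * √2 : ℝ) : ℂ)) := by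
  rw [← tendsto_add_atTop_iff_nat 1]
  have hG : Complex.Gamma z ≠ 0 := Complex.Gamma_ne_zero_of_re_pos hz
  have a1 : Tendsto (fun m : ℕ => Complex.Gamma z / Complex.GammaSeq z m) atTop (𝓝 1) := by
    have := (tendsto_const_nhds (x := Complex.Gamma z)).div (Complex.GammaSeq_tendsto_Gamma z) hG
    rwa [div_self hG] at this
  have a2 : Tendsto (fun m : ℕ => ((Stirling.stirlingSeq m * √2 : ℝ) : ℂ)) atTop
      (𝓝 ((√π * √2 : ℝ) : ℂ)) :=
    (Complex.continuous_ofReal.tendsto _).comp (Stirling.tendsto_stirlingSeq_sqrt_pi.mul_const _)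
  have a3 : Tendsto (fun m : ℕ => (m : ℂ)⁻¹) atTop (𝓝 0) := tendsto_inv_atTop_nhds_zero_nat
  have a4 : Tendsto (fun m : ℕ => (m : ℂ) * Complex.log (1 + (z + 1) / m)) atTop (𝓝 (z + 1)) := by
    refine Complex.tendsto_nat_mul_log_one_add_of_tendsto ?_
    refine tendsto_const_nhds.congr' ?_
    filter_upwards [eventually_gt_atTop 0] with m hm
    have : (m : ℂ) ≠ 0 := Nat.cast_ne_zero.2 hm.ne'
    field_simp
  have a5 : Tendsto (fun m : ℕ => Complex.log (1 + (z + 1) / m)) atTop (𝓝 0) := by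
    have := a3.mul a4
    rw [zero_mul] at this
    refine this.congr' ?_
    filter_upwards [eventually_gt_atTop 0] with m hm
    have : (m : ℂ) ≠ 0 := Nat.cast_ne_zero.2 hm.ne'
    field_simp
  have a6 := (a1.mul a2).mul ((Complex.continuous_exp.tendsto _).comp
    ((a4.neg.sub (a5.const_mul (z + 1 / 2))).add_const (z + 1)))
  simp only [mul_zero, sub_zero, neg_add_cancel, Complex.exp_zero, mul_one, one_mul] at a6
  refine a6.congr' ?_
  filter_upwards [eventually_gt_atTop 0] with m hm
  exact (stirlingRem_add_natCast_eq hz hm).symm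

lemma norm_stirlingRem_sub_le {z : ℂ} (hz : 0 < z.re) (ht : 8 ≤ z.im) :
    ‖stirlingRem z - (√π * √2 : ℝ)‖ ≤ 16 * (√π * √2) / z.im := by
  have h1 := tendsto_stirlingRem_add_natCast hz
  have h2 : Tendsto (fun m : ℕ => ‖stirlingRem z - stirlingRem (z + m)‖) atTop
      (𝓝 ‖stirlingRem z - (√π * √2 : ℝ)‖) := (tendsto_const_nhds.sub h1).norm
  have h3 : Tendsto (fun m : ℕ => ‖stirlingRem (z + m)‖ * (16 / z.im)) atTop
      (𝓝 (‖((√π * √2 : ℝ) : ℂ)‖ * (16 / z.im))) := h1.norm.mul_const _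
  have h4 := le_of_tendsto_of_tendsto' h2 h3 fun m => by
    set S := ∑ j ∈ Finset.range m, stirlingStep (z + j) with hS
    have h5 : ‖S‖ ≤ 8 / z.im := by
      refine (norm_sum_le _ _).trans ?_
      have h6 : ∀ j ∈ Finset.range m, ‖stirlingStep (z + j)‖ ≤
          2 * (1 / (z.im ^ 2 + (j : ℝ) ^ 2)) := fun j _ => by
        have hj : (0 : ℝ) ≤ j := Nat.cast_nonneg j
        have h7 : ‖z + j‖ ^ 2 = (z.re + j) ^ 2 + z.im ^ 2 := by
          rw [Complex.sq_norm, Complex.normSq_apply]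
          simp
          ring
        have h8 : z.im ^ 2 + (j : ℝ) ^ 2 ≤ ‖z + j‖ ^ 2 := by
          rw [h7]
          nlinarith
        have h9 : 2 ≤ ‖z + j‖ := by
          refine le_of_sq_le_sq ?_ (norm_nonneg _)
          nlinarith
        refine (norm_stirlingStep_le h9).trans ?_
        rw [mul_one_div]
        exact div_le_div_of_nonneg_left (by norm_num) (by nlinarith) h8
      refine (Finset.sum_le_sum h6).trans ?_
      rw [← Finset.mul_sum]
      have := sum_one_div_sq_add_sq_le (show 2 ≤ z.im by linarith) m
      calc _ ≤ 2 * (4 / z.im) := by gcongr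
        _ = _ := by ring
    have h6 : ‖S‖ ≤ 1 := h5.trans (by rw [div_le_one (by linarith)]; exact ht)
    rw [stirlingRem_eq_mul_exp_sum hz m, ← hS, ← mul_sub_one, norm_mul]
    refine mul_le_mul_of_nonneg_left ?_ (norm_nonneg _)
    refine (Complex.norm_exp_sub_one_le h6).trans ?_
    calc 2 * ‖S‖ ≤ 2 * (8 / z.im) := by gcongr
      _ = _ := by ring
  rw [Complex.norm_real, Real.norm_of_nonneg (by positivity)] at h4
  exact h4.trans_eq (by ring)

end Stirling

section IsStirling

open scoped Topology

/-- The main term `t ^ α * exp (-β t) * exp (i γ (t log t - t))`. -/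
noncomputable def stirlingMain (α β γ t : ℝ) : ℂ :=
  Complex.exp ((α * Real.log t - β * t : ℝ) + (γ * (t * Real.log t - t) : ℝ) * Complex.I)

lemma stirlingMain_ne_zero (α β γ t : ℝ) : stirlingMain α β γ t ≠ 0 := Complex.exp_ne_zero _

lemma stirlingMain_add (α β γ α' β' γ' t : ℝ) :
    stirlingMain (α + α') (β + β') (γ + γ') t =
      stirlingMain α β γ t * stirlingMain α' β' γ' t := by
  rw [stirlingMain, stirlingMain, stirlingMain, ← Complex.exp_add]
  congr 1
  push_cast
  ring

lemma stirlingMain_neg (α β γ t : ℝ) :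
    stirlingMain (-α) (-β) (-γ) t = (stirlingMain α β γ t)⁻¹ := by
  rw [stirlingMain, stirlingMain, ← Complex.exp_neg]
  congr 1
  push_cast
  ring

lemma star_stirlingMain (α β γ t : ℝ) :
    (starRingEnd ℂ) (stirlingMain α β γ t) = stirlingMain α β (-γ) t := by
  rw [stirlingMain, stirlingMain, ← Complex.exp_conj]
  simp

lemma norm_stirlingMain {t : ℝ} (ht : 0 < t) (α γ : ℝ) : ‖stirlingMain α 0 γ t‖ = t ^ α := by
  rw [stirlingMain, Complex.norm_exp, Real.rpow_def_of_pos ht]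
  simp [mul_comm]

/-- `f t` is `κ * stirlingMain α β γ t * (1 + O(1 / t))` as `t → ∞`, for some `κ ≠ 0`. -/
def IsStirling (f : ℝ → ℂ) (α β γ : ℝ) : Prop :=
  ∃ κ : ℂ, κ ≠ 0 ∧ (fun t => f t / stirlingMain α β γ t - κ) =O[atTop] fun t : ℝ => t⁻¹

lemma isBigO_one_of_isBigO_inv {g : ℝ → ℂ} {κ : ℂ}
    (h : (fun t => g t - κ) =O[atTop] fun t : ℝ => t⁻¹) :
    Tendsto g atTop (𝓝 κ) := by
  have := h.trans_tendsto tendsto_inv_atTop_zero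
  simpa using this.add_const κ

namespace IsStirling

variable {f g : ℝ → ℂ} {α β γ α' β' γ' : ℝ}

lemma mul (hf : IsStirling f α β γ) (hg : IsStirling g α' β' γ') :
    IsStirling (fun t => f t * g t) (α + α') (β + β') (γ + γ') := by
  obtain ⟨κ, h0, h⟩ := hf
  obtain ⟨κ', h0', h'⟩ := hg
  refine ⟨κ * κ', mul_ne_zero h0 h0', ?_⟩
  have h1 := (isBigO_one_of_isBigO_inv h').isBigO_one ℝ
  have h2 := ((h.mul h1).congr_right fun t => mul_one _).add (h'.const_mul_left κ)
  refine h2.congr_left fun t => ?_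
  rw [stirlingMain_add, mul_div_mul_comm]
  ring

lemma inv (hf : IsStirling f α β γ) : IsStirling (fun t => (f t)⁻¹) (-α) (-β) (-γ) := by
  obtain ⟨κ, h0, h⟩ := hf
  refine ⟨κ⁻¹, inv_ne_zero h0, ?_⟩
  have ht := isBigO_one_of_isBigO_inv h
  have h1 := (ht.inv₀ h0).isBigO_one ℝ
  have h2 := (h1.mul (isBigO_const_const (-κ⁻¹) (one_ne_zero (α := ℝ)) atTop)).mul h
  simp only [one_mul] at h2
  refine h2.congr' ?_ EventuallyEq.rfl
  filter_upwards [ht.eventually_ne h0] with t ht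
  rw [stirlingMain_neg, div_inv_eq_mul, show (f t)⁻¹ * stirlingMain α β γ t =
    (f t / stirlingMain α β γ t)⁻¹ by rw [inv_div, mul_comm, div_eq_mul_inv]]
  generalize f t / stirlingMain α β γ t = u at ht
  field_simp
  ring

lemma star (hf : IsStirling f α β γ) : IsStirling (fun t => (starRingEnd ℂ) (f t)) α β (-γ) := by
  obtain ⟨κ, h0, h⟩ := hf
  refine ⟨(starRingEnd ℂ) κ, (map_ne_zero _).2 h0, ?_⟩
  have h1 : (fun t => (starRingEnd ℂ) (f t / stirlingMain α β γ t - κ)) =O[atTop]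
      fun t : ℝ => t⁻¹ :=
    IsBigO.of_norm_left (h.norm_left.congr_left fun t => (RCLike.norm_conj _).symm)
  exact h1.congr_left fun t => by simp [star_stirlingMain]

lemma pow (hf : IsStirling f α β γ) (n : ℕ) :
    IsStirling (fun t => f t ^ n) (n * α) (n * β) (n * γ) := by
  induction n with
  | zero =>
    refine ⟨1, one_ne_zero, ?_⟩
    simp [stirlingMain, isBigO_zero]
  | succ n ih =>
    have := ih.mul hf
    simp only [pow_succ]
    convert this using 1 <;> push_cast <;> ring

lemma isBigO (hf : IsStirling f α 0 γ) : f =O[atTop] fun t : ℝ => t ^ α := by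
  obtain ⟨κ, h0, h⟩ := hf
  have h1 : (fun t => stirlingMain α 0 γ t) =O[atTop] fun t : ℝ => t ^ α := by
    refine IsBigO.of_bound 1 ?_
    filter_upwards [eventually_gt_atTop 0] with t ht
    rw [norm_stirlingMain ht, one_mul]
    exact le_abs_self _
  have h2 := ((isBigO_one_of_isBigO_inv h).isBigO_one ℝ).mul h1
  refine h2.congr (fun t => ?_) fun t => one_mul _
  rw [div_mul_cancel₀ _ (stirlingMain_ne_zero _ _ _ _)]

end IsStirling

lemma isStirling_ofReal_add_mul_I (σ : ℝ) :
    IsStirling (fun t => (σ : ℂ) + t * Complex.I) 1 0 0 := by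
  refine ⟨Complex.I, Complex.I_ne_zero, ?_⟩
  have h : (fun t : ℝ => (σ : ℂ) * ((t⁻¹ : ℝ) : ℂ)) =O[atTop] fun t : ℝ => t⁻¹ := by
    refine IsBigO.const_mul_left ?_ _
    refine IsBigO.of_norm_left ?_
    simp only [Complex.norm_real]
    exact (isBigO_refl _ _).norm_left
  refine h.congr' ?_ EventuallyEq.rfl
  filter_upwards [eventually_gt_atTop 0] with t ht
  have : stirlingMain 1 0 0 t = t := by
    rw [stirlingMain]
    simp only [one_mul, zero_mul, sub_zero, Complex.ofReal_zero, add_zero]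
    rw [← Complex.ofReal_exp, Real.exp_log ht]
  rw [this]
  have ht' : (t : ℂ) ≠ 0 := Complex.ofReal_ne_zero.2 ht.ne'
  push_cast
  field_simp
  ring

lemma log_ofReal_add_mul_I {σ t : ℝ} (hσ : 0 < σ) (ht : 0 < t) :
    Complex.log ((σ : ℂ) + t * Complex.I) =
      Real.log t + (π / 2 : ℝ) * Complex.I + Complex.log (1 - σ / t * Complex.I) := by
  have hd : 0 < σ / t := div_pos hσ ht
  have h1 : 1 - (σ : ℂ) / t * Complex.I ≠ 0 := fun h => by
    have := congrArg Complex.re h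
    simp [← Complex.ofReal_div] at this
  have ht' : (t : ℂ) ≠ 0 := Complex.ofReal_ne_zero.2 ht.ne'
  have e : (σ : ℂ) + t * Complex.I = (t : ℝ) * (Complex.I * (1 - σ / t * Complex.I)) := by
    field_simp
    linear_combination σ * Complex.I_sq
  rw [e, Complex.log_ofReal_mul ht (mul_ne_zero Complex.I_ne_zero h1),
    (Complex.log_mul_eq_add_log_iff Complex.I_ne_zero h1).2, Complex.log_I]
  · push_cast
    ring
  · rw [Complex.arg_I]
    have a1 := Complex.abs_arg_lt_pi_div_two_iff.2
      (Or.inl (show 0 < (1 - (σ : ℂ) / t * Complex.I).re by simp [← Complex.ofReal_div]))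
    have a2 : Complex.arg (1 - (σ : ℂ) / t * Complex.I) < 0 := by
      rw [Complex.arg_neg_iff]
      simp [← Complex.ofReal_div, hd]
    have a3 := abs_lt.1 a1
    constructor <;> linarith [a3.1, Real.pi_pos]

lemma isStirling_Gamma_of_pos {σ : ℝ} (hσ : 0 < σ) :
    IsStirling (fun t => Complex.Gamma (σ + t * Complex.I)) (σ - 1 / 2) (π / 2) 1 := by
  set ℓ : ℝ → ℂ := fun t => Complex.log (1 - σ / t * Complex.I) with hℓ
  set C : ℂ := (σ - 1 / 2) * (π / 2 : ℝ) * Complex.I with hC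
  set d : ℝ → ℂ := fun t => (σ - 1 / 2) * ℓ t + (t * Complex.I * ℓ t - σ) with hd
  have hinv : Tendsto (fun t : ℝ => t⁻¹) atTop (𝓝 0) := tendsto_inv_atTop_zero
  have hu : (fun t : ℝ => -((σ : ℂ) / t * Complex.I)) =O[atTop] fun t : ℝ => t⁻¹ := by
    refine IsBigO.of_bound σ (Eventually.of_forall fun t => ?_)
    simp [abs_of_pos hσ, div_eq_mul_inv]
  have hu0 : Tendsto (fun t : ℝ => -((σ : ℂ) / t * Complex.I)) atTop (𝓝 0) :=
    hu.trans_tendsto hinv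
  have hlog : (fun t : ℝ => ℓ t + (σ : ℂ) / t * Complex.I) =O[atTop] fun t : ℝ => t⁻¹ ^ 2 := by
    have : (fun u : ℂ => Complex.log (1 + u) - u) =O[𝓝 0] fun u => u ^ 2 := by
      refine IsBigO.of_bound 1 ?_
      filter_upwards [Metric.ball_mem_nhds (0 : ℂ) (show (0 : ℝ) < 1 / 2 by norm_num)] with u hu
      rw [mem_ball_zero_iff] at hu
      refine (Complex.norm_log_one_add_sub_self_le (by linarith)).trans ?_
      have : (1 - ‖u‖)⁻¹ ≤ 2 := by
        rw [inv_le_comm₀ (by linarith) (by norm_num)]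
        linarith
      rw [norm_pow]
      nlinarith [sq_nonneg ‖u‖]
    refine ((this.comp_tendsto hu0).trans (hu.pow 2)).congr_left fun t => ?_
    simp [hℓ, sub_eq_add_neg]
  have hℓO : ℓ =O[atTop] fun t : ℝ => t⁻¹ := by
    have : (fun t : ℝ => t⁻¹ ^ 2) =O[atTop] fun t : ℝ => t⁻¹ := by
      simpa [pow_two] using (isBigO_refl (fun t : ℝ => t⁻¹) atTop).mul (hinv.isBigO_one ℝ)
    refine ((hlog.trans this).add hu).congr_left fun t => ?_
    ring
  have hdO : d =O[atTop] fun t : ℝ => t⁻¹ := by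
    refine (hℓO.const_mul_left _).add ?_
    have h1 : (fun t : ℝ => (t : ℂ) * Complex.I) =O[atTop] fun t : ℝ => t :=
      IsBigO.of_bound 1 (Eventually.of_forall fun t => by simp)
    refine (h1.mul hlog).congr' ?_ ?_
    · filter_upwards [eventually_gt_atTop 0] with t ht
      have ht' : (t : ℂ) ≠ 0 := Complex.ofReal_ne_zero.2 ht.ne'
      field_simp
      linear_combination σ * Complex.I_sq
    · filter_upwards [eventually_gt_atTop 0] with t ht
      field_simp
  have hexp : (fun t => Complex.exp (d t) - 1) =O[atTop] fun t : ℝ => t⁻¹ := by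
    have h1 : (fun u : ℂ => Complex.exp u - 1) =O[𝓝 0] fun u => u := by
      simpa using (Complex.hasDerivAt_exp 0).isBigO_sub
    exact (h1.comp_tendsto (hdO.trans_tendsto hinv)).trans hdO
  have hR : (fun t : ℝ => stirlingRem (σ + t * Complex.I) - (√π * √2 : ℝ)) =O[atTop]
      fun t : ℝ => t⁻¹ := by
    refine IsBigO.of_bound (16 * (√π * √2)) ?_
    filter_upwards [eventually_ge_atTop 8] with t ht
    have := norm_stirlingRem_sub_le (z := σ + t * Complex.I) (by simpa using hσ) (by simpa using ht)
    simp only [Complex.add_im, Complex.ofReal_im, Complex.mul_im, Complex.ofReal_re, Complex.I_im,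
      mul_one, Complex.I_re, mul_zero, add_zero, zero_add] at this
    rwa [Real.norm_of_nonneg (by positivity), ← div_eq_mul_inv]
  have hc : (√π * √2 : ℝ) ≠ 0 := by positivity
  refine ⟨(√π * √2 : ℝ) * Complex.exp C, mul_ne_zero (Complex.ofReal_ne_zero.2 hc)
    (Complex.exp_ne_zero _), ?_⟩
  have h1 := (isBigO_one_of_isBigO_inv hR).isBigO_one ℝ
  have h2 := ((h1.mul hexp).congr_right fun t => one_mul _).add hR
  refine (h2.const_mul_left (Complex.exp C)).congr' ?_ EventuallyEq.rfl
  filter_upwards [eventually_gt_atTop 0] with t ht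
  have hG : Complex.Gamma (σ + t * Complex.I) = stirlingRem (σ + t * Complex.I) *
      Complex.exp ((σ + t * Complex.I - 1 / 2) * Complex.log (σ + t * Complex.I) -
        (σ + t * Complex.I)) := by
    rw [stirlingRem, mul_assoc, ← Complex.exp_add, neg_add_cancel, Complex.exp_zero, mul_one]
  have hm : Complex.exp ((σ + t * Complex.I - 1 / 2) * Complex.log (σ + t * Complex.I) -
        (σ + t * Complex.I)) = stirlingMain (σ - 1 / 2) (π / 2) 1 t *
        (Complex.exp C * Complex.exp (d t)) := by
    rw [stirlingMain, ← Complex.exp_add, ← Complex.exp_add, log_ofReal_add_mul_I hσ ht, hC, hd]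
    congr 1
    simp only [hℓ]
    push_cast
    linear_combination (π / 2 * t : ℂ) * Complex.I_sq
  rw [hG, hm, mul_left_comm, mul_div_cancel_left₀ _ (stirlingMain_ne_zero _ _ _ _)]
  ring

/-- Stirling's formula for `Γ` on vertical lines. -/
lemma isStirling_Gamma (σ : ℝ) :
    IsStirling (fun t => Complex.Gamma (σ + t * Complex.I)) (σ - 1 / 2) (π / 2) 1 := by
  obtain ⟨m, hm⟩ := exists_nat_gt (-σ)
  induction m generalizing σ with
  | zero => exact isStirling_Gamma_of_pos (by simpa using hm)
  | succ m ih =>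
    have h1 := (ih (σ + 1) (by push_cast at hm; linarith)).mul (isStirling_ofReal_add_mul_I σ).inv
    obtain ⟨κ, h0, h⟩ := h1
    refine ⟨κ, h0, h.congr' ?_ EventuallyEq.rfl⟩
    filter_upwards [eventually_gt_atTop 0] with t ht
    have hz : (σ : ℂ) + t * Complex.I ≠ 0 := fun h => by
      have := congrArg Complex.im h
      simp at this
      linarith
    rw [show ((σ + 1 : ℝ) : ℂ) + t * Complex.I = σ + t * Complex.I + 1 by push_cast; ring,
      Complex.Gamma_add_one _ hz]
    congr 1
    rw [mul_comm, inv_mul_cancel_left₀ hz]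
    congr 2 <;> ring

end IsStirling

section Oscillatory

open scoped Topology Interval

/-- Abel summation for integrals against a monotone weight. -/
lemma norm_integral_smul_le_of_monotoneOn {g : ℝ → ℂ} {h h' : ℝ → ℝ} {u v M : ℝ} (huv : u ≤ v)
    (hg : ContinuousOn g (Set.Icc u v)) (hh : ∀ x ∈ Set.Icc u v, HasDerivAt h (h' x) x)
    (hh' : ContinuousOn h' (Set.Icc u v))
    (hsign : (∀ x ∈ Set.Icc u v, 0 ≤ h' x) ∨ ∀ x ∈ Set.Icc u v, h' x ≤ 0)
    (hM : ∀ w ∈ Set.Icc u v, ‖∫ x in u..w, g x‖ ≤ M) :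
    ‖∫ x in u..v, (h x : ℂ) * g x‖ ≤ M * (|h v| + |h v - h u|) := by
  have hI : Set.uIcc u v = Set.Icc u v := Set.uIcc_of_le huv
  set G : ℝ → ℂ := fun w => ∫ x in u..w, g x with hG
  have hgi : IntervalIntegrable g volume u v := (hI ▸ hg).intervalIntegrable
  have hGc : ContinuousOn G (Set.uIcc u v) :=
    intervalIntegral.continuousOn_primitive_interval (by rw [hI]; exact hg.integrableOn_Icc)
  have hGd : ∀ x ∈ Set.Ioo (min u v) (max u v), HasDerivAt G (g x) x := fun x hx => by
    rw [min_eq_left huv, max_eq_right huv] at hx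
    have hnhds : Set.Icc u v ∈ 𝓝 x := Icc_mem_nhds hx.1 hx.2
    refine intervalIntegral.integral_hasDerivAt_right
      (hgi.mono_set (Set.uIcc_subset_uIcc_left (by rw [hI]; exact ⟨hx.1.le, hx.2.le⟩))) ?_
      (hg.continuousAt hnhds)
    exact ⟨_, hnhds, hg.aestronglyMeasurable measurableSet_Icc⟩
  have hhd : ∀ x ∈ Set.uIcc u v, HasDerivAt (fun x => (h x : ℂ)) ((h' x : ℝ) : ℂ) x :=
    fun x hx => (hh x (hI ▸ hx)).ofReal_comp
  have hh'i : IntervalIntegrable h' volume u v := (hI ▸ hh').intervalIntegrable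
  have hparts := intervalIntegral.integral_mul_deriv_eq_deriv_mul_of_hasDerivAt
    (u := fun x => (h x : ℂ)) (v := G) (u' := fun x => ((h' x : ℝ) : ℂ)) (v' := g)
    (fun x hx => (hhd x hx).continuousAt.continuousWithinAt) hGc
    (fun x hx => hhd x (Set.Ioo_subset_Icc_self hx)) hGd
    (Complex.continuous_ofReal.comp_continuousOn (hI ▸ hh')).intervalIntegrable hgi
  have hGu : G u = 0 := intervalIntegral.integral_same
  have hM0 : 0 ≤ M := (norm_nonneg _).trans (hM u (Set.left_mem_Icc.2 huv))
  have hvar : ∫ x in u..v, |h' x| = |h v - h u| := by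
    have hF : ∫ x in u..v, h' x = h v - h u :=
      intervalIntegral.integral_eq_sub_of_hasDerivAt (fun x hx => hh x (hI ▸ hx)) hh'i
    rcases hsign with hs | hs
    · rw [intervalIntegral.integral_congr (g := h') fun x hx => abs_of_nonneg (hs x (hI ▸ hx)), hF,
        abs_of_nonneg]
      rw [← hF]
      exact intervalIntegral.integral_nonneg huv hs
    · rw [intervalIntegral.integral_congr (g := fun x => -h' x)
        fun x hx => abs_of_nonpos (hs x (hI ▸ hx)), intervalIntegral.integral_neg, hF,
        abs_of_nonpos]
      have := intervalIntegral.integral_nonneg (f := fun x => -h' x) (μ := volume) huv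
        fun x hx => neg_nonneg.2 (hs x hx)
      rw [intervalIntegral.integral_neg, hF] at this
      linarith
  rw [hparts, hGu, mul_zero, sub_zero, mul_add]
  refine (norm_sub_le _ _).trans (add_le_add ?_ ?_)
  · rw [norm_mul, Complex.norm_real, Real.norm_eq_abs, mul_comm]
    exact mul_le_mul_of_nonneg_right (hM v (Set.right_mem_Icc.2 huv)) (abs_nonneg _)
  · rw [← hvar, ← intervalIntegral.integral_const_mul]
    refine intervalIntegral.norm_integral_le_of_norm_le huv ?_ (hh'i.abs.const_mul M)
    refine ae_of_all _ fun x hx => ?_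
    rw [norm_mul, Complex.norm_real, Real.norm_eq_abs, mul_comm]
    exact mul_le_mul_of_nonneg_right (hM x (Set.Ioc_subset_Icc_self hx)) (abs_nonneg _)

/-- The first derivative test for oscillatory integrals. -/
lemma norm_integral_exp_le_of_le_abs_deriv {φ φ' φ'' : ℝ → ℝ} {u v r : ℝ} (huv : u ≤ v) (hr : 0 < r)
    (h1 : ∀ x ∈ Set.Icc u v, HasDerivAt φ (φ' x) x)
    (h2 : ∀ x ∈ Set.Icc u v, HasDerivAt φ' (φ'' x) x)
    (h3 : ContinuousOn φ'' (Set.Icc u v))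
    (hsign : (∀ x ∈ Set.Icc u v, 0 ≤ φ'' x) ∨ ∀ x ∈ Set.Icc u v, φ'' x ≤ 0)
    (hle : ∀ x ∈ Set.Icc u v, r ≤ |φ' x|) :
    ‖∫ x in u..v, Complex.exp (φ x * Complex.I)‖ ≤ 6 / r := by
  have hI : Set.uIcc u v = Set.Icc u v := Set.uIcc_of_le huv
  have h0 : ∀ x ∈ Set.Icc u v, φ' x ≠ 0 := fun x hx h => by
    have := hle x hx
    rw [h, abs_zero] at this
    linarith
  have hc' : ContinuousOn φ' (Set.Icc u v) := fun x hx => (h2 x hx).continuousAt.continuousWithinAt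
  have hE : ∀ x ∈ Set.Icc u v, HasDerivAt (fun x => Complex.exp (φ x * Complex.I))
      (Complex.exp (φ x * Complex.I) * (φ' x * Complex.I)) x := fun x hx =>
    ((h1 x hx).ofReal_comp.mul_const Complex.I).cexp
  have hEc : ContinuousOn (fun x => Complex.exp (φ x * Complex.I)) (Set.Icc u v) := fun x hx =>
    (hE x hx).continuousAt.continuousWithinAt
  set g : ℝ → ℂ := fun x => Complex.exp (φ x * Complex.I) * (φ' x * Complex.I) with hg
  have hgc : ContinuousOn g (Set.Icc u v) :=
    hEc.mul ((Complex.continuous_ofReal.comp_continuousOn hc').mul continuousOn_const)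
  have hM : ∀ w ∈ Set.Icc u v, ‖∫ x in u..w, g x‖ ≤ 2 := fun w hw => by
    have hsub : Set.uIcc u w ⊆ Set.Icc u v := by
      rw [Set.uIcc_of_le hw.1]
      exact Set.Icc_subset_Icc_right hw.2
    rw [intervalIntegral.integral_eq_sub_of_hasDerivAt (fun x hx => hE x (hsub hx))
      (hgc.mono hsub).intervalIntegrable]
    refine (norm_sub_le _ _).trans ?_
    rw [Complex.norm_exp_ofReal_mul_I, Complex.norm_exp_ofReal_mul_I]
    norm_num
  have hkey := norm_integral_smul_le_of_monotoneOn (h := fun x => (φ' x)⁻¹)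
    (h' := fun x => -φ'' x / φ' x ^ 2) huv hgc (fun x hx => (h2 x hx).inv (h0 x hx))
    (h3.neg.div (hc'.pow 2) fun x hx => pow_ne_zero 2 (h0 x hx))
    (hsign.symm.imp (fun h x hx => div_nonneg (neg_nonneg.2 (h x hx)) (sq_nonneg _))
      fun h x hx => div_nonpos_of_nonpos_of_nonneg (neg_nonpos.2 (h x hx)) (sq_nonneg _)) hM
  have heq : ∫ x in u..v, ((φ' x)⁻¹ : ℝ) * g x =
      (∫ x in u..v, Complex.exp (φ x * Complex.I)) * Complex.I := by
    rw [← intervalIntegral.integral_mul_const]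
    refine intervalIntegral.integral_congr fun x hx => ?_
    have : (φ' x : ℂ) ≠ 0 := Complex.ofReal_ne_zero.2 (h0 x (hI ▸ hx))
    simp only [hg]
    push_cast
    field_simp
  rw [heq, norm_mul, Complex.norm_I, mul_one] at hkey
  have hb : ∀ x ∈ Set.Icc u v, |(φ' x)⁻¹| ≤ 1 / r := fun x hx => by
    rw [abs_inv, ← one_div]
    exact one_div_le_one_div_of_le hr (hle x hx)
  have e1 := hb u (Set.left_mem_Icc.2 huv)
  have e2 := hb v (Set.right_mem_Icc.2 huv)
  have e3 := abs_sub (φ' v)⁻¹ (φ' u)⁻¹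
  have e4 : 6 / r = 6 * (1 / r) := by ring
  rw [e4]
  linarith

lemma norm_integral_clamp_le {f : ℝ → ℂ} {u v p q M : ℝ} (huv : u ≤ v) (hM : 0 ≤ M) (hpq : p ≤ q)
    (h : ∀ a b, u ≤ a → a ≤ b → b ≤ v → p ≤ a → b ≤ q → ‖∫ x in a..b, f x‖ ≤ M) :
    ‖∫ x in (max u (min v p))..(max u (min v q)), f x‖ ≤ M := by
  rcases le_or_gt q u with hq | hq
  · have e1 : max u (min v p) = u := max_eq_left ((min_le_right _ _).trans (hpq.trans hq))
    have e2 : max u (min v q) = u := max_eq_left ((min_le_right _ _).trans hq)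
    simpa [e1, e2] using hM
  · rcases le_or_gt v p with hp | hp
    · rw [min_eq_left hp, min_eq_left (hp.trans hpq)]
      simpa using hM
    · refine h _ _ (le_max_left _ _) (max_le_max le_rfl (min_le_min le_rfl hpq))
        (max_le huv (min_le_left _ _)) ?_ (max_le hq.le (min_le_right _ _))
      rw [min_eq_right hp.le]
      exact le_max_right _ _

/-- The phase `A (s ^ 2 / 2) (log s - 1 / 2 - L)`. -/
noncomputable def logPhase (A L s : ℝ) : ℝ := A * (s ^ 2 / 2 * (Real.log s - 1 / 2 - L))

lemma hasDerivAt_logPhase (A L : ℝ) {s : ℝ} (hs : 0 < s) :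
    HasDerivAt (logPhase A L) (A * (s * (Real.log s - L))) s := by
  have h := ((((hasDerivAt_id s).pow 2).div_const 2).mul
    (((Real.hasDerivAt_log hs.ne').sub_const (1 / 2)).sub_const L)).const_mul A
  refine h.congr_deriv ?_
  simp
  field_simp
  left
  ring

lemma hasDerivAt_deriv_logPhase (A L : ℝ) {s : ℝ} (hs : 0 < s) :
    HasDerivAt (fun s => A * (s * (Real.log s - L))) (A * (Real.log s - L + 1)) s := by
  have h := ((hasDerivAt_id s).mul ((Real.hasDerivAt_log hs.ne').sub_const L)).const_mul A
  refine h.congr_deriv ?_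
  simp [hs.ne']

lemma norm_integral_exp_logPhase_le_of_le {A L u v r : ℝ} (hA : A ≠ 0) (hr : 0 < r) (hu : 1 ≤ u)
    (huv : u ≤ v)
    (hsign : (∀ x ∈ Set.Icc u v, 0 ≤ Real.log x - L + 1) ∨
      ∀ x ∈ Set.Icc u v, Real.log x - L + 1 ≤ 0)
    (hle : ∀ x ∈ Set.Icc u v, r ≤ x * |Real.log x - L|) :
    ‖∫ s in u..v, Complex.exp (logPhase A L s * Complex.I)‖ ≤ 6 / (|A| * r) := by
  have hpos : ∀ x ∈ Set.Icc u v, 0 < x := fun x hx => by linarith [hx.1]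
  refine norm_integral_exp_le_of_le_abs_deriv huv (mul_pos (abs_pos.2 hA) hr)
    (fun x hx => hasDerivAt_logPhase A L (hpos x hx))
    (fun x hx => hasDerivAt_deriv_logPhase A L (hpos x hx)) ?_ ?_ fun x hx => ?_
  · exact continuousOn_const.mul (((Real.continuousOn_log.mono fun x hx => (hpos x hx).ne').sub
      continuousOn_const).add continuousOn_const)
  · rcases lt_or_gt_of_ne hA with hA | hA
    · exact hsign.symm.imp (fun h x hx => mul_nonneg_of_nonpos_of_nonpos hA.le (h x hx))
        fun h x hx => mul_nonpos_of_nonpos_of_nonneg hA.le (h x hx)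
    · exact hsign.imp (fun h x hx => mul_nonneg hA.le (h x hx))
        fun h x hx => mul_nonpos_of_nonneg_of_nonpos hA.le (h x hx)
  · rw [abs_mul, abs_mul, abs_of_pos (hpos x hx)]
    exact mul_le_mul_of_nonneg_left (hle x hx) (abs_nonneg _)

/-- Uniform boundedness of `∫ exp (i A (s ^ 2 / 2) (log s - 1 / 2 - L))`. -/
lemma norm_integral_exp_logPhase_le {A : ℝ} (hA : A ≠ 0) {L u v : ℝ} (hu : 1 ≤ u) (huv : u ≤ v) :
    ‖∫ s in u..v, Complex.exp (logPhase A L s * Complex.I)‖ ≤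
      12 / |A| + 6 * Real.exp 1 / |A| + 2 := by
  set f : ℝ → ℂ := fun s => Complex.exp (logPhase A L s * Complex.I) with hf
  set s₀ := Real.exp L with hs₀
  have hs₀p : 0 < s₀ := Real.exp_pos L
  have hlog : Real.log s₀ = L := Real.log_exp L
  have he1 : 1 < Real.exp 1 := by
    have := Real.add_one_lt_exp (one_ne_zero)
    linarith
  set p1 := s₀ / Real.exp 1 with hp1
  have hp1p : 0 < p1 := div_pos hs₀p (Real.exp_pos 1)
  have hlogp1 : Real.log p1 = L - 1 := by
    rw [hp1, Real.log_div hs₀p.ne' (Real.exp_pos 1).ne', hlog, Real.log_exp]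
  have hp1s : p1 < s₀ := div_lt_self hs₀p he1
  set p2 := max p1 (s₀ - 1) with hp2
  have hA' : 0 < |A| := abs_pos.2 hA
  have hcont : ContinuousOn f (Set.Ici 1) := fun s hs => by
    have hs0 : 0 < s := lt_of_lt_of_le one_pos hs
    have h : ContinuousAt (fun s => (logPhase A L s : ℂ)) s :=
      (hasDerivAt_logPhase A L hs0).continuousAt.ofReal
    exact ((h.mul continuousAt_const).cexp : ContinuousAt f s).continuousWithinAt
  have hfint : ∀ a b, u ≤ a → u ≤ b → IntervalIntegrable f volume a b := fun a b ha hb =>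
    (hcont.mono fun x hx => hu.trans ((le_min ha hb).trans hx.1)).intervalIntegrable
  have b1 : ∀ a b, u ≤ a → a ≤ b → b ≤ v → 0 ≤ a → b ≤ p1 → ‖∫ x in a..b, f x‖ ≤ 6 / |A| :=
    fun a b ha hab hb _ hb1 => by
      have hlogx : ∀ x ∈ Set.Icc a b, Real.log x - L ≤ -1 := fun x hx => by
        have := Real.log_le_log (show 0 < x by linarith [hx.1]) (hx.2.trans hb1)
        rw [hlogp1] at this
        linarith
      have := norm_integral_exp_logPhase_le_of_le (L := L) hA one_pos (hu.trans ha) hab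
        (Or.inr fun x hx => by linarith [hlogx x hx]) fun x hx => by
          have h1 := hlogx x hx
          rw [abs_of_nonpos (by linarith)]
          have h2 : 1 ≤ x := by linarith [hx.1]
          nlinarith
      simpa using this
  have b2 : ∀ a b, u ≤ a → a ≤ b → b ≤ v → p1 ≤ a → b ≤ p2 →
      ‖∫ x in a..b, f x‖ ≤ 6 * Real.exp 1 / |A| := fun a b ha hab hb ha1 hb2 => by
    rcases le_or_gt b p1 with h | h
    · have : a = b := le_antisymm hab (h.trans ha1)
      rw [this, intervalIntegral.integral_same, norm_zero]
      positivity
    · have hb2' : b ≤ s₀ - 1 := by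
        rcases le_max_iff.1 hb2 with h' | h'
        · linarith
        · exact h'
      have := norm_integral_exp_logPhase_le_of_le (L := L) (r := 1 / Real.exp 1) hA (by positivity)
        (hu.trans ha) hab
        (Or.inl fun x hx => by
          have := Real.log_le_log hp1p (ha1.trans hx.1)
          rw [hlogp1] at this
          linarith) fun x hx => by
          have hx0 : 0 < x := by linarith [hx.1]
          have hxs : x ≤ s₀ - 1 := hx.2.trans hb2'
          have h1 : 1 - x / s₀ ≤ L - Real.log x := by
            have := Real.log_le_sub_one_of_pos (div_pos hx0 hs₀p)
            rw [Real.log_div hx0.ne' hs₀p.ne', hlog] at this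
            linarith
          have h2 : 1 / s₀ ≤ 1 - x / s₀ := by
            rw [le_sub_iff_add_le, ← add_div, div_le_one hs₀p]
            linarith
          have h3 : s₀ / Real.exp 1 ≤ x := ha1.trans hx.1
          rw [abs_of_nonpos (by linarith [div_pos one_pos hs₀p]), neg_sub]
          calc 1 / Real.exp 1 = s₀ / Real.exp 1 * (1 / s₀) := by field_simp
            _ ≤ x * (L - Real.log x) := mul_le_mul h3 (h2.trans h1) (by positivity) hx0.le
      refine this.trans_eq ?_
      field_simp
  have b3 : ∀ a b, u ≤ a → a ≤ b → b ≤ v → p2 ≤ a → b ≤ s₀ + 1 → ‖∫ x in a..b, f x‖ ≤ 2 :=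
    fun a b _ hab _ ha2 hb => by
      have h := intervalIntegral.norm_integral_le_of_norm_le_const (a := a) (b := b) (f := f)
        (C := 1)
        fun x _ => (Complex.norm_exp_ofReal_mul_I _).le
      rw [one_mul, abs_of_nonneg (sub_nonneg.2 hab)] at h
      have := (le_max_right p1 (s₀ - 1)).trans ha2
      linarith
  have b4 : ∀ a b, u ≤ a → a ≤ b → b ≤ v → s₀ + 1 ≤ a → b ≤ max v (s₀ + 1) →
      ‖∫ x in a..b, f x‖ ≤ 6 / |A| := fun a b ha hab _ ha1 _ => by
    have hx1 : ∀ x ∈ Set.Icc a b, x - s₀ ≤ x * (Real.log x - L) := fun x hx => by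
      have hx0 : 0 < x := by linarith [hx.1]
      have := Real.log_le_sub_one_of_pos (div_pos hs₀p hx0)
      rw [Real.log_div hs₀p.ne' hx0.ne', hlog] at this
      calc x - s₀ = x * (1 - s₀ / x) := by field_simp
        _ ≤ _ := mul_le_mul_of_nonneg_left (by linarith) hx0.le
    have hx2 : ∀ x ∈ Set.Icc a b, 0 ≤ Real.log x - L := fun x hx => by
      rw [← hlog]
      exact sub_nonneg.2 (Real.log_le_log hs₀p (by linarith [hx.1]))
    have := norm_integral_exp_logPhase_le_of_le (L := L) hA one_pos (hu.trans ha) hab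
      (Or.inl fun x hx => by linarith [hx2 x hx]) fun x hx => by
        rw [abs_of_nonneg (hx2 x hx)]
        linarith [hx1 x hx, hx.1]
    simpa using this
  have hp12 : p1 ≤ p2 := le_max_left _ _
  have hp23 : p2 ≤ s₀ + 1 := max_le (by linarith) (by linarith)
  have c1 := norm_integral_clamp_le huv (by positivity) hp1p.le b1
  have c2 := norm_integral_clamp_le huv (by positivity) hp12 b2
  have c3 := norm_integral_clamp_le huv (by positivity) hp23 b3
  have c4 := norm_integral_clamp_le huv (by positivity) (le_max_right v (s₀ + 1)) b4
  rw [max_eq_left (show min v 0 ≤ u from (min_le_right _ _).trans (by linarith))] at c1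
  rw [min_eq_left (le_max_left v (s₀ + 1)), max_eq_right huv] at c4
  have hi := fun p q =>
    hfint (max u (min v p)) (max u (min v q)) (le_max_left _ _) (le_max_left _ _)
  rw [← intervalIntegral.integral_add_adjacent_intervals (hfint u _ le_rfl (le_max_left _ _))
      (hfint (max u (min v (s₀ + 1))) v (le_max_left _ _) huv),
    ← intervalIntegral.integral_add_adjacent_intervals (hfint u _ le_rfl (le_max_left _ _))
      (hi p2 (s₀ + 1)),
    ← intervalIntegral.integral_add_adjacent_intervals (hfint u _ le_rfl (le_max_left _ _))
      (hi p1 p2)]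
  refine (norm_add_le_of_le (norm_add_le_of_le (norm_add_le_of_le c1 c2) c3) c4).trans_eq ?_
  ring

end Oscillatory

section OscillatoryStirling

open scoped Topology Interval

lemma continuousOn_stirlingMain (α β γ : ℝ) : ContinuousOn (stirlingMain α β γ) (Set.Ioi 0) := by
  intro t ht
  have hl : ContinuousAt Real.log t := Real.continuousAt_log (ne_of_gt ht)
  have h1 : ContinuousAt (fun t : ℝ => α * Real.log t - β * t) t := by fun_prop
  have h2 : ContinuousAt (fun t : ℝ => γ * (t * Real.log t - t)) t := by fun_prop
  have h3 : ContinuousAt (stirlingMain α β γ) t :=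
    (h1.ofReal.add (h2.ofReal.mul continuousAt_const)).cexp
  exact h3.continuousWithinAt

lemma stirlingMain_neg_half_sq {γ y s : ℝ} (hγ : γ ≠ 0) (hs : 0 < s) (δ : ℝ) :
    stirlingMain (-1 / 2) 0 γ (s ^ 2) *
      Complex.exp (-δ * (s ^ 2 : ℝ) ^ 2 + (y * (s ^ 2) : ℝ) * Complex.I) *
      ((2 * s : ℝ) : ℂ) = ((2 * Real.exp (-δ * s ^ 4) : ℝ) : ℂ) *
      Complex.exp (logPhase (4 * γ) (-y / (2 * γ)) s * Complex.I) := by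
  have h1 : ((s : ℝ) : ℂ) = Complex.exp ((Real.log s : ℝ) : ℂ) := by
    rw [← Complex.ofReal_exp, Real.exp_log hs]
  have h2 : logPhase (4 * γ) (-y / (2 * γ)) s =
      γ * (s ^ 2 * (2 * Real.log s) - s ^ 2) + y * s ^ 2 := by
    rw [logPhase]
    field_simp
    ring
  rw [stirlingMain, h2, Real.log_pow]
  push_cast
  have h3 : Complex.exp (-1 / 2 * (2 * (Real.log s : ℂ)) - 0 * (s : ℂ) ^ 2 +
        γ * ((s : ℂ) ^ 2 * (2 * (Real.log s : ℂ)) - (s : ℂ) ^ 2) * Complex.I) *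
      Complex.exp (-δ * ((s : ℂ) ^ 2) ^ 2 + y * (s : ℂ) ^ 2 * Complex.I) *
      Complex.exp (Real.log s : ℂ) = Complex.exp (-δ * (s : ℂ) ^ 4) *
      Complex.exp ((γ * ((s : ℂ) ^ 2 * (2 * (Real.log s : ℂ)) - (s : ℂ) ^ 2) + y * (s : ℂ) ^ 2) *
        Complex.I) := by
    rw [← Complex.exp_add, ← Complex.exp_add, ← Complex.exp_add]
    congr 1
    ring
  rw [← h1] at h3
  linear_combination 2 * h3

lemma norm_integral_stirlingMain_le {γ : ℝ} (hγ : γ ≠ 0) {δ : ℝ} (hδ : 0 ≤ δ) (y : ℝ) {a b : ℝ}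
    (ha : 1 ≤ a) (hab : a ≤ b) :
    ‖∫ t in a..b, stirlingMain (-1 / 2) 0 γ t *
        Complex.exp (-δ * (t : ℝ) ^ 2 + (y * t : ℝ) * Complex.I)‖ ≤
      4 * (12 / |4 * γ| + 6 * Real.exp 1 / |4 * γ| + 2) := by
  set F : ℝ → ℂ := fun t => stirlingMain (-1 / 2) 0 γ t *
    Complex.exp (-δ * (t : ℝ) ^ 2 + (y * t : ℝ) * Complex.I) with hF
  have ha0 : 0 ≤ a := by linarith
  have hb0 : 0 ≤ b := by linarith
  have hu : 1 ≤ √a := Real.one_le_sqrt.2 ha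
  have huv : √a ≤ √b := Real.sqrt_le_sqrt hab
  have hI : [[√a, √b]] = Set.Icc √a √b := Set.uIcc_of_le huv
  have hpos : ∀ x ∈ [[√a, √b]], 0 < x := fun x hx => by
    rw [hI] at hx
    linarith [hx.1]
  have hFc : ContinuousOn F (Set.Ioi 0) :=
    (continuousOn_stirlingMain _ _ _).mul (Continuous.continuousOn (by fun_prop))
  have hsub : ∫ s in √a..√b, ((2 * s : ℝ) : ℂ) * F (s ^ 2) = ∫ t in a..b, F t := by
    have := intervalIntegral.integral_deriv_smul_comp' (a := √a) (b := √b) (f := fun s => s ^ 2)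
      (f' := fun s => 2 * s) (g := F) (fun x _ => by simpa using hasDerivAt_pow 2 x)
      (by fun_prop) (hFc.mono (by
        rintro _ ⟨x, hx, rfl⟩
        exact pow_pos (hpos x hx) 2))
    simpa only [Real.sq_sqrt ha0, Real.sq_sqrt hb0, Complex.real_smul, Function.comp_apply]
      using this
  rw [← hsub, intervalIntegral.integral_congr (g := fun s => ((2 * Real.exp (-δ * s ^ 4) : ℝ) : ℂ) *
      Complex.exp (logPhase (4 * γ) (-y / (2 * γ)) s * Complex.I)) fun s hs =>
    (mul_comm _ _).trans (stirlingMain_neg_half_sq hγ (hpos s hs) δ)]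
  set L := -y / (2 * γ)
  set M := 12 / |4 * γ| + 6 * Real.exp 1 / |4 * γ| + 2 with hM
  have hγ4 : 4 * γ ≠ 0 := mul_ne_zero (by norm_num) hγ
  have hcont : ContinuousOn (fun s => Complex.exp (logPhase (4 * γ) L s * Complex.I))
      (Set.Icc √a √b) := fun s hs => by
    have h : ContinuousAt (fun s => (logPhase (4 * γ) L s : ℂ)) s :=
      (hasDerivAt_logPhase (4 * γ) L (hpos s (hI ▸ hs))).continuousAt.ofReal
    exact (h.mul continuousAt_const).cexp.continuousWithinAt
  have hd : ∀ x ∈ Set.Icc √a √b, HasDerivAt (fun s => 2 * Real.exp (-δ * s ^ 4))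
      (2 * (Real.exp (-δ * x ^ 4) * (-δ * (4 * x ^ 3)))) x := fun x _ => by
    have h := (((hasDerivAt_pow 4 x).const_mul (-δ)).exp).const_mul 2
    simpa using h
  have key := norm_integral_smul_le_of_monotoneOn huv hcont hd (by fun_prop)
    (Or.inr fun x hx => by
      have hx0 := hpos x (hI ▸ hx)
      have : 0 ≤ Real.exp (-δ * x ^ 4) * (δ * (4 * x ^ 3)) := by positivity
      linarith)
    (M := M) fun w hw => norm_integral_exp_logPhase_le hγ4 hu hw.1
  refine key.trans ?_
  have hM0 : 0 ≤ M := by positivity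
  have hb : ∀ x, 2 * Real.exp (-δ * x ^ 4) ≤ 2 := fun x => by
    have : Real.exp (-δ * x ^ 4) ≤ 1 := Real.exp_le_one_iff.2 (by
      have : 0 ≤ δ * x ^ 4 := by positivity
      linarith)
    linarith
  have hp : ∀ x, 0 < 2 * Real.exp (-δ * x ^ 4) := fun x => by positivity
  have h1 : |2 * Real.exp (-δ * √b ^ 4)| ≤ 2 := by
    rw [abs_of_pos (hp _)]
    exact hb _
  have h2 : |2 * Real.exp (-δ * √b ^ 4) - 2 * Real.exp (-δ * √a ^ 4)| ≤ 2 := by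
    rw [abs_le]
    constructor <;> linarith [hb √a, hb √b, hp √a, hp √b]
  nlinarith

/-- Uniform boundedness of the Fourier integrals of functions with asymptotics of Stirling type. -/
theorem IsStirling.exists_norm_integral_le {f : ℝ → ℂ} {γ : ℝ} (hf : IsStirling f (-1 / 2) 0 γ)
    (hγ : γ ≠ 0) (hc : Continuous f) :
    ∃ M, ∀ δ y T : ℝ, 0 ≤ δ → 0 ≤ T →
      ‖∫ t in (0 : ℝ)..T, f t * Complex.exp (-δ * (t : ℝ) ^ 2 + (y * t : ℝ) * Complex.I)‖ ≤ M := by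
  obtain ⟨κ, h0, h⟩ := hf
  obtain ⟨C, hC0, hC⟩ := h.exists_pos
  rw [IsBigOWith] at hC
  obtain ⟨T₁, hT₁⟩ := eventually_atTop.1 hC
  set T₀ := max T₁ 1 with hT₀
  have hT0 : 1 ≤ T₀ := le_max_right _ _
  obtain ⟨B, hB⟩ := (isCompact_Icc (a := (0 : ℝ)) (b := T₀)).exists_bound_of_continuousOn
    hc.continuousOn
  have hB0 : 0 ≤ B := (norm_nonneg _).trans (hB 0 ⟨le_rfl, by linarith⟩)
  set M₁ := 4 * (12 / |4 * γ| + 6 * Real.exp 1 / |4 * γ| + 2)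
  have hexp : ∀ δ y t : ℝ, 0 ≤ δ →
      ‖Complex.exp (-δ * (t : ℝ) ^ 2 + (y * t : ℝ) * Complex.I)‖ ≤ 1 := fun δ y t hδ => by
    rw [Complex.norm_exp, Real.exp_le_one_iff]
    have : 0 ≤ δ * t ^ 2 := by positivity
    simp [← Complex.ofReal_pow]
    linarith
  have hec : ∀ δ y : ℝ, Continuous fun t : ℝ =>
      Complex.exp (-δ * (t : ℝ) ^ 2 + (y * t : ℝ) * Complex.I) := fun δ y => by fun_prop
  have hsmall : ∀ δ y T : ℝ, 0 ≤ δ → 0 ≤ T → T ≤ T₀ →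
      ‖∫ t in (0 : ℝ)..T, f t * Complex.exp (-δ * (t : ℝ) ^ 2 + (y * t : ℝ) * Complex.I)‖ ≤
        B * T₀ :=
    fun δ y T hδ h0T hT => by
      have := intervalIntegral.norm_integral_le_of_norm_le_const (a := 0) (b := T) (C := B)
        (f := fun t => f t * Complex.exp (-δ * (t : ℝ) ^ 2 + (y * t : ℝ) * Complex.I))
        fun t ht => by
          rw [Set.uIoc_of_le h0T] at ht
          rw [norm_mul]
          exact (mul_le_of_le_one_right (norm_nonneg _) (hexp δ y t hδ)).trans
            (hB t ⟨ht.1.le, ht.2.trans hT⟩)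
      refine this.trans ?_
      rw [sub_zero, abs_of_nonneg h0T]
      exact mul_le_mul_of_nonneg_left hT hB0
  refine ⟨B * T₀ + ‖κ‖ * M₁ + C * 2, fun δ y T hδ h0T => ?_⟩
  have hM1 : 0 ≤ ‖κ‖ * M₁ := by positivity
  rcases le_or_gt T T₀ with hT | hT
  · have := hsmall δ y T hδ h0T hT
    linarith
  set e : ℝ → ℂ := fun t => Complex.exp (-δ * (t : ℝ) ^ 2 + (y * t : ℝ) * Complex.I) with he
  have hsplit : ∫ t in (0 : ℝ)..T, f t * e t = (∫ t in (0 : ℝ)..T₀, f t * e t) +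
      ∫ t in T₀..T, f t * e t :=
    (intervalIntegral.integral_add_adjacent_intervals ((hc.mul (hec δ y)).intervalIntegrable _ _)
      ((hc.mul (hec δ y)).intervalIntegrable _ _)).symm
  have hI : [[T₀, T]] = Set.Icc T₀ T := Set.uIcc_of_le hT.le
  have hmc : ContinuousOn (fun t => κ * (stirlingMain (-1 / 2) 0 γ t * e t)) [[T₀, T]] := by
    refine continuousOn_const.mul (((continuousOn_stirlingMain _ _ _).mono fun t ht => ?_).mul
      (hec δ y).continuousOn)
    rw [hI] at ht
    exact lt_of_lt_of_le (by linarith) ht.1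
  have hfi : IntervalIntegrable (fun t => f t * e t) volume T₀ T :=
    (hc.mul (hec δ y)).intervalIntegrable _ _
  have hsplit2 : ∫ t in T₀..T, f t * e t = κ * (∫ t in T₀..T, stirlingMain (-1 / 2) 0 γ t * e t) +
      ∫ t in T₀..T, (f t * e t - κ * (stirlingMain (-1 / 2) 0 γ t * e t)) := by
    rw [intervalIntegral.integral_sub hfi
      hmc.intervalIntegrable, intervalIntegral.integral_const_mul]
    ring
  have hlast : ‖∫ t in T₀..T, (f t * e t - κ * (stirlingMain (-1 / 2) 0 γ t * e t))‖ ≤ C * 2 := by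
    have hle : ∀ t ∈ Set.Ioc T₀ T, ‖f t * e t - κ * (stirlingMain (-1 / 2) 0 γ t * e t)‖ ≤
        C * t ^ (-3 / 2 : ℝ) := fun t ht => by
      have ht0 : 0 < t := by linarith [ht.1]
      have h1 := hT₁ t ((le_max_left _ _).trans ht.1.le)
      have e1 : f t * e t - κ * (stirlingMain (-1 / 2) 0 γ t * e t) =
          (f t / stirlingMain (-1 / 2) 0 γ t - κ) * stirlingMain (-1 / 2) 0 γ t * e t := by
        rw [sub_mul, div_mul_cancel₀ _ (stirlingMain_ne_zero _ _ _ _)]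
        ring
      rw [e1, norm_mul, norm_mul, norm_stirlingMain ht0]
      have h2 : ‖t⁻¹‖ * t ^ (-1 / 2 : ℝ) = t ^ (-3 / 2 : ℝ) := by
        rw [Real.norm_of_nonneg (inv_nonneg.2 ht0.le), ← Real.rpow_neg_one, ← Real.rpow_add ht0]
        norm_num
      have h3 : 0 ≤ t ^ (-1 / 2 : ℝ) := Real.rpow_nonneg ht0.le _
      calc _ ≤ ‖f t / stirlingMain (-1 / 2) 0 γ t - κ‖ * t ^ (-1 / 2 : ℝ) :=
            mul_le_of_le_one_right (by positivity) (hexp δ y t hδ)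
        _ ≤ C * ‖t⁻¹‖ * t ^ (-1 / 2 : ℝ) := mul_le_mul_of_nonneg_right h1 h3
        _ = _ := by rw [mul_assoc, h2]
    have hT0' : (0 : ℝ) ∉ [[T₀, T]] := by
      rw [hI]
      intro h
      linarith [h.1]
    refine (intervalIntegral.norm_integral_le_of_norm_le hT.le (ae_of_all _ hle)
      ((intervalIntegral.intervalIntegrable_rpow (Or.inr hT0')).const_mul C)).trans ?_
    rw [intervalIntegral.integral_const_mul, integral_rpow (Or.inr ⟨by norm_num, hT0'⟩)]
    refine mul_le_mul_of_nonneg_left ?_ hC0.le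
    have h1 : 0 ≤ T ^ (-3 / 2 + 1 : ℝ) := Real.rpow_nonneg h0T _
    have h2 : T₀ ^ (-3 / 2 + 1 : ℝ) ≤ 1 := Real.rpow_le_one_of_one_le_of_nonpos hT0 (by norm_num)
    rw [div_le_iff_of_neg (by norm_num)]
    linarith
  rw [hsplit, hsplit2, ← add_assoc]
  refine norm_add_le_of_le (norm_add_le_of_le (hsmall δ y T₀ hδ (by linarith) le_rfl) ?_) hlast
  rw [norm_mul]
  exact mul_le_mul_of_nonneg_left (norm_integral_stirlingMain_le hγ hδ y hT0 hT.le) (norm_nonneg _)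

end OscillatoryStirling

section ContourShift

open scoped Topology

theorem integral_inv_add_mul_I {s : ℝ} (hs : s ≠ 0) (T : ℝ) :
    ∫ t in (-T)..T, ((s : ℂ) + t * Complex.I)⁻¹ = ((2 * Real.arctan (T / s) : ℝ) : ℂ) := by
  have hne : ∀ t : ℝ, (s : ℂ) + t * Complex.I ≠ 0 := fun t h => hs (by
    simpa using congrArg Complex.re h)
  have hcont : Continuous fun t : ℝ => ((s : ℂ) + t * Complex.I)⁻¹ :=
    Continuous.inv₀ (by fun_prop) hne
  have hpos : ∀ t : ℝ, 0 < s ^ 2 + t ^ 2 := fun t => by positivity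
  have h1 : ∫ t in (-T)..T, ((s : ℂ) + t * Complex.I)⁻¹ =
      ∫ t in (-T)..T, ((s : ℂ) + (-t : ℝ) * Complex.I)⁻¹ := by
    rw [intervalIntegral.integral_comp_neg (fun t : ℝ => ((s : ℂ) + t * Complex.I)⁻¹), neg_neg]
  have h2 : (2 : ℂ) * ∫ t in (-T)..T, ((s : ℂ) + t * Complex.I)⁻¹ =
      ∫ t in (-T)..T, ((2 * (s / (s ^ 2 + t ^ 2)) : ℝ) : ℂ) := by
    rw [two_mul]
    nth_rewrite 2 [h1]
    have hcont' : Continuous fun t : ℝ => ((s : ℂ) + (-t : ℝ) * Complex.I)⁻¹ :=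
      hcont.comp continuous_neg
    rw [← intervalIntegral.integral_add (hcont.intervalIntegrable _ _)
      (hcont'.intervalIntegrable _ _)]
    refine intervalIntegral.integral_congr fun t _ => ?_
    have ha := hne t
    have hb := hne (-t)
    have hc : ((s : ℂ) ^ 2 + (t : ℂ) ^ 2) ≠ 0 := by exact_mod_cast (hpos t).ne'
    have he : (s : ℂ) ^ 2 + (t : ℂ) ^ 2 =
        ((s : ℂ) + t * Complex.I) * ((s : ℂ) + (-t : ℝ) * Complex.I) := by
      push_cast
      linear_combination (t : ℂ) ^ 2 * Complex.I_sq
    push_cast at hb he ⊢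
    rw [inv_add_inv ha hb, ← he]
    ring
  have h3 : ∫ t in (-T)..T, 2 * (s / (s ^ 2 + t ^ 2)) = 2 * (2 * Real.arctan (T / s)) := by
    have hd : ∀ t ∈ Set.uIcc (-T) T, HasDerivAt (fun t => 2 * Real.arctan (t / s))
        (2 * (s / (s ^ 2 + t ^ 2))) t := fun t _ => by
      have h := (((hasDerivAt_id t).div_const s).arctan).const_mul 2
      have h3 := (hpos t).ne'
      have h4 : 1 + (t / s) ^ 2 ≠ 0 := by positivity
      have h5 : 2 * (s / (s ^ 2 + t ^ 2)) = 2 * (1 / (1 + (id t / s) ^ 2) * (1 / s)) := by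
        simp only [id]
        field_simp
      rw [h5]
      exact h
    rw [intervalIntegral.integral_eq_sub_of_hasDerivAt hd]
    · rw [neg_div, Real.arctan_neg]
      ring
    · refine Continuous.intervalIntegrable ?_ _ _
      exact continuous_const.mul (continuous_const.div (by fun_prop) fun t => (hpos t).ne')
  rw [intervalIntegral.integral_ofReal, h3] at h2
  have h4 : (2 : ℂ) ≠ 0 := two_ne_zero
  apply mul_left_cancel₀ h4
  rw [h2]
  push_cast
  ring

theorem tendsto_integral_inv_add_mul_I_of_pos {s : ℝ} (hs : 0 < s) :
    Tendsto (fun T : ℝ => ∫ t in (-T)..T, ((s : ℂ) + t * Complex.I)⁻¹) atTop (𝓝 (π : ℂ)) := by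
  have h : Tendsto (fun T : ℝ => 2 * Real.arctan (T / s)) atTop (𝓝 (2 * (π / 2))) :=
    ((Real.tendsto_arctan_atTop.mono_right nhdsWithin_le_nhds).comp
      (tendsto_id.atTop_div_const hs)).const_mul 2
  rw [mul_div_cancel₀ _ two_ne_zero] at h
  simpa only [integral_inv_add_mul_I hs.ne', Function.comp_def] using
    (Complex.continuous_ofReal.tendsto π).comp h

theorem tendsto_integral_inv_add_mul_I_of_neg {s : ℝ} (hs : s < 0) :
    Tendsto (fun T : ℝ => ∫ t in (-T)..T, ((s : ℂ) + t * Complex.I)⁻¹) atTop (𝓝 (-π : ℂ)) := by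
  have h : Tendsto (fun T : ℝ => 2 * Real.arctan (T / s)) atTop (𝓝 (2 * (-(π / 2)))) :=
    ((Real.tendsto_arctan_atBot.mono_right nhdsWithin_le_nhds).comp
      (tendsto_id.atTop_div_const_of_neg hs)).const_mul 2
  rw [mul_neg, mul_div_cancel₀ _ two_ne_zero] at h
  simpa only [integral_inv_add_mul_I hs.ne, Function.comp_def, Complex.ofReal_neg] using
    (Complex.continuous_ofReal.tendsto (-π)).comp h

theorem integrable_vertical_div {K : ℂ → ℂ} (hK : Continuous K) {a p C : ℝ} (hap : a ≠ p)
    (hb : ∀ t : ℝ, ‖K (a + t * Complex.I)‖ ≤ C / (1 + t ^ 2)) :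
    Integrable fun t : ℝ => K (a + t * Complex.I) / (a + t * Complex.I - p) := by
  have hs : a - p ≠ 0 := sub_ne_zero.2 hap
  have hne : ∀ t : ℝ, (a : ℂ) + t * Complex.I - p ≠ 0 := fun t h => hs (by
    simpa using congrArg Complex.re h)
  have hcont : Continuous fun t : ℝ => K (a + t * Complex.I) / (a + t * Complex.I - p) :=
    (hK.comp (by fun_prop)).div (by fun_prop) hne
  refine Integrable.mono' (integrable_inv_one_add_sq.const_mul (C * |a - p|⁻¹))
    hcont.aestronglyMeasurable (ae_of_all _ fun t => ?_)
  rw [norm_div, div_eq_mul_inv]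
  have h1 : |a - p| ≤ ‖(a : ℂ) + t * Complex.I - p‖ := by
    simpa using Complex.abs_re_le_norm ((a : ℂ) + t * Complex.I - p)
  have h2 := (norm_nonneg _).trans (hb t)
  calc _ ≤ C / (1 + t ^ 2) * |a - p|⁻¹ :=
        mul_le_mul (hb t) (inv_anti₀ (abs_pos.2 hs) h1) (by positivity) h2
    _ = _ := by ring

/-- Shifting a vertical line of integration across a simple pole. -/
theorem integral_vertical_sub_eq {K : ℂ → ℂ} (hK : Differentiable ℂ K) {c p σ C : ℝ}
    (hcp : c < p) (hpσ : p < σ)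
    (hb : ∀ w : ℂ, c ≤ w.re → w.re ≤ σ → ‖K w‖ ≤ C / (1 + w.im ^ 2)) :
    (∫ t : ℝ, K (σ + t * Complex.I) / (σ + t * Complex.I - p)) -
      ∫ t : ℝ, K (c + t * Complex.I) / (c + t * Complex.I - p) = 2 * π * K p := by
  set E : ℂ → ℂ := dslope K p with hE
  have hEd : DifferentiableOn ℂ E Set.univ :=
    (Complex.differentiableOn_dslope univ_mem).2 hK.differentiableOn
  have hEeq : ∀ w : ℂ, w ≠ p → E w = K w / (w - p) - K p * (w - p)⁻¹ := fun w hw => by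
    rw [hE, dslope_of_ne _ hw, slope_def_field]
    ring
  have hC : 0 ≤ C := by
    have h := (norm_nonneg _).trans (hb (σ : ℂ) (by simp; linarith) (by simp))
    simpa using h
  have hline : ∀ {a : ℝ}, a ≠ p → c ≤ a → a ≤ σ → ∀ T : ℝ,
      ∫ t in (-T)..T, E (a + t * Complex.I) =
        (∫ t in (-T)..T, K (a + t * Complex.I) / (a + t * Complex.I - p)) -
          K p * ∫ t in (-T)..T, (((a - p : ℝ) : ℂ) + t * Complex.I)⁻¹ := by
    intro a hap h1 h2 T
    have hs : a - p ≠ 0 := sub_ne_zero.2 hap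
    have hne : ∀ t : ℝ, ((a - p : ℝ) : ℂ) + t * Complex.I ≠ 0 := fun t h => hs (by
      simpa using congrArg Complex.re h)
    rw [← intervalIntegral.integral_const_mul, ← intervalIntegral.integral_sub]
    · refine intervalIntegral.integral_congr fun t _ => ?_
      have hw : (a : ℂ) + t * Complex.I ≠ p := fun h => hap (by
        simpa using congrArg Complex.re h)
      rw [hEeq _ hw]
      congr 3
      push_cast
      ring
    · exact (integrable_vertical_div hK.continuous hap fun t => by
        simpa using hb (a + t * Complex.I) (by simpa) (by simpa)).intervalIntegrable
    · exact (continuous_const.mul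
        (Continuous.inv₀ (by fun_prop) hne)).intervalIntegrable _ _
  have hσ := (intervalIntegral_tendsto_integral (integrable_vertical_div hK.continuous hpσ.ne'
    fun t => by simpa using hb (σ + t * Complex.I) (by simp; linarith) (by simp))
    tendsto_neg_atTop_atBot tendsto_id).sub
      ((tendsto_integral_inv_add_mul_I_of_pos (sub_pos.2 hpσ)).const_mul (K p))
  have hc := (intervalIntegral_tendsto_integral (integrable_vertical_div hK.continuous hcp.ne
    fun t => by simpa using hb (c + t * Complex.I) (by simp) (by simp; linarith))
    tendsto_neg_atTop_atBot tendsto_id).sub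
      ((tendsto_integral_inv_add_mul_I_of_neg (sub_neg.2 hcp)).const_mul (K p))
  simp only [id, ← hline hpσ.ne' (by linarith) le_rfl] at hσ
  simp only [id, ← hline hcp.ne le_rfl (by linarith)] at hc
  have hlim := hσ.sub hc
  have hrect : ∀ T : ℝ, (∫ t in (-T)..T, E (σ + t * Complex.I)) -
      ∫ t in (-T)..T, E (c + t * Complex.I) =
        Complex.I * ((∫ x in c..σ, E (x + (-T : ℝ) * Complex.I)) -
          ∫ x in c..σ, E (x + T * Complex.I)) := by
    intro T
    have h := Complex.integral_boundary_rect_eq_zero_of_differentiableOn E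
      ⟨c, -T⟩ ⟨σ, T⟩ (hEd.mono (Set.subset_univ _))
    simp only [smul_eq_mul] at h
    linear_combination (-Complex.I) * h + ((∫ t in (-T)..T, E (σ + t * Complex.I)) -
      ∫ t in (-T)..T, E (c + t * Complex.I)) * Complex.I_sq
  have hhor : ∀ T : ℝ, 0 < T → ∀ y : ℝ, |y| = T →
      ‖∫ x in c..σ, E (x + y * Complex.I)‖ ≤ (C + ‖K p‖) * |σ - c| * T⁻¹ := by
    intro T hT y hy
    have hle : ∀ x ∈ Set.uIoc c σ, ‖E (x + y * Complex.I)‖ ≤ (C + ‖K p‖) * T⁻¹ := by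
      intro x hx
      rw [Set.uIoc_of_le (by linarith)] at hx
      have hy0 : y ≠ 0 := abs_pos.1 (hy ▸ hT)
      have hw : (x : ℂ) + y * Complex.I ≠ p := fun h => hy0 (by
        simpa using congrArg Complex.im h)
      have h1 : T ≤ ‖(x : ℂ) + y * Complex.I - p‖ := by
        rw [← hy]
        simpa using Complex.abs_im_le_norm ((x : ℂ) + y * Complex.I - p)
      have h2 : ‖K (x + y * Complex.I)‖ ≤ C := by
        refine (hb _ (by simpa using hx.1.le) (by simpa using hx.2)).trans ?_
        exact div_le_self hC (by nlinarith [sq_nonneg ((x : ℂ) + y * Complex.I).im])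
      have h3 : E (x + y * Complex.I) =
          (K (x + y * Complex.I) - K p) * ((x : ℂ) + y * Complex.I - p)⁻¹ := by
        rw [hEeq _ hw]
        ring
      rw [h3, norm_mul, norm_inv]
      exact mul_le_mul (norm_sub_le_of_le h2 le_rfl) (inv_anti₀ hT h1) (by positivity)
        (by positivity)
    refine (intervalIntegral.norm_integral_le_of_norm_le_const hle).trans_eq ?_
    ring
  have hzero : Tendsto (fun T : ℝ => (∫ t in (-T)..T, E (σ + t * Complex.I)) -
      ∫ t in (-T)..T, E (c + t * Complex.I)) atTop (𝓝 0) := by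
    have h0 : Tendsto (fun T : ℝ => 2 * ((C + ‖K p‖) * |σ - c| * T⁻¹)) atTop (𝓝 0) := by
      simpa using (tendsto_inv_atTop_zero.const_mul ((C + ‖K p‖) * |σ - c|)).const_mul (2 : ℝ)
    refine squeeze_zero_norm' ?_ h0
    filter_upwards [eventually_gt_atTop 0] with T hT
    rw [hrect, norm_mul, Complex.norm_I, one_mul, two_mul]
    exact norm_sub_le_of_le (hhor T hT (-T) (by rw [abs_neg, abs_of_pos hT]))
      (hhor T hT T (abs_of_pos hT))
  have hfin := tendsto_nhds_unique hlim hzero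
  linear_combination hfin

end ContourShift

section Perron

open scoped Topology

/-- The weight `(1 - u)₊ ^ ρ` of the Riesz means. -/
noncomputable def rieszWeight (ρ u : ℝ) : ℝ := (max (1 - u) 0) ^ ρ

theorem rieszWeight_of_one_le {ρ u : ℝ} (hρ : 0 < ρ) (hu : 1 ≤ u) : rieszWeight ρ u = 0 := by
  rw [rieszWeight, max_eq_right (by linarith), Real.zero_rpow hρ.ne']

theorem continuous_rieszWeight {ρ : ℝ} (hρ : 0 < ρ) : Continuous (rieszWeight ρ) :=
  Continuous.rpow_const (by fun_prop) fun _ => Or.inr hρ.le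

theorem cpow_smul_rieszWeight {ρ : ℝ} {s : ℂ} {t : ℝ} (ht1 : t ≤ 1) :
    (t : ℂ) ^ (s - 1) • ((rieszWeight ρ t : ℝ) : ℂ) =
      (t : ℂ) ^ (s - 1) * (1 - (t : ℂ)) ^ (((ρ : ℂ) + 1) - 1) := by
  rw [rieszWeight, max_eq_left (by linarith), Complex.ofReal_cpow (by linarith), smul_eq_mul,
    add_sub_cancel_right]
  push_cast
  rfl

theorem mellinConvergent_rieszWeight {ρ : ℝ} (hρ : 0 < ρ) {s : ℂ} (hs : 0 < s.re) :
    MellinConvergent (fun u => ((rieszWeight ρ u : ℝ) : ℂ)) s := by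
  have h1 := Complex.betaIntegral_convergent (v := (ρ : ℂ) + 1) hs (by simp; linarith)
  rw [intervalIntegrable_iff_integrableOn_Ioc_of_le zero_le_one] at h1
  rw [MellinConvergent, ← Set.Ioc_union_Ioi_eq_Ioi zero_le_one]
  refine IntegrableOn.union ?_ ?_
  · exact h1.congr_fun (fun t ht => (cpow_smul_rieszWeight ht.2).symm) measurableSet_Ioc
  · refine integrableOn_zero.congr_fun (fun t ht => ?_) measurableSet_Ioi
    simp [rieszWeight_of_one_le hρ (le_of_lt ht)]

theorem mellin_rieszWeight {ρ : ℝ} (hρ : 0 < ρ) {s : ℂ} (hs : 0 < s.re) :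
    mellin (fun u => ((rieszWeight ρ u : ℝ) : ℂ)) s =
      Complex.Gamma (ρ + 1) * (Complex.Gamma s / Complex.Gamma (s + ρ + 1)) := by
  have h0 := mellinConvergent_rieszWeight hρ hs
  rw [MellinConvergent] at h0
  have h2 : ∫ t in Set.Ioi (1 : ℝ), (t : ℂ) ^ (s - 1) • ((rieszWeight ρ t : ℝ) : ℂ) = 0 := by
    refine setIntegral_eq_zero_of_forall_eq_zero fun t ht => ?_
    simp [rieszWeight_of_one_le hρ (le_of_lt ht)]
  have h3 : mellin (fun u => ((rieszWeight ρ u : ℝ) : ℂ)) s =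
      Complex.betaIntegral s ((ρ : ℂ) + 1) := by
    rw [mellin, Complex.betaIntegral, intervalIntegral.integral_of_le zero_le_one,
      ← Set.Ioc_union_Ioi_eq_Ioi zero_le_one, setIntegral_union
        (Set.Ioc_disjoint_Ioi le_rfl) measurableSet_Ioi
        (h0.mono_set Set.Ioc_subset_Ioi_self)
        (h0.mono_set (Set.Ioi_subset_Ioi zero_le_one)), h2, add_zero]
    exact setIntegral_congr_fun measurableSet_Ioc fun t ht => cpow_smul_rieszWeight ht.2
  have h4 := Complex.Gamma_mul_Gamma_eq_betaIntegral hs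
    (show 0 < ((ρ : ℂ) + 1).re by simp; linarith)
  have h5 : Complex.Gamma (s + (ρ + 1)) ≠ 0 :=
    Complex.Gamma_ne_zero_of_re_pos (by simp; linarith)
  rw [h3, add_assoc]
  field_simp
  rw [mul_comm (Complex.Gamma _) (Complex.Gamma s), h4]
  ring

theorem integrable_Gamma_div_Gamma {ρ σ : ℝ} (hρ : 0 < ρ) (hσ : 0 < σ) :
    Integrable fun t : ℝ =>
      Complex.Gamma (σ + t * Complex.I) / Complex.Gamma (σ + t * Complex.I + ρ + 1) := by
  have hne : ∀ t : ℝ, Complex.Gamma (σ + t * Complex.I + ρ + 1) ≠ 0 := fun t =>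
    Complex.Gamma_ne_zero_of_re_pos (by simp; linarith)
  have hcG : ∀ {a : ℝ}, 0 < a → Continuous fun t : ℝ => Complex.Gamma (a + t * Complex.I) := by
    intro a ha
    refine continuous_iff_continuousAt.2 fun t => ?_
    refine ContinuousAt.comp (f := fun t : ℝ => (a : ℂ) + t * Complex.I)
      (Complex.differentiableAt_Gamma _ fun m h => ?_).continuousAt (by fun_prop)
    have h1 := congrArg Complex.re h
    simp at h1
    linarith [(Nat.cast_nonneg m : (0 : ℝ) ≤ m)]
  have hre : ∀ t : ℝ, (σ : ℂ) + t * Complex.I + ρ + 1 =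
      ((σ + ρ + 1 : ℝ) : ℂ) + t * Complex.I := fun t => by
    push_cast
    ring
  have hcont : Continuous fun t : ℝ =>
      Complex.Gamma (σ + t * Complex.I) / Complex.Gamma (σ + t * Complex.I + ρ + 1) := by
    refine (hcG hσ).div ?_ hne
    simp_rw [hre]
    exact hcG (by linarith)
  have hst := (isStirling_Gamma σ).mul (isStirling_Gamma (σ + ρ + 1)).inv
  have hO : (fun t : ℝ => Complex.Gamma (σ + t * Complex.I) /
      Complex.Gamma (σ + t * Complex.I + ρ + 1)) =O[atTop] fun t : ℝ => t ^ (-1 - ρ) := by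
    have h1 : IsStirling (fun t : ℝ => Complex.Gamma (σ + t * Complex.I) /
      Complex.Gamma (σ + t * Complex.I + ρ + 1)) (-1 - ρ) 0 0 := by
      convert hst using 1
      · funext t
        rw [hre, div_eq_mul_inv]
      · ring
      · ring
      · ring
    exact h1.isBigO
  refine LocallyIntegrable.integrable_of_isBigO_atTop_of_norm_isNegInvariant
    hcont.locallyIntegrable (ae_of_all _ fun t => ?_) hO ?_
  · have hconj : ∀ a : ℝ, Complex.Gamma (a + ((-t : ℝ) : ℂ) * Complex.I) =
        (starRingEnd ℂ) (Complex.Gamma (a + t * Complex.I)) := fun a => by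
      rw [← Complex.Gamma_conj]
      congr 1
      simp
    simp only [Function.comp, hre, hconj, norm_div, RCLike.norm_conj]
  · exact integrableAtFilter_rpow_atTop_iff.2 (by linarith)

theorem integral_cpow_mul_Gamma_div_Gamma {ρ σ u : ℝ} (hρ : 0 < ρ) (hσ : 0 < σ) (hu : 0 < u) :
    ∫ t : ℝ, (u : ℂ) ^ (-((σ : ℂ) + t * Complex.I)) *
      (Complex.Gamma (σ + t * Complex.I) / Complex.Gamma (σ + t * Complex.I + ρ + 1)) =
        2 * π * ((rieszWeight ρ u / Real.Gamma (ρ + 1) : ℝ) : ℂ) := by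
  have hre : ∀ t : ℝ, 0 < ((σ : ℂ) + t * Complex.I).re := fun t => by simpa
  have hm : ∀ t : ℝ, mellin (fun u => ((rieszWeight ρ u : ℝ) : ℂ)) (σ + t * Complex.I) =
      Complex.Gamma (ρ + 1) * (Complex.Gamma (σ + t * Complex.I) /
        Complex.Gamma (σ + t * Complex.I + ρ + 1)) := fun t => mellin_rieszWeight hρ (hre t)
  have hv : Complex.VerticalIntegrable (mellin fun u => ((rieszWeight ρ u : ℝ) : ℂ)) σ := by
    simp only [Complex.VerticalIntegrable, hm]
    exact (integrable_Gamma_div_Gamma hρ hσ).const_mul _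
  have h := mellinInv_mellin_eq σ (fun u => ((rieszWeight ρ u : ℝ) : ℂ)) hu
    (mellinConvergent_rieszWeight hρ (by simpa)) hv
    (Complex.continuous_ofReal.comp (continuous_rieszWeight hρ)).continuousAt
  have hG : Complex.Gamma (ρ + 1) ≠ 0 := Complex.Gamma_ne_zero_of_re_pos (by simp; linarith)
  simp only [mellinInv, hm, smul_eq_mul, mul_left_comm _ (Complex.Gamma (ρ + 1)),
    integral_const_mul] at h
  rw [Complex.ofReal_div, ← h, ← Complex.Gamma_ofReal]
  have hπ : (π : ℂ) ≠ 0 := by exact_mod_cast Real.pi_ne_zero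
  push_cast at hG ⊢
  rw [Complex.real_smul]
  push_cast
  rw [mul_div_assoc, mul_div_assoc, mul_div_cancel₀ _ hG, ← mul_assoc,
    mul_one_div_cancel (mul_ne_zero two_ne_zero hπ), one_mul]

/-- Perron's formula for the Riesz means of order `ρ`. -/
theorem integral_perron {ρ σ x : ℝ} (hρ : 0 < ρ) (hσ : 0 < σ) (hx : 0 < x) {a : ℕ → ℂ}
    (ha : Summable fun m : ℕ => ‖a m‖ * (m : ℝ) ^ (-2 * σ)) :
    ∫ t : ℝ, (x : ℂ) ^ (2 * ((σ : ℂ) + t * Complex.I)) *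
      (Complex.Gamma (σ + t * Complex.I) / Complex.Gamma (σ + t * Complex.I + ρ + 1) *
        ∑' m : ℕ, a m * (m : ℂ) ^ (-2 * ((σ : ℂ) + t * Complex.I))) =
      2 * π * ((x ^ (-(2 * ρ)) : ℝ) : ℂ) * ((1 / (Real.Gamma (ρ + 1) : ℂ)) *
        ∑ m ∈ Finset.Icc 1 ⌊x⌋₊, (((x ^ 2 - (m : ℝ) ^ 2) ^ ρ : ℝ) : ℂ) * a m) := by
  set g : ℝ → ℂ := fun t => Complex.Gamma (σ + t * Complex.I) /
    Complex.Gamma (σ + t * Complex.I + ρ + 1) with hg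
  have hgi : Integrable g := integrable_Gamma_div_Gamma hρ hσ
  have hs0 : ∀ t : ℝ, -2 * ((σ : ℂ) + t * Complex.I) ≠ 0 := fun t h => by
    have := congrArg Complex.re h
    simp at this
    linarith
  set F : ℕ → ℝ → ℂ := fun m t => a m *
    ((((m : ℝ) / x) ^ 2 : ℝ) : ℂ) ^ (-((σ : ℂ) + t * Complex.I)) * g t with hF
  have hFterm : ∀ m t, F m t = (x : ℂ) ^ (2 * ((σ : ℂ) + t * Complex.I)) *
      (g t * (a m * (m : ℂ) ^ (-2 * ((σ : ℂ) + t * Complex.I)))) := by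
    intro m t
    rcases Nat.eq_zero_or_pos m with rfl | hm
    · have h1 : -((σ : ℂ) + t * Complex.I) ≠ 0 := fun h => hs0 t (by linear_combination 2 * h)
      have h2 : ((((0 : ℕ) : ℝ) / x) ^ 2 : ℝ) = 0 := by simp
      simp only [hF]
      rw [h2, Complex.ofReal_zero, Nat.cast_zero, Complex.zero_cpow (hs0 t),
        Complex.zero_cpow h1]
      ring
    · have hm' : (0 : ℝ) < m := by exact_mod_cast hm
      have h1 : ((((m : ℝ) / x) ^ 2 : ℝ) : ℂ) ^ (-((σ : ℂ) + t * Complex.I)) =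
          (x : ℂ) ^ (2 * ((σ : ℂ) + t * Complex.I)) *
            (m : ℂ) ^ (-2 * ((σ : ℂ) + t * Complex.I)) := by
        rw [ofReal_cpow_eq_exp (by positivity), ofReal_cpow_eq_exp hx,
          ← Complex.ofReal_natCast m, ofReal_cpow_eq_exp hm', ← Complex.exp_add, Real.log_pow,
          Real.log_div hm'.ne' hx.ne']
        congr 1
        push_cast
        ring
      simp only [hF]
      rw [h1]
      ring
  have hnorm : ∀ m t, ‖F m t‖ = x ^ (2 * σ) * (‖a m‖ * (m : ℝ) ^ (-2 * σ)) * ‖g t‖ := by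
    intro m t
    rw [hFterm]
    simp only [norm_mul]
    rw [Complex.norm_cpow_eq_rpow_re_of_pos hx]
    have h1 : ‖(m : ℂ) ^ (-2 * ((σ : ℂ) + t * Complex.I))‖ = (m : ℝ) ^ (-2 * σ) := by
      rcases Nat.eq_zero_or_pos m with rfl | hm
      · rw [Nat.cast_zero, Complex.zero_cpow (hs0 t), Nat.cast_zero, Real.zero_rpow (by linarith),
          norm_zero]
      · rw [Complex.norm_natCast_cpow_of_pos hm]
        simp
    rw [h1]
    simp
    ring
  have hFi : ∀ m, Integrable (F m) := by
    intro m
    refine Integrable.mono' (hgi.norm.const_mul (x ^ (2 * σ) * (‖a m‖ * (m : ℝ) ^ (-2 * σ)))) ?_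
      (ae_of_all _ fun t => (hnorm m t).le)
    have h1 : Continuous fun t : ℝ => (x : ℂ) ^ (2 * ((σ : ℂ) + t * Complex.I)) :=
      Continuous.const_cpow (by fun_prop) (Or.inl (by exact_mod_cast hx.ne'))
    have h2 : Continuous fun t : ℝ => (m : ℂ) ^ (-2 * ((σ : ℂ) + t * Complex.I)) :=
      Continuous.const_cpow (by fun_prop) (Or.inr hs0)
    have h3 : F m = fun t : ℝ => (x : ℂ) ^ (2 * ((σ : ℂ) + t * Complex.I)) *
      (g t * (a m * (m : ℂ) ^ (-2 * ((σ : ℂ) + t * Complex.I)))) := funext (hFterm m)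
    rw [h3]
    exact h1.aestronglyMeasurable.mul
      (hgi.aestronglyMeasurable.mul (continuous_const.mul h2).aestronglyMeasurable)
  have hFs : Summable fun m => ∫ t, ‖F m t‖ := by
    simp only [hnorm, integral_const_mul]
    exact (ha.mul_left _).mul_right _
  have hL : ∀ t : ℝ, (x : ℂ) ^ (2 * ((σ : ℂ) + t * Complex.I)) * (g t *
      ∑' m : ℕ, a m * (m : ℂ) ^ (-2 * ((σ : ℂ) + t * Complex.I))) = ∑' m, F m t := by
    intro t
    simp only [hFterm, tsum_mul_left]
  have hfint : ∀ m, ∫ t, F m t = if m ∈ Finset.Icc 1 ⌊x⌋₊ then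
      2 * π * ((x ^ (-(2 * ρ)) : ℝ) : ℂ) * ((1 / (Real.Gamma (ρ + 1) : ℂ)) *
        ((((x ^ 2 - (m : ℝ) ^ 2) ^ ρ : ℝ) : ℂ) * a m)) else 0 := by
    intro m
    rcases Nat.eq_zero_or_pos m with rfl | hm
    · have : ∀ t, F 0 t = 0 := fun t => by
        rw [hFterm, Nat.cast_zero, Complex.zero_cpow (hs0 t)]
        ring
      simp [this]
    · have hm' : (0 : ℝ) < m := by exact_mod_cast hm
      simp only [hF, mul_assoc, integral_const_mul]
      rw [hg, integral_cpow_mul_Gamma_div_Gamma hρ hσ (by positivity)]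
      by_cases hmx : (m : ℝ) ≤ x
      · have h1 : m ∈ Finset.Icc 1 ⌊x⌋₊ := Finset.mem_Icc.2 ⟨hm, Nat.le_floor hmx⟩
        rw [if_pos h1]
        have h2 : rieszWeight ρ (((m : ℝ) / x) ^ 2) =
            x ^ (-(2 * ρ)) * (x ^ 2 - (m : ℝ) ^ 2) ^ ρ := by
          have h3 : 0 ≤ x ^ 2 - (m : ℝ) ^ 2 := by nlinarith
          have h4 : 1 - ((m : ℝ) / x) ^ 2 = (x ^ 2 - (m : ℝ) ^ 2) / x ^ 2 := by
            field_simp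
          rw [rieszWeight, h4, max_eq_left (by positivity), Real.div_rpow h3 (by positivity),
            Real.rpow_neg hx.le, Real.rpow_mul hx.le, Real.rpow_two]
          ring
        rw [h2]
        push_cast
        ring
      · have h1 : m ∉ Finset.Icc 1 ⌊x⌋₊ := fun h => hmx
          ((Nat.le_floor_iff hx.le).1 (Finset.mem_Icc.1 h).2)
        rw [if_neg h1, rieszWeight_of_one_le hρ]
        · simp
        · rw [one_le_sq_iff_one_le_abs, abs_of_pos (by positivity), one_le_div hx]
          exact (not_le.1 hmx).le
  calc _ = ∫ t, ∑' m, F m t := integral_congr_ae (ae_of_all _ hL)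
    _ = ∑' m, ∫ t, F m t := (integral_tsum_of_summable_integral_norm hFi hFs).symm
    _ = _ := by
      simp only [hfint]
      rw [tsum_eq_sum (s := Finset.Icc 1 ⌊x⌋₊) fun m hm => if_neg hm, Finset.mul_sum,
        Finset.mul_sum]
      exact Finset.sum_congr rfl fun m hm => if_pos hm

end Perron

section RieszMeans

open scoped Topology

theorem norm_exp_gaussian_phase (δ y t : ℝ) :
    ‖Complex.exp (-δ * (t : ℝ) ^ 2 + (y * t : ℝ) * Complex.I)‖ = Real.exp (-δ * t ^ 2) := by
  rw [Complex.norm_exp]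
  congr 1
  have h1 : (-δ * (t : ℝ) ^ 2 + (y * t : ℝ) * Complex.I : ℂ) =
      ((-δ * t ^ 2 : ℝ) : ℂ) + (y * t : ℝ) * Complex.I := by
    push_cast
    ring
  rw [h1, Complex.add_re, Complex.ofReal_re, Complex.re_ofReal_mul, Complex.I_re, mul_zero,
    add_zero]

theorem IsStirling.exists_norm_le {f : ℝ → ℂ} {γ : ℝ} (hf : IsStirling f (-1 / 2) 0 γ)
    (hc : Continuous f) (hs : ∀ t, f (-t) = (starRingEnd ℂ) (f t)) : ∃ C, ∀ t, ‖f t‖ ≤ C := by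
  obtain ⟨A, hA⟩ := hf.isBigO.bound
  obtain ⟨T, hT⟩ := eventually_atTop.1 (hA.and (eventually_ge_atTop 1))
  obtain ⟨B, hB⟩ := (isCompact_Icc (a := (0 : ℝ)) (b := T)).exists_bound_of_continuousOn
    hc.continuousOn
  have hpos : ∀ t : ℝ, 0 ≤ t → ‖f t‖ ≤ max B |A| := by
    intro t ht
    rcases le_total t T with h | h
    · exact (hB t ⟨ht, h⟩).trans (le_max_left _ _)
    · obtain ⟨h1, h2⟩ := hT t h
      refine (h1.trans ?_).trans (le_max_right _ _)
      have h3 : ‖t ^ (-1 / 2 : ℝ)‖ ≤ 1 := by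
        rw [Real.norm_of_nonneg (Real.rpow_nonneg ht _)]
        exact Real.rpow_le_one_of_one_le_of_nonpos h2 (by norm_num)
      calc A * ‖t ^ (-1 / 2 : ℝ)‖ ≤ |A| * ‖t ^ (-1 / 2 : ℝ)‖ :=
            mul_le_mul_of_nonneg_right (le_abs_self A) (norm_nonneg _)
        _ ≤ |A| := mul_le_of_le_one_right (abs_nonneg A) h3
  refine ⟨max B |A|, fun t => ?_⟩
  rcases le_total 0 t with h | h
  · exact hpos t h
  · have h1 := hpos (-t) (by linarith)
    rwa [hs, RCLike.norm_conj] at h1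

theorem integrable_mul_gaussian_phase {f : ℝ → ℂ} {C : ℝ} (hc : Continuous f)
    (hC : ∀ t, ‖f t‖ ≤ C) {δ : ℝ} (hδ : 0 < δ) (y : ℝ) :
    Integrable fun t : ℝ => f t * Complex.exp (-δ * (t : ℝ) ^ 2 + (y * t : ℝ) * Complex.I) := by
  refine Integrable.mono' ((integrable_exp_neg_mul_sq hδ).const_mul C)
    (Continuous.aestronglyMeasurable (by fun_prop)) (ae_of_all _ fun t => ?_)
  rw [norm_mul, norm_exp_gaussian_phase]
  exact mul_le_mul_of_nonneg_right (hC t) (Real.exp_nonneg _)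

theorem IsStirling.exists_norm_integral_gaussian_le {f : ℝ → ℂ} {γ : ℝ}
    (hf : IsStirling f (-1 / 2) 0 γ) (hγ : γ ≠ 0) (hc : Continuous f)
    (hs : ∀ t, f (-t) = (starRingEnd ℂ) (f t)) :
    ∃ M, ∀ δ y : ℝ, 0 < δ →
      ‖∫ t : ℝ, f t * Complex.exp (-δ * (t : ℝ) ^ 2 + (y * t : ℝ) * Complex.I)‖ ≤ M := by
  obtain ⟨M, hM⟩ := hf.exists_norm_integral_le hγ hc
  obtain ⟨C, hC⟩ := hf.exists_norm_le hc hs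
  refine ⟨M + M, fun δ y hδ => ?_⟩
  set g : ℝ → ℂ := fun t => f t * Complex.exp (-δ * (t : ℝ) ^ 2 + (y * t : ℝ) * Complex.I) with hg
  have hgi : Integrable g := integrable_mul_gaussian_phase hc hC hδ y
  have hgs : ∀ t, g (-t) = (starRingEnd ℂ) (g t) := fun t => by
    simp only [hg, hs, map_mul, ← Complex.exp_conj]
    simp
  have hlim := intervalIntegral_tendsto_integral hgi tendsto_neg_atTop_atBot tendsto_id
  refine le_of_tendsto hlim.norm ?_
  filter_upwards [eventually_ge_atTop 0] with T hT
  have h1 : ∫ t in (-T)..(0 : ℝ), g t = (starRingEnd ℂ) (∫ t in (0 : ℝ)..T, g t) := by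
    have h2 := intervalIntegral.integral_comp_neg (a := 0) (b := T) g
    rw [neg_zero] at h2
    rw [← h2, intervalIntegral.integral_of_le hT, intervalIntegral.integral_of_le hT,
      ← integral_conj]
    simp only [hgs]
  rw [id, ← intervalIntegral.integral_add_adjacent_intervals (b := 0) hgi.intervalIntegrable
    hgi.intervalIntegrable, h1]
  have h3 := hM δ y T hδ.le hT
  refine norm_add_le_of_le ?_ h3
  rw [RCLike.norm_conj]
  exact h3

/-- Gaussian factors dominate the growth of exponential type on vertical lines. -/
theorem exp_mul_abs_mul_exp_neg_le {C δ t : ℝ} (hδ : 0 < δ) :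
    Real.exp (C * |t|) * Real.exp (-δ * t ^ 2) ≤
      2 * Real.exp ((C + 1) ^ 2 / (4 * δ)) / (1 + t ^ 2) := by
  have h1 : 1 + t ^ 2 ≤ 2 * Real.exp |t| := by
    have := Real.quadratic_le_exp_of_nonneg (abs_nonneg t)
    rw [sq_abs] at this
    nlinarith [abs_nonneg t]
  have h2 : (C + 1) * |t| - δ * t ^ 2 ≤ (C + 1) ^ 2 / (4 * δ) := by
    rw [le_div_iff₀ (by positivity), ← sq_abs t]
    nlinarith [sq_nonneg (2 * δ * |t| - (C + 1))]
  rw [le_div_iff₀ (by positivity)]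
  calc _ ≤ Real.exp (C * |t|) * Real.exp (-δ * t ^ 2) * (2 * Real.exp |t|) :=
        mul_le_mul_of_nonneg_left h1 (by positivity)
    _ = 2 * Real.exp ((C + 1) * |t| - δ * t ^ 2) := by
      rw [show (C + 1) * |t| - δ * t ^ 2 = C * |t| + -δ * t ^ 2 + |t| by ring, Real.exp_add,
        Real.exp_add]
      ring
    _ ≤ _ := mul_le_mul_of_nonneg_left (Real.exp_le_exp.2 h2) (by norm_num)

theorem norm_exp_mul_sq (δ : ℝ) (w : ℂ) :
    ‖Complex.exp (δ * w ^ 2)‖ = Real.exp (δ * w.re ^ 2) * Real.exp (-δ * w.im ^ 2) := by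
  rw [Complex.norm_exp, ← Real.exp_add, Complex.re_ofReal_mul]
  congr 1
  rw [sq, Complex.mul_re]
  ring

theorem norm_integral_dual_series_le {c γ M δ x : ℝ} {κ : Type*} [Countable κ] {B : κ → ℂ}
    {l : κ → ℝ} (hl : ∀ k, 0 < l k) (hB : Summable fun k => ‖B k‖ * l k ^ (-(1 / 2 - c)))
    {f : ℝ → ℂ} (hf : IsStirling f (-1 / 2) 0 γ) (hfc : Continuous f)
    (hfs : ∀ t, f (-t) = (starRingEnd ℂ) (f t)) (hδ : 0 < δ) (hx : 0 < x)
    (hM : ∀ δ y : ℝ, 0 < δ →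
      ‖∫ t : ℝ, f t * Complex.exp (-δ * (t : ℝ) ^ 2 + (y * t : ℝ) * Complex.I)‖ ≤ M) :
    ‖∫ t : ℝ, f t * (∑' k, B k * (l k : ℂ) ^ (-(1 / 2 - ((c : ℂ) + t * Complex.I)))) *
      Complex.exp (δ * ((c : ℂ) + t * Complex.I) ^ 2) *
        (x : ℂ) ^ (2 * ((c : ℂ) + t * Complex.I))‖ ≤
      M * (∑' k, ‖B k‖ * l k ^ (-(1 / 2 - c))) * (Real.exp (δ * c ^ 2) * x ^ (2 * c)) := by
  obtain ⟨C, hC⟩ := hf.exists_norm_le hfc hfs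
  set A : κ → ℂ := fun k => B k *
    ((l k ^ (-(1 / 2 - c)) * (Real.exp (δ * c ^ 2) * x ^ (2 * c)) : ℝ) : ℂ) with hA
  set y : κ → ℝ := fun k => Real.log (l k) + 2 * Real.log x + 2 * δ * c with hy
  set g : κ → ℝ → ℂ := fun k t => f t *
    Complex.exp (-δ * (t : ℝ) ^ 2 + (y k * t : ℝ) * Complex.I) with hg
  have hAn : ∀ k, ‖A k‖ = ‖B k‖ * l k ^ (-(1 / 2 - c)) * (Real.exp (δ * c ^ 2) * x ^ (2 * c)) := by
    intro k
    have h1 := Real.rpow_nonneg (hl k).le (-(1 / 2 - c))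
    have h2 := Real.rpow_nonneg hx.le (2 * c)
    simp only [hA]
    rw [norm_mul, Complex.norm_real, Real.norm_of_nonneg (by positivity)]
    ring
  have hAs : Summable fun k => ‖A k‖ := by
    simp only [hAn]
    exact hB.mul_right _
  have hterm : ∀ k (t : ℝ), B k * (l k : ℂ) ^ (-(1 / 2 - ((c : ℂ) + t * Complex.I))) *
      Complex.exp (δ * ((c : ℂ) + t * Complex.I) ^ 2) * (x : ℂ) ^ (2 * ((c : ℂ) + t * Complex.I)) *
        f t = A k * g k t := by
    intro k t
    simp only [hA, hg]
    rw [Real.rpow_def_of_pos (hl k), Real.rpow_def_of_pos hx, ofReal_cpow_eq_exp (hl k),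
      ofReal_cpow_eq_exp hx]
    have h1 : Complex.exp (Real.log (l k) * (-(1 / 2 - ((c : ℂ) + t * Complex.I)))) *
        Complex.exp (δ * ((c : ℂ) + t * Complex.I) ^ 2) *
          Complex.exp (Real.log x * (2 * ((c : ℂ) + t * Complex.I))) =
        ((Real.exp (Real.log (l k) * -(1 / 2 - c)) * (Real.exp (δ * c ^ 2) *
          Real.exp (Real.log x * (2 * c))) : ℝ) : ℂ) *
          Complex.exp (-δ * (t : ℝ) ^ 2 + (y k * t : ℝ) * Complex.I) := by
      push_cast
      simp only [← Complex.exp_add]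
      congr 1
      simp only [hy]
      push_cast
      linear_combination (δ * t ^ 2 : ℂ) * Complex.I_sq
    linear_combination (B k * f t) * h1
  have hgn : ∀ k t, ‖g k t‖ ≤ C * Real.exp (-δ * t ^ 2) := fun k t => by
    simp only [hg]
    rw [norm_mul, norm_exp_gaussian_phase]
    exact mul_le_mul_of_nonneg_right (hC t) (Real.exp_nonneg _)
  have hgi : ∀ k, Integrable (g k) := fun k => integrable_mul_gaussian_phase hfc hC hδ (y k)
  have hswap : ∫ t : ℝ, f t * (∑' k, B k * (l k : ℂ) ^ (-(1 / 2 - ((c : ℂ) + t * Complex.I)))) *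
      Complex.exp (δ * ((c : ℂ) + t * Complex.I) ^ 2) *
        (x : ℂ) ^ (2 * ((c : ℂ) + t * Complex.I)) = ∑' k, ∫ t, A k * g k t := by
    rw [integral_tsum_of_summable_integral_norm]
    · refine integral_congr_ae (ae_of_all _ fun t => ?_)
      dsimp only
      rw [tsum_congr fun k => (hterm k t).symm]
      simp only [tsum_mul_right]
      ring
    · exact fun k => (hgi k).const_mul _
    · simp only [norm_mul, integral_const_mul]
      refine Summable.of_nonneg_of_le (fun k => by positivity) (fun k => ?_)
        (hAs.mul_right (∫ t, C * Real.exp (-δ * t ^ 2)))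
      exact mul_le_mul_of_nonneg_left (integral_mono (hgi k).norm
        ((integrable_exp_neg_mul_sq hδ).const_mul C) (hgn k)) (norm_nonneg _)
  rw [hswap]
  have hle : ∀ k, ‖∫ t, A k * g k t‖ ≤ M * ‖A k‖ := fun k => by
    rw [integral_const_mul, norm_mul, mul_comm]
    exact mul_le_mul_of_nonneg_right (hM δ (y k) hδ) (norm_nonneg _)
  refine (tsum_of_norm_bounded (hAs.mul_left M).hasSum hle).trans_eq ?_
  simp only [hAn]
  rw [tsum_mul_left, tsum_mul_right]
  ring

end RieszMeans

section RieszMeansAsymptotic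

open scoped Topology

theorem norm_mul_gaussian_cpow_le {H : ℂ → ℂ} {c C δ x : ℝ} (hC : 0 ≤ C)
    (hHb : ∀ w : ℂ, c ≤ w.re → w.re ≤ 1 → ‖H w‖ ≤ C * Real.exp (C * |w.im|))
    (hδ : 0 < δ) (hx : 1 ≤ x) {w : ℂ} (h1 : c ≤ w.re) (h2 : w.re ≤ 1) :
    ‖H w * Complex.exp (δ * w ^ 2) * (x : ℂ) ^ (2 * w)‖ ≤
      C * Real.exp (δ * (1 + c ^ 2)) * x ^ (2 : ℝ) *
        (2 * Real.exp ((C + 1) ^ 2 / (4 * δ))) / (1 + w.im ^ 2) := by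
  have hx0 : 0 < x := by linarith
  rw [norm_mul, norm_mul, norm_exp_mul_sq, Complex.norm_cpow_eq_rpow_re_of_pos hx0]
  have h3 : x ^ ((2 * w).re) ≤ x ^ (2 : ℝ) := by
    refine Real.rpow_le_rpow_of_exponent_le hx ?_
    simp
    linarith
  have h4 : Real.exp (δ * w.re ^ 2) ≤ Real.exp (δ * (1 + c ^ 2)) := by
    refine Real.exp_le_exp.2 (mul_le_mul_of_nonneg_left ?_ hδ.le)
    rcases le_total 0 w.re with h | h <;> nlinarith [sq_nonneg c]
  have h5 := exp_mul_abs_mul_exp_neg_le (C := C) (t := w.im) hδ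
  calc ‖H w‖ * (Real.exp (δ * w.re ^ 2) * Real.exp (-δ * w.im ^ 2)) * x ^ ((2 * w).re)
      ≤ C * Real.exp (C * |w.im|) * (Real.exp (δ * (1 + c ^ 2)) * Real.exp (-δ * w.im ^ 2)) *
          x ^ (2 : ℝ) := by
        gcongr
        exact hHb w h1 h2
    _ = C * Real.exp (δ * (1 + c ^ 2)) * x ^ (2 : ℝ) *
          (Real.exp (C * |w.im|) * Real.exp (-δ * w.im ^ 2)) := by ring
    _ ≤ C * Real.exp (δ * (1 + c ^ 2)) * x ^ (2 : ℝ) *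
          (2 * Real.exp ((C + 1) ^ 2 / (4 * δ)) / (1 + w.im ^ 2)) := by
        gcongr
    _ = _ := by ring

/-- Asymptotics of the Riesz means of the coefficients of a Dirichlet series from its functional
equation. -/
theorem isBigO_rieszMean_sub {ρ c γ C : ℝ} (hρ : 0 < ρ) (hc : c < 1 / 2) (hγ : γ ≠ 0)
    {a : ℕ → ℂ} (ha : Summable fun m : ℕ => ‖a m‖ * (m : ℝ) ^ (-2 * (1 : ℝ)))
    {H : ℂ → ℂ} (hH : Differentiable ℂ H)
    (hHb : ∀ w : ℂ, c ≤ w.re → w.re ≤ 1 → ‖H w‖ ≤ C * Real.exp (C * |w.im|))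
    (hHr : ∀ t : ℝ, H (((1 : ℝ) : ℂ) + t * Complex.I) =
      (((1 : ℝ) : ℂ) + t * Complex.I - ((1 / 2 : ℝ) : ℂ)) *
        (Complex.Gamma (((1 : ℝ) : ℂ) + t * Complex.I) /
          Complex.Gamma (((1 : ℝ) : ℂ) + t * Complex.I + ρ + 1) *
            ∑' m : ℕ, a m * (m : ℂ) ^ (-2 * (((1 : ℝ) : ℂ) + t * Complex.I))))
    {κ : Type*} [Countable κ] {B : κ → ℂ} {l : κ → ℝ} (hl : ∀ k, 0 < l k)
    (hB : Summable fun k => ‖B k‖ * l k ^ (-(1 / 2 - c)))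
    {f : ℝ → ℂ} (hf : IsStirling f (-1 / 2) 0 γ) (hfc : Continuous f)
    (hfs : ∀ t, f (-t) = (starRingEnd ℂ) (f t))
    (hHl : ∀ t : ℝ, H ((c : ℂ) + t * Complex.I) =
      ((c : ℂ) + t * Complex.I - ((1 / 2 : ℝ) : ℂ)) *
        (f t * ∑' k, B k * (l k : ℂ) ^ (-(1 / 2 - ((c : ℂ) + t * Complex.I))))) :
    (fun x : ℝ => (1 / (Real.Gamma (ρ + 1) : ℂ)) *
        ∑ m ∈ Finset.Icc 1 ⌊x⌋₊, (((x ^ 2 - (m : ℝ) ^ 2) ^ ρ : ℝ) : ℂ) * a m -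
          H (1 / 2) * ((x ^ (1 + 2 * ρ) : ℝ) : ℂ))
      =O[atTop] fun x : ℝ => x ^ (2 * ρ + 2 * c) := by
  have hC : 0 ≤ C := by
    have h1 := (norm_nonneg _).trans (hHb ((1 : ℝ) : ℂ) (by simp; linarith) (by simp))
    simpa using h1
  obtain ⟨M, hM⟩ := hf.exists_norm_integral_gaussian_le hγ hfc hfs
  set S : ℝ → ℂ := fun x => (1 / (Real.Gamma (ρ + 1) : ℂ)) *
    ∑ m ∈ Finset.Icc 1 ⌊x⌋₊, (((x ^ 2 - (m : ℝ) ^ 2) ^ ρ : ℝ) : ℂ) * a m with hS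
  set b : ℝ := ∑' k, ‖B k‖ * l k ^ (-(1 / 2 - c)) with hb
  have hne : ∀ {s : ℝ}, s ≠ 1 / 2 → ∀ t : ℝ,
      (s : ℂ) + t * Complex.I - ((1 / 2 : ℝ) : ℂ) ≠ 0 := fun {s} hs t h => hs (by
    have h1 := congrArg Complex.re h
    rw [Complex.sub_re, Complex.add_re, Complex.ofReal_re, Complex.re_ofReal_mul, Complex.I_re,
      Complex.ofReal_re, Complex.zero_re] at h1
    linarith)
  have key : ∀ x : ℝ, 1 ≤ x →
      ‖2 * π * ((x ^ (-(2 * ρ)) : ℝ) : ℂ) * S x - 2 * π * (H ((1 / 2 : ℝ) : ℂ) * x)‖ ≤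
        M * b * x ^ (2 * c) := by
    intro x hx
    have hx0 : 0 < x := by linarith
    set P : ℝ → ℂ := fun t => (x : ℂ) ^ (2 * (((1 : ℝ) : ℂ) + t * Complex.I)) *
      (Complex.Gamma (((1 : ℝ) : ℂ) + t * Complex.I) /
        Complex.Gamma (((1 : ℝ) : ℂ) + t * Complex.I + ρ + 1) *
          ∑' m : ℕ, a m * (m : ℂ) ^ (-2 * (((1 : ℝ) : ℂ) + t * Complex.I))) with hP
    have hPeq : ∀ t, P t = H (((1 : ℝ) : ℂ) + t * Complex.I) *
        (x : ℂ) ^ (2 * (((1 : ℝ) : ℂ) + t * Complex.I)) /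
          (((1 : ℝ) : ℂ) + t * Complex.I - ((1 / 2 : ℝ) : ℂ)) := fun t => by
      rw [eq_div_iff (hne (by norm_num) t), hHr]
      simp only [hP]
      ring
    have hPc : Continuous P := by
      rw [funext hPeq]
      refine Continuous.div (Continuous.mul (hH.continuous.comp (by fun_prop)) ?_) (by fun_prop)
        (hne (by norm_num))
      exact Continuous.const_cpow (by fun_prop) (Or.inl (by exact_mod_cast hx0.ne'))
    have hPi : Integrable P := by
      have h1 := (integrable_Gamma_div_Gamma (σ := 1) hρ one_pos).norm.const_mul
        (x ^ (2 : ℝ) * ∑' m : ℕ, ‖a m‖ * (m : ℝ) ^ (-2 * (1 : ℝ)))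
      refine Integrable.mono' h1 hPc.aestronglyMeasurable (ae_of_all _ fun t => ?_)
      simp only [hP]
      rw [norm_mul, norm_mul, Complex.norm_cpow_eq_rpow_re_of_pos hx0]
      have h2 : ((2 * (((1 : ℝ) : ℂ) + t * Complex.I)).re) = 2 := by simp
      have h3 : ‖∑' m : ℕ, a m * (m : ℂ) ^ (-2 * (((1 : ℝ) : ℂ) + t * Complex.I))‖ ≤
          ∑' m : ℕ, ‖a m‖ * (m : ℝ) ^ (-2 * (1 : ℝ)) := by
        refine tsum_of_norm_bounded ha.hasSum fun m => ?_
        rw [norm_mul]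
        refine mul_le_mul_of_nonneg_left ?_ (norm_nonneg _)
        rcases Nat.eq_zero_or_pos m with rfl | hm
        · have h4 : -2 * (((1 : ℝ) : ℂ) + t * Complex.I) ≠ 0 := fun h => by
            have := congrArg Complex.re h
            simp at this
          rw [Nat.cast_zero, Complex.zero_cpow h4, norm_zero, Nat.cast_zero,
            Real.zero_rpow (by norm_num)]
        · rw [Complex.norm_natCast_cpow_of_pos hm]
          simp
      rw [h2]
      have h5 : 0 ≤ x ^ (2 : ℝ) := Real.rpow_nonneg hx0.le _
      calc _ ≤ x ^ (2 : ℝ) * (‖Complex.Gamma (((1 : ℝ) : ℂ) + t * Complex.I) /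
            Complex.Gamma (((1 : ℝ) : ℂ) + t * Complex.I + ρ + 1)‖ *
              ∑' m : ℕ, ‖a m‖ * (m : ℝ) ^ (-2 * (1 : ℝ))) := by gcongr
        _ = _ := by ring
    have hPint : ∫ t, P t = 2 * π * ((x ^ (-(2 * ρ)) : ℝ) : ℂ) * S x :=
      integral_perron hρ one_pos hx0 ha
    have hshift : ∀ δ : ℝ, 0 < δ →
        ‖(∫ t : ℝ, Complex.exp (δ * (((1 : ℝ) : ℂ) + t * Complex.I) ^ 2) * P t) -
          2 * π * (H ((1 / 2 : ℝ) : ℂ) * Complex.exp (δ * ((1 / 2 : ℝ) : ℂ) ^ 2) *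
            (x : ℂ) ^ (2 * ((1 / 2 : ℝ) : ℂ)))‖ ≤
          M * b * (Real.exp (δ * c ^ 2) * x ^ (2 * c)) := by
      intro δ hδ
      set K : ℂ → ℂ := fun w => H w * Complex.exp (δ * w ^ 2) * (x : ℂ) ^ (2 * w) with hK
      have hxd : Differentiable ℂ fun w : ℂ => (x : ℂ) ^ (2 * w) := fun w =>
        DifferentiableAt.const_cpow (by fun_prop) (Or.inl (by exact_mod_cast hx0.ne'))
      have hKd : Differentiable ℂ K := (hH.mul (by fun_prop)).mul hxd
      have h := integral_vertical_sub_eq hKd hc (by norm_num : (1 / 2 : ℝ) < 1) fun w h1 h2 =>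
        norm_mul_gaussian_cpow_le hC hHb hδ hx h1 h2
      have e1 : ∫ t : ℝ, K (((1 : ℝ) : ℂ) + t * Complex.I) /
          (((1 : ℝ) : ℂ) + t * Complex.I - ((1 / 2 : ℝ) : ℂ)) =
          ∫ t : ℝ, Complex.exp (δ * (((1 : ℝ) : ℂ) + t * Complex.I) ^ 2) * P t := by
        refine integral_congr_ae (ae_of_all _ fun t => ?_)
        dsimp only
        rw [hPeq]
        simp only [hK]
        ring
      have e2 : ∫ t : ℝ, K ((c : ℂ) + t * Complex.I) /
          ((c : ℂ) + t * Complex.I - ((1 / 2 : ℝ) : ℂ)) =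
          ∫ t : ℝ, f t * (∑' k, B k * (l k : ℂ) ^ (-(1 / 2 - ((c : ℂ) + t * Complex.I)))) *
            Complex.exp (δ * ((c : ℂ) + t * Complex.I) ^ 2) *
              (x : ℂ) ^ (2 * ((c : ℂ) + t * Complex.I)) := by
        refine integral_congr_ae (ae_of_all _ fun t => ?_)
        dsimp only
        rw [div_eq_iff (hne hc.ne t)]
        simp only [hK]
        rw [hHl]
        ring
      have h3 := norm_integral_dual_series_le hl hB hf hfc hfs hδ hx0 hM
      rw [← e2, ← hb] at h3
      rw [← e1]
      convert h3 using 2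
      simp only [hK] at h ⊢
      linear_combination h
    have hx1 : (x : ℂ) ^ (2 * ((1 / 2 : ℝ) : ℂ)) = x := by
      push_cast
      norm_num
    have hlim1 : Tendsto (fun δ : ℝ =>
        ∫ t : ℝ, Complex.exp (δ * (((1 : ℝ) : ℂ) + t * Complex.I) ^ 2) * P t) (𝓝[>] 0)
          (𝓝 (∫ t, P t)) := by
      refine tendsto_integral_filter_of_dominated_convergence (fun t => Real.exp 1 * ‖P t‖)
        (Eventually.of_forall fun δ => ?_) ?_ (hPi.norm.const_mul _) (ae_of_all _ fun t => ?_)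
      · exact (Continuous.mul (by fun_prop) hPc).aestronglyMeasurable
      · filter_upwards [Ioo_mem_nhdsGT (zero_lt_one' ℝ)] with δ hδ
        refine ae_of_all _ fun t => ?_
        rw [norm_mul, norm_exp_mul_sq]
        refine mul_le_mul_of_nonneg_right ?_ (norm_nonneg _)
        rw [← Real.exp_add]
        refine Real.exp_le_exp.2 ?_
        simp
        nlinarith [hδ.1, hδ.2, mul_nonneg hδ.1.le (sq_nonneg t)]
      · have h1 : Continuous fun δ : ℝ =>
            Complex.exp (δ * (((1 : ℝ) : ℂ) + t * Complex.I) ^ 2) * P t := by fun_prop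
        have h2 := (h1.tendsto 0).mono_left (nhdsWithin_le_nhds (s := Set.Ioi 0))
        simpa only [Complex.ofReal_zero, zero_mul, Complex.exp_zero, one_mul] using h2
    have hlim2 : Tendsto (fun δ : ℝ => 2 * π * (H ((1 / 2 : ℝ) : ℂ) *
        Complex.exp (δ * ((1 / 2 : ℝ) : ℂ) ^ 2) * (x : ℂ) ^ (2 * ((1 / 2 : ℝ) : ℂ)))) (𝓝[>] 0)
          (𝓝 (2 * π * (H ((1 / 2 : ℝ) : ℂ) * x))) := by
      have h1 : Continuous fun δ : ℝ => 2 * π * (H ((1 / 2 : ℝ) : ℂ) *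
        Complex.exp (δ * ((1 / 2 : ℝ) : ℂ) ^ 2) * (x : ℂ) ^ (2 * ((1 / 2 : ℝ) : ℂ))) := by
        fun_prop
      have h2 := (h1.tendsto 0).mono_left (nhdsWithin_le_nhds (s := Set.Ioi 0))
      simpa only [Complex.ofReal_zero, zero_mul, Complex.exp_zero, mul_one, hx1] using h2
    have hlim3 : Tendsto (fun δ : ℝ => M * b * (Real.exp (δ * c ^ 2) * x ^ (2 * c))) (𝓝[>] 0)
          (𝓝 (M * b * x ^ (2 * c))) := by
      have h1 : Continuous fun δ : ℝ => M * b * (Real.exp (δ * c ^ 2) * x ^ (2 * c)) := by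
        fun_prop
      have h2 := (h1.tendsto 0).mono_left (nhdsWithin_le_nhds (s := Set.Ioi 0))
      simpa only [zero_mul, Real.exp_zero, one_mul] using h2
    rw [← hPint]
    refine le_of_tendsto_of_tendsto (hlim1.sub hlim2).norm hlim3 ?_
    filter_upwards [self_mem_nhdsWithin] with δ hδ
    exact hshift δ hδ
  refine IsBigO.of_bound (M * b / (2 * π)) ?_
  filter_upwards [eventually_ge_atTop 1] with x hx
  have hx0 : 0 < x := by linarith
  have h1 := key x hx
  have hp : 0 < x ^ (2 * ρ) := Real.rpow_pos_of_pos hx0 _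
  have h2 : S x - H (1 / 2) * ((x ^ (1 + 2 * ρ) : ℝ) : ℂ) = ((x ^ (2 * ρ) / (2 * π) : ℝ) : ℂ) *
      (2 * π * ((x ^ (-(2 * ρ)) : ℝ) : ℂ) * S x - 2 * π * (H ((1 / 2 : ℝ) : ℂ) * x)) := by
    have hπ : (π : ℂ) ≠ 0 := by exact_mod_cast Real.pi_ne_zero
    have hp' : ((x ^ (2 * ρ) : ℝ) : ℂ) ≠ 0 := by exact_mod_cast hp.ne'
    rw [Real.rpow_neg hx0.le, Real.rpow_add hx0, Real.rpow_one]
    push_cast at hp' ⊢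
    field_simp
  rw [h2, norm_mul, Complex.norm_real, Real.norm_of_nonneg (by positivity),
    Real.norm_of_nonneg (Real.rpow_nonneg hx0.le _), Real.rpow_add hx0]
  calc _ ≤ x ^ (2 * ρ) / (2 * π) * (M * b * x ^ (2 * c)) :=
        mul_le_mul_of_nonneg_left h1 (by positivity)
    _ = _ := by ring

end RieszMeansAsymptotic

section VerticalGrowth

theorem norm_Gamma_le_Gamma_re {z : ℂ} (hz : 0 < z.re) :
    ‖Complex.Gamma z‖ ≤ Real.Gamma z.re := by
  rw [Complex.Gamma_eq_integral hz, Complex.GammaIntegral, Real.Gamma_eq_integral hz]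
  refine (norm_integral_le_integral_norm _).trans_eq ?_
  refine setIntegral_congr_fun measurableSet_Ioi fun x hx => ?_
  rw [norm_mul, Complex.norm_real, Real.norm_of_nonneg (Real.exp_nonneg _),
    Complex.norm_cpow_eq_rpow_re_of_pos hx]
  simp

theorem norm_sin_le_exp (z : ℂ) : ‖Complex.sin z‖ ≤ Real.exp |z.im| := by
  have h1 : ‖Complex.exp (-z * Complex.I)‖ ≤ Real.exp |z.im| := by
    rw [Complex.norm_exp]
    refine Real.exp_le_exp.2 ?_
    simp [le_abs_self]
  have h2 : ‖Complex.exp (z * Complex.I)‖ ≤ Real.exp |z.im| := by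
    rw [Complex.norm_exp]
    refine Real.exp_le_exp.2 ?_
    simp [neg_le_abs]
  rw [Complex.sin, norm_div, norm_mul, Complex.norm_I, mul_one, Complex.norm_ofNat,
    div_le_iff₀ two_pos]
  linarith [norm_sub_le (Complex.exp (-z * Complex.I)) (Complex.exp (z * Complex.I))]

theorem exists_norm_inv_Gamma_le_of_nonpos (a : ℝ) :
    ∃ C, ∀ w : ℂ, a ≤ w.re → w.re ≤ 0 →
      ‖(Complex.Gamma w)⁻¹‖ ≤ C * Real.exp (π * |w.im|) := by
  have hc : ContinuousOn Real.Gamma (Set.Icc 1 (1 - a)) := fun x hx =>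
    (Real.differentiableAt_Gamma fun m h => by
      have h1 := hx.1
      have h2 : (0 : ℝ) ≤ m := Nat.cast_nonneg m
      linarith).continuousAt.continuousWithinAt
  obtain ⟨B, hB⟩ := isCompact_Icc.exists_bound_of_continuousOn hc
  refine ⟨B / π, fun w h1 h2 => ?_⟩
  have hre : 0 < (1 - w).re := by
    simp
    linarith
  have hG : Complex.Gamma (1 - w) ≠ 0 := Complex.Gamma_ne_zero_of_re_pos hre
  have hΓ : ‖Complex.Gamma (1 - w)‖ ≤ B := by
    refine (norm_Gamma_le_Gamma_re hre).trans ((le_abs_self _).trans ?_)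
    refine hB _ ⟨?_, ?_⟩ <;> simp <;> linarith
  have hsin : ‖Complex.sin (π * w)‖ ≤ Real.exp (π * |w.im|) := by
    refine (norm_sin_le_exp _).trans_eq ?_
    rw [Complex.im_ofReal_mul, abs_mul, abs_of_pos Real.pi_pos]
  have hπ : (π : ℂ) ≠ 0 := by exact_mod_cast Real.pi_ne_zero
  have h3 : (Complex.Gamma w)⁻¹ = Complex.Gamma (1 - w) * Complex.sin (π * w) / π := by
    have h4 := Complex.Gamma_mul_Gamma_one_sub w
    by_cases h5 : Complex.sin (π * w) = 0
    · rw [h5, div_zero] at h4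
      rcases mul_eq_zero.1 h4 with h6 | h6
      · rw [h6, h5]
        simp
      · exact absurd h6 hG
    · rw [eq_div_iff h5] at h4
      have h6 : Complex.Gamma w ≠ 0 := fun h => hπ (by rw [← h4, h]; ring)
      rw [eq_div_iff hπ]
      apply mul_left_cancel₀ h6
      rw [← mul_assoc, mul_inv_cancel₀ h6, one_mul]
      linear_combination -h4
  rw [h3, norm_div, norm_mul, Complex.norm_real, Real.norm_of_nonneg Real.pi_pos.le,
    div_mul_eq_mul_div]
  have hB0 : 0 ≤ B := (norm_nonneg _).trans hΓ
  gcongr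

theorem norm_inv_Gamma_le_norm_sub_nat {w : ℂ} (hw : 1 ≤ |w.im|) (k : ℕ) :
    ‖(Complex.Gamma w)⁻¹‖ ≤ ‖(Complex.Gamma (w - k))⁻¹‖ := by
  induction k with
  | zero => simp
  | succ k ih =>
    refine ih.trans ?_
    have h1 : w - k = (w - (k + 1 : ℕ)) + 1 := by
      push_cast
      ring
    have h2 := Complex.one_div_Gamma_eq_self_mul_one_div_Gamma_add_one (w - (k + 1 : ℕ))
    rw [← h1] at h2
    rw [h2, norm_mul]
    refine le_mul_of_one_le_left (norm_nonneg _) ?_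
    refine hw.trans ?_
    simpa using Complex.abs_im_le_norm (w - (k + 1 : ℕ))

/-- The reciprocal of the Gamma function has exponential growth in vertical strips. -/
theorem exists_norm_inv_Gamma_le (a b : ℝ) :
    ∃ C, 0 ≤ C ∧ ∀ w : ℂ, a ≤ w.re → w.re ≤ b →
      ‖(Complex.Gamma w)⁻¹‖ ≤ C * Real.exp (π * |w.im|) := by
  obtain ⟨k, hk⟩ := exists_nat_ge b
  obtain ⟨C₁, h1⟩ := exists_norm_inv_Gamma_le_of_nonpos (a - k)
  obtain ⟨C₂, h2⟩ := (isCompact_Icc (a := a) (b := b)).reProdIm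
    (isCompact_Icc (a := (-1 : ℝ)) (b := 1)) |>.exists_bound_of_continuousOn
      Complex.differentiable_one_div_Gamma.continuous.continuousOn
  refine ⟨max |C₁| |C₂|, by positivity, fun w ha hb => ?_⟩
  rcases le_total |w.im| 1 with h | h
  · have h3 := h2 w ⟨⟨ha, hb⟩, abs_le.1 h⟩
    refine h3.trans (((le_abs_self C₂).trans (le_max_right |C₁| |C₂|)).trans ?_)
    exact le_mul_of_one_le_right (by positivity) (Real.one_le_exp (by positivity))
  · refine (norm_inv_Gamma_le_norm_sub_nat h k).trans ?_
    have h3 := h1 (w - k) (by simp; linarith) (by simp; linarith)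
    refine h3.trans ?_
    simp only [Complex.sub_im, Complex.natCast_im, sub_zero]
    exact mul_le_mul_of_nonneg_right ((le_abs_self _).trans (le_max_left _ _))
      (Real.exp_nonneg _)

/-- The completed `L`-function of an even nonprincipal character is bounded in vertical strips. -/
theorem exists_norm_completedLFunction_le {q : ℕ} [NeZero q] (hq : q ≠ 1)
    {χ : DirichletCharacter ℂ q} (heven : χ.Even) (hnp : χ ≠ 1) (a b : ℝ) :
    ∃ C, 0 ≤ C ∧ ∀ w : ℂ, a ≤ w.re → w.re ≤ b →
      ‖DirichletCharacter.completedLFunction χ w‖ ≤ C := by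
  have h0 : χ 0 = 0 := χ.map_zero' hq
  have hsum : ∑ j, χ j = 0 := χ.sum_eq_zero_of_ne_one hnp
  have heq : ∀ w : ℂ, DirichletCharacter.completedLFunction χ w = (q : ℂ) ^ (-w) *
      ∑ j : ZMod q, χ j *
        ((HurwitzZeta.hurwitzEvenFEPair (ZMod.toAddCircle j)).Λ₀ (w / 2) / 2) := by
    intro w
    rw [DirichletCharacter.completedLFunction, ZMod.completedLFunction_def_even heven.to_fun]
    congr 1
    have h1 : ∑ j : ZMod q, χ j * (1 / (1 - w)) = 0 := by rw [← Finset.sum_mul, hsum, zero_mul]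
    have h2 : ∑ j : ZMod q, χ j * ((if ZMod.toAddCircle j = 0 then 1 else 0) / w) = 0 := by
      refine Finset.sum_eq_zero fun j _ => ?_
      by_cases hj : j = 0
      · rw [hj, h0, zero_mul]
      · rw [if_neg (ZMod.toAddCircle_eq_zero.not.2 hj), zero_div, mul_zero]
    calc _ = ∑ j : ZMod q, χ j *
            ((HurwitzZeta.hurwitzEvenFEPair (ZMod.toAddCircle j)).Λ₀ (w / 2) / 2) -
          ∑ j : ZMod q, χ j * ((if ZMod.toAddCircle j = 0 then 1 else 0) / w) -
            ∑ j : ZMod q, χ j * (1 / (1 - w)) := by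
          rw [← Finset.sum_sub_distrib, ← Finset.sum_sub_distrib]
          refine Finset.sum_congr rfl fun j _ => ?_
          rw [HurwitzZeta.completedHurwitzZetaEven_eq, HurwitzZeta.completedHurwitzZetaEven₀]
          ring
      _ = _ := by rw [h1, h2, sub_zero, sub_zero]
  choose C hC using fun j : ZMod q =>
    (HurwitzZeta.hurwitzEvenFEPair (ZMod.toAddCircle j)).exists_norm_Λ₀_le (a / 2) (b / 2)
  have hq1 : (1 : ℝ) ≤ q := by exact_mod_cast NeZero.one_le
  have hq0 : 0 < q := NeZero.pos q
  refine ⟨(q : ℝ) ^ (-a) * ∑ j : ZMod q, ‖χ j‖ * (|C j| / 2), by positivity, fun w h1 h2 => ?_⟩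
  rw [heq, norm_mul, Complex.norm_natCast_cpow_of_pos hq0]
  refine mul_le_mul ?_ ?_ (norm_nonneg _) (by positivity)
  · exact Real.rpow_le_rpow_of_exponent_le hq1 (by simpa using h1)
  · refine (norm_sum_le _ _).trans (Finset.sum_le_sum fun j _ => ?_)
    rw [norm_mul, norm_div, Complex.norm_ofNat]
    have h3 : (w / 2).re = w.re / 2 := by simp
    have h4 := hC j (w / 2) (by rw [h3]; linarith) (by rw [h3]; linarith)
    have h5 := h4.trans (le_abs_self (C j))
    gcongr

end VerticalGrowth

section GammaQuotient

/-- The quotient of Gamma factors in the functional equation of a product of `n + 1` degree one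
factors, weighted by the kernel of the Riesz means of order `ρ`, on the line `re w = c`. -/
noncomputable def gammaQuotient (n : ℕ) (ρ c t : ℝ) : ℂ :=
  Complex.Gamma (1 / 2 - ((c : ℂ) + t * Complex.I)) ^ (n + 1) *
    (Complex.Gamma ((c : ℂ) + t * Complex.I))⁻¹ ^ n *
      (Complex.Gamma ((c : ℂ) + t * Complex.I + ρ + 1))⁻¹

theorem gammaQuotient_neg (n : ℕ) (ρ c t : ℝ) :
    gammaQuotient n ρ c (-t) = (starRingEnd ℂ) (gammaQuotient n ρ c t) := by
  have h : (starRingEnd ℂ) 2 = 2 := Complex.conj_ofNat 2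
  simp [gammaQuotient, ← Complex.Gamma_conj, h]

theorem continuous_gammaQuotient (n : ℕ) (ρ : ℝ) {c : ℝ} (hc : c < 1 / 2) :
    Continuous (gammaQuotient n ρ c) := by
  have h1 : Continuous fun t : ℝ => Complex.Gamma (1 / 2 - ((c : ℂ) + t * Complex.I)) := by
    refine continuous_iff_continuousAt.2 fun t => ?_
    refine ContinuousAt.comp (f := fun t : ℝ => (1 / 2 : ℂ) - ((c : ℂ) + t * Complex.I))
      (Complex.differentiableAt_Gamma _ fun m h => ?_).continuousAt (by fun_prop)
    have h1 := congrArg Complex.re h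
    simp at h1
    have h2 : (0 : ℝ) ≤ m := Nat.cast_nonneg m
    linarith
  have h2 := Complex.differentiable_one_div_Gamma.continuous
  exact ((h1.pow _).mul ((h2.comp (by fun_prop :
    Continuous fun t : ℝ => (c : ℂ) + t * Complex.I)).pow n)).mul
      (h2.comp (by fun_prop : Continuous fun t : ℝ => (c : ℂ) + t * Complex.I + ρ + 1))

theorem isStirling_gammaQuotient (n : ℕ) (ρ : ℝ) {c : ℝ}
    (hc : 4 * ((n : ℝ) + 1) * c = n - 2 * ρ) :
    IsStirling (gammaQuotient n ρ c) (-1 / 2) 0 (-2 * ((n : ℝ) + 1)) := by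
  have h := ((((isStirling_Gamma (1 / 2 - c)).star).pow (n + 1)).mul
    (((isStirling_Gamma c).inv).pow n)).mul (isStirling_Gamma (c + ρ + 1)).inv
  convert h using 1
  · funext t
    have h1 : (1 / 2 : ℂ) - ((c : ℂ) + t * Complex.I) =
        (starRingEnd ℂ) (((1 / 2 - c : ℝ) : ℂ) + t * Complex.I) := by
      have h2 : (starRingEnd ℂ) 2 = 2 := Complex.conj_ofNat 2
      simp [h2]
      ring
    have h2 : (c : ℂ) + t * Complex.I + ρ + 1 = ((c + ρ + 1 : ℝ) : ℂ) + t * Complex.I := by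
      push_cast
      ring
    rw [gammaQuotient, h1, h2, Complex.Gamma_conj]
  · push_cast
    linarith
  · push_cast
    ring
  · push_cast
    ring

end GammaQuotient

section Kernel

variable {q : ℕ} [NeZero q]

/-- The entire function whose values on vertical lines control the Riesz means of order `ρ` of the
convolution of a Dirichlet character `χ` with the coefficients of a completed zeta function `Ξ` of
degree `m + 1`. -/
noncomputable def rieszKernel (m : ℕ) (ρ : ℝ) (χ : DirichletCharacter ℂ q) (Ξ : ℂ → ℂ) (w : ℂ) :
    ℂ :=
  Ξ w * DirichletCharacter.completedLFunction χ (2 * w) * ((π : ℂ) ^ w) ^ (m + 2) *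
    ((Complex.Gamma (w + 1))⁻¹ * (Complex.Gamma w)⁻¹ ^ m * (Complex.Gamma (w + ρ + 1))⁻¹)

theorem differentiable_rieszKernel (m : ℕ) (ρ : ℝ) {χ : DirichletCharacter ℂ q} (hnp : χ ≠ 1)
    {Ξ : ℂ → ℂ} (hΞ : Differentiable ℂ Ξ) : Differentiable ℂ (rieszKernel m ρ χ Ξ) := by
  have hπ : (π : ℂ) ≠ 0 := by exact_mod_cast Real.pi_ne_zero
  have h2 := Complex.differentiable_one_div_Gamma
  have h1 : Differentiable ℂ fun w : ℂ => (π : ℂ) ^ w := fun w =>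
    (differentiableAt_id.const_cpow (Or.inl hπ))
  exact ((hΞ.mul ((DirichletCharacter.differentiable_completedLFunction hnp).comp
    (by fun_prop : Differentiable ℂ fun w : ℂ => 2 * w))).mul (h1.pow _)).mul
    (((h2.comp (by fun_prop : Differentiable ℂ fun w : ℂ => w + 1)).mul (h2.pow m)).mul
      (h2.comp (by fun_prop : Differentiable ℂ fun w : ℂ => w + ρ + 1)))

theorem exists_norm_rieszKernel_le (m : ℕ) (ρ : ℝ) {χ : DirichletCharacter ℂ q} (hq : q ≠ 1)
    (heven : χ.Even) (hnp : χ ≠ 1) {Ξ : ℂ → ℂ} (a b : ℝ)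
    (hΞ : ∃ C, ∀ w : ℂ, a ≤ w.re → w.re ≤ b → ‖Ξ w‖ ≤ C * (1 + ‖w‖) ^ 2) :
    ∃ C, ∀ w : ℂ, a ≤ w.re → w.re ≤ b →
      ‖rieszKernel m ρ χ Ξ w‖ ≤ C * Real.exp (C * |w.im|) := by
  obtain ⟨C₀, h₀⟩ := hΞ
  obtain ⟨C₁, hC₁, h₁⟩ := exists_norm_completedLFunction_le hq heven hnp (2 * a) (2 * b)
  obtain ⟨C₂, hC₂, h₂⟩ := exists_norm_inv_Gamma_le (a + 1) (b + 1)
  obtain ⟨C₃, hC₃, h₃⟩ := exists_norm_inv_Gamma_le a b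
  obtain ⟨C₄, hC₄, h₄⟩ := exists_norm_inv_Gamma_le (a + ρ + 1) (b + ρ + 1)
  set M : ℝ := |a| + |b|
  set A : ℝ := |C₀| * (1 + M) ^ 2 * C₁ * (π ^ b) ^ (m + 2) * (C₂ * C₃ ^ m * C₄)
  set E : ℝ := 2 + π + m * π + π
  have hA : 0 ≤ A := by positivity
  have hE : 0 ≤ E := by positivity
  refine ⟨max A E, fun w hwa hwb => ?_⟩
  have hre : |w.re| ≤ M := by
    rw [abs_le]
    constructor
    · linarith [neg_abs_le a, abs_nonneg b]
    · linarith [le_abs_self b, abs_nonneg a]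
  have hM : 0 ≤ M := by positivity
  have hw : 1 + ‖w‖ ≤ (1 + M) * Real.exp |w.im| := by
    have h5 := Complex.norm_le_abs_re_add_abs_im w
    have h6 := Real.add_one_le_exp |w.im|
    nlinarith [abs_nonneg w.im]
  have e₀ : ‖Ξ w‖ ≤ |C₀| * (1 + M) ^ 2 * Real.exp (2 * |w.im|) := by
    have h7 : (1 + ‖w‖) ^ 2 ≤ ((1 + M) * Real.exp |w.im|) ^ 2 := by gcongr
    calc ‖Ξ w‖ ≤ C₀ * (1 + ‖w‖) ^ 2 := h₀ w hwa hwb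
      _ ≤ |C₀| * (1 + ‖w‖) ^ 2 := by gcongr; exact le_abs_self _
      _ ≤ |C₀| * ((1 + M) * Real.exp |w.im|) ^ 2 := by gcongr
      _ = _ := by rw [mul_pow, ← Real.exp_nat_mul]; push_cast; ring
  have e₁ : ‖DirichletCharacter.completedLFunction χ (2 * w)‖ ≤ C₁ :=
    h₁ _ (by simpa using hwa) (by simpa using hwb)
  have e₂ : ‖((π : ℂ) ^ w) ^ (m + 2)‖ ≤ (π ^ b) ^ (m + 2) := by
    rw [norm_pow, Complex.norm_cpow_eq_rpow_re_of_pos Real.pi_pos]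
    gcongr
    linarith [Real.pi_gt_three]
  have e₃ : ‖(Complex.Gamma (w + 1))⁻¹‖ ≤ C₂ * Real.exp (π * |w.im|) := by
    simpa using h₂ (w + 1) (by simpa using hwa) (by simpa using hwb)
  have e₄ : ‖(Complex.Gamma w)⁻¹ ^ m‖ ≤ C₃ ^ m * Real.exp (m * π * |w.im|) := by
    rw [norm_pow, mul_assoc (m : ℝ), Real.exp_nat_mul, ← mul_pow]
    gcongr
    exact h₃ w hwa hwb
  have e₅ : ‖(Complex.Gamma (w + ρ + 1))⁻¹‖ ≤ C₄ * Real.exp (π * |w.im|) := by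
    simpa using h₄ (w + ρ + 1) (by simpa using hwa) (by simpa using hwb)
  calc ‖rieszKernel m ρ χ Ξ w‖ ≤ |C₀| * (1 + M) ^ 2 * Real.exp (2 * |w.im|) * C₁ *
        (π ^ b) ^ (m + 2) * (C₂ * Real.exp (π * |w.im|) * (C₃ ^ m * Real.exp (m * π * |w.im|)) *
          (C₄ * Real.exp (π * |w.im|))) := by
        simp only [rieszKernel, norm_mul]
        gcongr
    _ = A * (Real.exp (2 * |w.im|) * Real.exp (π * |w.im|) * Real.exp (m * π * |w.im|) *
          Real.exp (π * |w.im|)) := by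
        simp only [A]
        ring
    _ = A * Real.exp (E * |w.im|) := by
        simp only [← Real.exp_add]
        congr 2
        simp only [E]
        ring
    _ ≤ _ := by
        gcongr
        · exact le_max_left _ _
        · exact le_max_right _ _

theorem rieszKernel_of_half_lt_re (m : ℕ) (ρ : ℝ) {χ : DirichletCharacter ℂ q} (hq : q ≠ 1)
    (heven : χ.Even) {Ξ : ℂ → ℂ} {w Z : ℂ} (hw : 1 / 2 < w.re)
    (hΞ : Ξ w = w * (w - 1 / 2) * (zetaFactor (m + 1) w * Z)) :
    rieszKernel m ρ χ Ξ w = (w - 1 / 2) * (Complex.Gamma w / Complex.Gamma (w + ρ + 1) *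
      (Z * DirichletCharacter.LFunction χ (2 * w))) := by
  have hπ : (π : ℂ) ≠ 0 := by exact_mod_cast Real.pi_ne_zero
  have hw0 : w ≠ 0 := by
    rintro rfl
    norm_num at hw
  have hΓ : Complex.Gamma w ≠ 0 := Complex.Gamma_ne_zero_of_re_pos (by linarith)
  have hπw : (π : ℂ) ^ w ≠ 0 := by simp [Complex.cpow_eq_zero_iff, hπ]
  have h1 : Complex.Gammaℝ (2 * w) ≠ 0 := Complex.Gammaℝ_ne_zero_of_re_pos (by simp; linarith)
  rw [rieszKernel, hΞ, zetaFactor,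
    DirichletCharacter.LFunction_eq_completed_div_gammaFactor χ _ (Or.inr hq),
    heven.gammaFactor_def, Complex.Gamma_add_one w hw0]
  have h2 : Complex.Gammaℝ (2 * w) = ((π : ℂ) ^ w)⁻¹ * Complex.Gamma w := by
    rw [Complex.Gammaℝ_def, ← Complex.cpow_neg]
    congr 2 <;> ring
  have h3 : (Complex.Gamma w) ^ m * (Complex.Gamma w)⁻¹ ^ m = 1 := by
    rw [← mul_pow, mul_inv_cancel₀ hΓ, one_pow]
  rw [h2, Complex.cpow_neg, mul_pow, pow_succ (Complex.Gamma w), pow_succ ((π : ℂ) ^ w) (m + 1),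
    inv_pow, div_eq_mul_inv (Complex.Gamma w)]
  generalize (Complex.Gamma w)⁻¹ ^ m = g at h3 ⊢
  generalize DirichletCharacter.completedLFunction χ (2 * w) = L
  field_simp
  linear_combination (2 * w - 1) * Z * L * (Complex.Gamma (w + ρ + 1))⁻¹ * h3

theorem LFunction_eq_tsum_cpow {χ : DirichletCharacter ℂ q} {z : ℂ} (hz : 1 / 2 < z.re) :
    DirichletCharacter.LFunction χ (2 * z) =
      ∑' j : ℕ, χ ((j + 1 : ℕ) : ZMod q) * (((j + 1 : ℕ) : ℝ) ^ 2 : ℝ) ^ (-z) := by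
  have h1 : 1 < (2 * z).re := by simp; linarith
  rw [DirichletCharacter.LFunction_eq_LSeries χ h1, LSeries,
    (DirichletCharacter.LSeriesSummable_of_one_lt_re χ h1).tsum_eq_zero_add]
  simp only [LSeries.term_zero, zero_add]
  refine tsum_congr fun j => ?_
  have h3 := ofReal_sq_cpow_neg (x := 1) (y := ((j + 1 : ℕ) : ℝ)) one_pos (by positivity) z
  rw [LSeries.term_of_ne_zero (Nat.succ_ne_zero j), div_eq_mul_inv, ← Complex.cpow_neg]
  simp only [one_mul, Complex.ofReal_one, Complex.one_cpow] at h3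
  rw [h3]
  push_cast
  ring_nf

theorem summable_norm_mul_sq_rpow (χ : DirichletCharacter ℂ q) {s : ℝ} (hs : 1 / 2 < s) :
    Summable fun j : ℕ => ‖χ ((j + 1 : ℕ) : ZMod q)‖ * (((j + 1 : ℕ) : ℝ) ^ 2) ^ (-s) := by
  have h1 : Summable fun n : ℕ => (n : ℝ) ^ (-(2 * s)) :=
    Real.summable_nat_rpow.2 (by linarith)
  have h2 := (summable_nat_add_iff 1).2 h1
  refine Summable.of_nonneg_of_le (fun j => by positivity) (fun j => ?_) h2
  rw [← Real.rpow_natCast _ 2, ← Real.rpow_mul (by positivity)]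
  calc _ ≤ 1 * ((j + 1 : ℕ) : ℝ) ^ (((2 : ℕ) : ℝ) * -s) := by
        gcongr
        exact DirichletCharacter.norm_le_one _ _
    _ = _ := by
        rw [one_mul]
        congr 1
        push_cast
        ring

/-- The frequencies of the Dirichlet series dual to `rieszKernel`. -/
noncomputable def dualFreq {κ : Type*} (q m : ℕ) (l : κ → ℝ) (p : κ × ℕ) : ℝ :=
  π ^ (2 * (m + 2)) / (q : ℝ) ^ 2 * (l p.1 * ((p.2 + 1 : ℕ) : ℝ) ^ 2)

/-- The coefficients of the Dirichlet series dual to `rieszKernel`. -/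
noncomputable def dualCoeff {κ : Type*} (m : ℕ) (χ : DirichletCharacter ℂ q) (β : κ → ℂ)
    (p : κ × ℕ) : ℂ :=
  DirichletCharacter.rootNumber χ * (q : ℂ) ^ (-(1 / 2) : ℂ) * ((π : ℂ) ^ (1 / 2 : ℂ)) ^ (m + 2) *
    (β p.1 * χ⁻¹ ((p.2 + 1 : ℕ) : ZMod q))

theorem dualFreq_pos {κ : Type*} (m : ℕ) {l : κ → ℝ} (hl : ∀ k, 0 < l k) (p : κ × ℕ) :
    0 < dualFreq q m l p := by
  have := hl p.1
  have hq : 0 < (q : ℝ) := by exact_mod_cast Nat.pos_of_neZero q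
  unfold dualFreq
  positivity

theorem summable_dualCoeff {κ : Type*} (m : ℕ) (χ : DirichletCharacter ℂ q) {β : κ → ℂ}
    {l : κ → ℝ} (hl : ∀ k, 0 < l k) {s : ℝ} (hs : 1 / 2 < s)
    (hβ : Summable fun k => ‖β k‖ * l k ^ (-s)) :
    Summable fun p => ‖dualCoeff m χ β p‖ * dualFreq q m l p ^ (-s) := by
  have hq : 0 < (q : ℝ) := by exact_mod_cast Nat.pos_of_neZero q
  have h1 := (hβ.mul_of_nonneg (summable_norm_mul_sq_rpow χ⁻¹ hs)
    (fun k => by have := hl k; positivity) (fun j => by positivity)).mul_left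
    (‖DirichletCharacter.rootNumber χ * (q : ℂ) ^ (-(1 / 2) : ℂ) *
      ((π : ℂ) ^ (1 / 2 : ℂ)) ^ (m + 2)‖ * (π ^ (2 * (m + 2)) / (q : ℝ) ^ 2) ^ (-s))
  refine h1.congr fun p => ?_
  have := hl p.1
  rw [dualCoeff, dualFreq, Real.mul_rpow (by positivity) (by positivity),
    Real.mul_rpow (by positivity) (by positivity), norm_mul _ (β p.1 * _),
    norm_mul (β p.1)]
  ring

theorem rieszKernel_of_re_neg (m : ℕ) (ρ : ℝ) {χ : DirichletCharacter ℂ q} (hq : q ≠ 1)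
    (heven : χ.Even) (hprim : χ.IsPrimitive) {κ : Type*} {β : κ → ℂ} {l : κ → ℝ}
    (hl : ∀ k, 0 < l k) {Ξ : ℂ → ℂ} {c t : ℝ} (hc : c < 0)
    (hβ : Summable fun k => ‖β k‖ * l k ^ (-(1 / 2 - c)))
    (hΞ : Ξ ((c : ℂ) + t * Complex.I) = ((c : ℂ) + t * Complex.I) *
      ((c : ℂ) + t * Complex.I - 1 / 2) * (zetaFactor (m + 1) (1 / 2 - ((c : ℂ) + t * Complex.I)) *
        ∑' k, β k * (l k : ℂ) ^ (-(1 / 2 - ((c : ℂ) + t * Complex.I))))) :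
    rieszKernel m ρ χ Ξ ((c : ℂ) + t * Complex.I) = ((c : ℂ) + t * Complex.I - 1 / 2) *
      (gammaQuotient (m + 1) ρ c t * ∑' p, dualCoeff m χ β p *
        (dualFreq q m l p : ℂ) ^ (-(1 / 2 - ((c : ℂ) + t * Complex.I)))) := by
  have hπ : (π : ℂ) ≠ 0 := by exact_mod_cast Real.pi_ne_zero
  have hq0 : 0 < (q : ℝ) := by exact_mod_cast Nat.pos_of_neZero q
  have hqc : (q : ℂ) ≠ 0 := by exact_mod_cast hq0.ne'
  set w : ℂ := (c : ℂ) + t * Complex.I with hwdef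
  set z : ℂ := 1 / 2 - w with hzdef
  have hwre : w.re = c := by simp [hwdef]
  have hzre : z.re = 1 / 2 - c := by simp [hzdef, hwre]
  have hw0 : w ≠ 0 := by
    intro h
    rw [h] at hwre
    simp at hwre
    linarith
  have hz : 1 / 2 < z.re := by rw [hzre]; linarith
  have hL : DirichletCharacter.completedLFunction χ (2 * w) = (q : ℂ) ^ (2 * z - 1 / 2) *
      DirichletCharacter.rootNumber χ * (((π : ℂ) ^ (-z) * Complex.Gamma z) *
        DirichletCharacter.LFunction χ⁻¹ (2 * z)) := by
    have h1 := hprim.completedLFunction_one_sub (2 * z)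
    have h2 : 1 - 2 * z = 2 * w := by rw [hzdef]; ring
    have h3 : Complex.Gammaℝ (2 * z) ≠ 0 :=
      Complex.Gammaℝ_ne_zero_of_re_pos (by simp; linarith)
    have heven' : (χ⁻¹).Even := by
      rw [DirichletCharacter.Even, MulChar.inv_apply]
      rwa [show Ring.inverse (-1 : ZMod q) = -1 from by
        simpa using Ring.inverse_unit (-1 : (ZMod q)ˣ)]
    have h4 : Complex.Gammaℝ (2 * z) = (π : ℂ) ^ (-z) * Complex.Gamma z := by
      rw [Complex.Gammaℝ_def]
      congr 2 <;> ring
    rw [← h2, h1, DirichletCharacter.LFunction_eq_completed_div_gammaFactor χ⁻¹ _ (Or.inr hq),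
      heven'.gammaFactor_def, ← h4]
    field_simp
  have hprod : (∑' k, β k * (l k : ℂ) ^ (-z)) * DirichletCharacter.LFunction χ⁻¹ (2 * z) =
      ∑' p : κ × ℕ, (β p.1 * (l p.1 : ℂ) ^ (-z)) *
        (χ⁻¹ ((p.2 + 1 : ℕ) : ZMod q) * (((p.2 + 1 : ℕ) : ℝ) ^ 2 : ℝ) ^ (-z)) := by
    rw [LFunction_eq_tsum_cpow hz]
    refine tsum_mul_tsum_of_summable_norm (hβ.congr fun k => ?_)
      ((summable_norm_mul_sq_rpow χ⁻¹ hz).congr fun j => ?_)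
    · rw [norm_mul, Complex.norm_cpow_eq_rpow_re_of_pos (hl k), Complex.neg_re, hzre]
    · rw [norm_mul, Complex.norm_cpow_eq_rpow_re_of_pos (by positivity), Complex.neg_re]
  have hterm : ∑' p, dualCoeff m χ β p * (dualFreq q m l p : ℂ) ^ (-z) =
      DirichletCharacter.rootNumber χ * (q : ℂ) ^ (2 * z - 1 / 2) *
        ((π : ℂ) ^ (w - z)) ^ (m + 2) *
        ((∑' k, β k * (l k : ℂ) ^ (-z)) * DirichletCharacter.LFunction χ⁻¹ (2 * z)) := by
    rw [hprod, ← tsum_mul_left]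
    refine tsum_congr fun p => ?_
    have hlp := hl p.1
    have h5 : (((π ^ (2 * (m + 2)) / (q : ℝ) ^ 2 : ℝ)) : ℂ) ^ (-z) =
        ((π : ℂ) ^ (-(2 * z))) ^ (m + 2) * (q : ℂ) ^ (2 * z) := by
      rw [← Complex.ofReal_natCast q, ofReal_cpow_eq_exp (by positivity),
        ofReal_cpow_eq_exp Real.pi_pos, ofReal_cpow_eq_exp hq0, ← Complex.exp_nat_mul,
        ← Complex.exp_add, Real.log_div (by positivity) (by positivity), Real.log_pow, Real.log_pow]
      congr 1
      push_cast
      ring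
    have h6 : w - z = 1 / 2 + -(2 * z) := by rw [hzdef]; ring
    rw [dualFreq, Complex.ofReal_mul, Complex.ofReal_mul (l p.1),
      ← Complex.ofReal_mul (l p.1),
      Complex.mul_cpow_ofReal_nonneg (by positivity) (by positivity), h5, Complex.ofReal_mul,
      Complex.mul_cpow_ofReal_nonneg (by positivity) (by positivity), h6,
      Complex.cpow_add _ _ hπ, mul_pow, sub_eq_neg_add (2 * z), Complex.cpow_add _ _ hqc, dualCoeff]
    ring
  have h7 : (π : ℂ) ^ (w - z) = (π : ℂ) ^ w * (π : ℂ) ^ (-z) := by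
    rw [sub_eq_add_neg, Complex.cpow_add _ _ hπ]
  rw [hterm, h7, rieszKernel, hΞ, hL, zetaFactor, gammaQuotient, Complex.Gamma_add_one w hw0,
    mul_inv]
  rw [← hwdef, ← hzdef]
  clear_value w z
  generalize (Complex.Gamma w)⁻¹ = g
  generalize (Complex.Gamma (w + ρ + 1))⁻¹ = g'
  field_simp
  ring

end Kernel

section LogSine

open HurwitzZeta

theorem sub_mem_slitPlane_of_norm_le_one {z : ℂ} (hz : ‖z‖ ≤ 1) (h1 : z ≠ 1) :
    1 - z ∈ Complex.slitPlane := by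
  refine Or.inl ?_
  rw [Complex.sub_re, Complex.one_re, sub_pos]
  refine lt_of_le_of_ne ((Complex.re_le_norm z).trans hz) fun h => h1 ?_
  have h2 : ‖z‖ ^ 2 = z.re ^ 2 + z.im ^ 2 := by
    rw [← Complex.normSq_eq_norm_sq, Complex.normSq_apply]
    ring
  have h3 : z.im = 0 := by
    have h4 : ‖z‖ ^ 2 ≤ 1 := by nlinarith [norm_nonneg z]
    rw [h] at h2
    nlinarith
  exact Complex.ext h h3

theorem norm_mul_exp_neg {z : ℂ} (hz : ‖z‖ = 1) (t : ℝ) :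
    ‖z * (Real.exp (-t) : ℂ)‖ = Real.exp (-t) := by
  rw [norm_mul, hz, one_mul, Complex.norm_real, Real.norm_of_nonneg (Real.exp_nonneg _)]

theorem mul_exp_neg_ne_one {z : ℂ} (hz : ‖z‖ = 1) (h1 : z ≠ 1) (t : ℝ) :
    z * (Real.exp (-t) : ℂ) ≠ 1 := by
  intro h
  have h2 := norm_mul_exp_neg hz t
  rw [h, norm_one] at h2
  rw [← h2] at h
  exact h1 (by simpa using h)

theorem hasSum_mul_exp_neg {z : ℂ} (hz : ‖z‖ = 1) {t : ℝ} (ht : 0 < t) :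
    HasSum (fun n : ℕ => z ^ (n + 1) * (Real.exp (-((n + 1 : ℕ) : ℝ) * t) : ℂ))
      (z * (Real.exp (-t) : ℂ) / (1 - z * (Real.exp (-t) : ℂ))) := by
  have h1 : ‖z * (Real.exp (-t) : ℂ)‖ < 1 := by
    rw [norm_mul_exp_neg hz]
    exact Real.exp_lt_one_iff.2 (by linarith)
  have h2 := (hasSum_geometric_of_norm_lt_one h1).mul_left (z * (Real.exp (-t) : ℂ))
  rw [div_eq_mul_inv]
  refine h2.congr_fun ?_
  intro n
  rw [← pow_succ', mul_pow, ← Complex.ofReal_pow, ← Real.exp_nat_mul]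
  congr 3
  ring

theorem continuous_mul_exp_div {z : ℂ} (hz : ‖z‖ = 1) (h1 : z ≠ 1) :
    Continuous fun t : ℝ => z * (Real.exp (-t) : ℂ) / (1 - z * (Real.exp (-t) : ℂ)) := by
  refine Continuous.div (by fun_prop) (by fun_prop) fun t => ?_
  exact sub_ne_zero.2 (mul_exp_neg_ne_one hz h1 t).symm

theorem isBigO_mul_exp_div {z : ℂ} (hz : ‖z‖ = 1) (a : ℝ) :
    (fun t : ℝ => z * (Real.exp (-t) : ℂ) / (1 - z * (Real.exp (-t) : ℂ))) =O[atTop]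
      fun t : ℝ => t ^ (-a) := by
  have h1 : (fun t : ℝ => z * (Real.exp (-t) : ℂ) / (1 - z * (Real.exp (-t) : ℂ))) =O[atTop]
      fun t : ℝ => Real.exp (-1 * t) := by
    refine IsBigO.of_bound 2 ?_
    filter_upwards [eventually_ge_atTop 1] with t ht
    have h2 := norm_mul_exp_neg hz t
    have h3 : Real.exp (-t) ≤ 1 / 2 := by
      rw [Real.exp_neg, one_div]
      refine inv_anti₀ two_pos ?_
      linarith [Real.add_one_le_exp t]
    have h4 : 1 / 2 ≤ ‖1 - z * (Real.exp (-t) : ℂ)‖ := by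
      have h5 := norm_sub_norm_le (1 : ℂ) (z * (Real.exp (-t) : ℂ))
      rw [norm_one, h2] at h5
      linarith
    rw [norm_div, h2, neg_one_mul, Real.norm_of_nonneg (Real.exp_nonneg _),
      div_le_iff₀ (by linarith)]
    nlinarith [Real.exp_pos (-t)]
  exact h1.trans (isLittleO_exp_neg_mul_rpow_atTop one_pos (-a)).isBigO

theorem expZeta_one_eq_neg_log {a : ℝ} (ha : (a : UnitAddCircle) ≠ 0)
    (h1 : Complex.exp (2 * π * Complex.I * a) ≠ 1) :
    expZeta a 1 = -Complex.log (1 - Complex.exp (2 * π * Complex.I * a)) := by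
  set z := Complex.exp (2 * π * Complex.I * a) with hzdef
  have hz : ‖z‖ = 1 := by
    rw [hzdef, show 2 * (π : ℂ) * Complex.I * a = ((2 * π * a : ℝ) : ℂ) * Complex.I by
      push_cast; ring, Complex.norm_exp_ofReal_mul_I]
  set F : ℝ → ℂ := fun t => z * (Real.exp (-t) : ℂ) / (1 - z * (Real.exp (-t) : ℂ)) with hF
  have hFc : Continuous F := continuous_mul_exp_div hz h1
  have hF0 : F =O[nhdsWithin 0 (Set.Ioi 0)] fun t : ℝ => t ^ (-(0 : ℝ)) := by
    simp only [neg_zero, Real.rpow_zero]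
    exact (hFc.continuousAt.isBigO_one ℝ).mono nhdsWithin_le_nhds
  have hmel : ∀ s : ℝ, 1 < s → Complex.Gamma s * expZeta a s = mellin F s := by
    intro s hs
    have h2 : Summable fun n : ℕ => ‖z ^ (n + 1)‖ / ((n + 1 : ℕ) : ℝ) ^ (s : ℂ).re := by
      have h3 := (summable_nat_add_iff 1).2 (Real.summable_one_div_nat_rpow.2 hs)
      refine h3.congr fun n => ?_
      rw [norm_pow, hz, one_pow, Complex.ofReal_re]
    have h4 := hasSum_mellin (a := fun n : ℕ => z ^ (n + 1)) (p := fun n : ℕ => ((n + 1 : ℕ) : ℝ))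
      (F := F) (s := s) (fun i => Or.inr (by positivity)) (by simpa using zero_lt_one.trans hs)
      (fun t ht => hasSum_mul_exp_neg hz ht) h2
    have h5 := hasSum_expZeta_of_one_lt_re a (s := s) (by simpa using hs)
    rw [← hasSum_nat_add_iff' 1] at h5
    have h6 := h5.mul_left (Complex.Gamma s)
    have h0 : (s : ℂ) ≠ 0 := by exact_mod_cast (zero_lt_one.trans hs).ne'
    simp only [Finset.sum_range_one, Nat.cast_zero, Complex.zero_cpow h0, div_zero, sub_zero] at h6
    refine h6.unique ?_
    refine h4.congr_fun ?_
    intro n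
    rw [hzdef, ← Complex.exp_nat_mul, mul_div_assoc]
    congr 3
    · ring
  have hdiff : DifferentiableAt ℂ (mellin F) 1 :=
    mellin_differentiableAt_of_isBigO_rpow (a := 2) (b := 0)
      (hFc.locallyIntegrable.locallyIntegrableOn _) (isBigO_mul_exp_div hz 2) (by norm_num) hF0
      (by norm_num)
  have hconv : MellinConvergent F 1 :=
    mellinConvergent_of_isBigO_rpow (a := 2) (b := 0)
      (hFc.locallyIntegrable.locallyIntegrableOn _) (isBigO_mul_exp_div hz 2) (by norm_num) hF0
      (by norm_num)
  have hlim : expZeta a 1 = mellin F 1 := by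
    have hc : Tendsto (fun s : ℝ => (s : ℂ)) (nhdsWithin 1 (Set.Ioi 1)) (nhds 1) := by
      have := (Complex.continuous_ofReal.tendsto 1).mono_left
        (nhdsWithin_le_nhds (s := Set.Ioi (1 : ℝ)))
      simpa using this
    have h2 : Tendsto (fun s : ℝ => Complex.Gamma s * expZeta a s) (nhdsWithin 1 (Set.Ioi 1))
        (nhds (Complex.Gamma 1 * expZeta a 1)) := by
      refine Tendsto.mul ?_ ?_
      · refine (Complex.differentiableAt_Gamma 1 fun m h => ?_).continuousAt.tendsto.comp hc
        have h1 := congrArg Complex.re h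
        simp at h1
        have h2 : (0 : ℝ) ≤ m := Nat.cast_nonneg m
        linarith
      · exact (differentiableAt_expZeta a 1 (Or.inr ha)).continuousAt.tendsto.comp hc
    have h3 := hdiff.continuousAt.tendsto.comp hc
    rw [Complex.Gamma_one, one_mul] at h2
    refine tendsto_nhds_unique h2 (h3.congr' ?_)
    filter_upwards [self_mem_nhdsWithin] with s hs
    exact (hmel s hs).symm
  have hfint : IntegrableOn F (Set.Ioi 0) := by
    have h2 := hconv
    rw [MellinConvergent] at h2
    simpa using h2
  have hderiv : ∀ t ∈ Set.Ici (0 : ℝ),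
      HasDerivAt (fun t : ℝ => Complex.log (1 - z * (Real.exp (-t) : ℂ))) (F t) t := by
    intro t ht
    have h2 : HasDerivAt (fun t : ℝ => 1 - z * (Real.exp (-t) : ℂ))
        (z * (Real.exp (-t) : ℂ)) t := by
      have h3 : HasDerivAt (fun t : ℝ => Real.exp (-t)) (-Real.exp (-t)) t := by
        simpa using (hasDerivAt_neg t).exp
      have h4 := (h3.ofReal_comp.const_mul z).const_sub 1
      convert! h4 using 1
      push_cast
      ring
    refine h2.clog_real ?_
    refine sub_mem_slitPlane_of_norm_le_one ?_ (mul_exp_neg_ne_one hz h1 t)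
    rw [norm_mul_exp_neg hz]
    exact Real.exp_le_one_iff.2 (by simpa using ht)
  have hatTop : Tendsto (fun t : ℝ => Complex.log (1 - z * (Real.exp (-t) : ℂ))) atTop
      (nhds 0) := by
    have h2 : Tendsto (fun t : ℝ => 1 - z * (Real.exp (-t) : ℂ)) atTop (nhds (1 - z * 0)) := by
      refine ((Complex.continuous_ofReal.tendsto 0).comp
        (Real.tendsto_exp_atBot.comp tendsto_neg_atTop_atBot)).const_mul z |>.const_sub 1
    rw [mul_zero, sub_zero] at h2
    have h3 := h2.clog (by simp)
    simpa using h3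
  have hI := integral_Ioi_of_hasDerivAt_of_tendsto' hderiv hfint hatTop
  rw [hlim, mellin]
  simpa using hI

end LogSine

section LValueOne

open HurwitzZeta

variable {q : ℕ} [NeZero q]

theorem ZMod.sum_eq_sum_Ico {M : Type*} [AddCommMonoid M] {f : ZMod q → M} (hf : f 0 = 0) :
    ∑ j, f j = ∑ n ∈ Finset.Ico 1 q, f (n : ZMod q) := by
  have hq : 0 < q := Nat.pos_of_neZero q
  have h1 : ∑ j, f j = ∑ n ∈ Finset.range q, f (n : ZMod q) := by
    refine Finset.sum_bij' (fun j _ => j.val) (fun n _ => (n : ZMod q)) ?_ ?_ ?_ ?_ ?_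
    · exact fun j _ => Finset.mem_range.2 (ZMod.val_lt j)
    · exact fun n _ => Finset.mem_univ _
    · exact fun j _ => ZMod.natCast_zmod_val j
    · exact fun n hn => ZMod.val_cast_of_lt (Finset.mem_range.1 hn)
    · intro j _
      rw [ZMod.natCast_zmod_val]
  rw [h1, Finset.range_eq_Ico, Finset.sum_eq_sum_Ico_succ_bot hq, Nat.cast_zero, hf, zero_add]

theorem stdAddChar_natCast (n : ℕ) :
    ZMod.stdAddChar (n : ZMod q) = Complex.exp (2 * π * Complex.I * n / q) := by
  simpa using ZMod.stdAddChar_coe (N := q) n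

theorem stdAddChar_ne_one {j : ZMod q} (hj : j ≠ 0) : ZMod.stdAddChar j ≠ 1 := fun h =>
  hj (ZMod.injective_stdAddChar (h.trans (AddChar.map_zero_eq_one _).symm))

theorem expZeta_toAddCircle_one {j : ZMod q} (hj : j ≠ 0) :
    expZeta (ZMod.toAddCircle j) 1 = -Complex.log (1 - ZMod.stdAddChar j) := by
  have h1 : ZMod.stdAddChar j = Complex.exp (2 * π * Complex.I * ((j.val / q : ℝ) : ℂ)) := by
    conv_lhs => rw [← ZMod.natCast_zmod_val j]
    rw [stdAddChar_natCast]
    push_cast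
    congr 1
    ring
  have h2 : ((j.val / q : ℝ) : UnitAddCircle) ≠ 0 := by
    rw [← ZMod.toAddCircle_apply]
    simpa using hj
  rw [ZMod.toAddCircle_apply, expZeta_one_eq_neg_log h2 (h1 ▸ stdAddChar_ne_one hj), h1]

theorem log_one_sub_stdAddChar_add {j : ZMod q} (hj : j ≠ 0) :
    Complex.log (1 - ZMod.stdAddChar j) + Complex.log (1 - ZMod.stdAddChar (-j)) =
      2 * (Real.log ‖1 - ZMod.stdAddChar j‖ : ℂ) := by
  have hnorm : ‖(ZMod.stdAddChar j : ℂ)‖ = 1 := by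
    rw [ZMod.stdAddChar_apply, Circle.norm_coe]
  have h1 : (1 : ℂ) - ZMod.stdAddChar (-j) = (starRingEnd ℂ) (1 - ZMod.stdAddChar j) := by
    rw [map_sub, map_one, AddChar.map_neg_eq_inv, Complex.inv_eq_conj hnorm]
  have h2 := sub_mem_slitPlane_of_norm_le_one hnorm.le (stdAddChar_ne_one hj)
  rw [h1, Complex.log_conj _ (Complex.slitPlane_arg_ne_pi h2), Complex.add_conj, Complex.log_re]
  push_cast
  ring

theorem norm_one_sub_stdAddChar {n : ℕ} (hn : n < q) :
    ‖(1 : ℂ) - ZMod.stdAddChar (n : ZMod q)‖ = 2 * Real.sin (π * n / q) := by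
  have hq : 0 < (q : ℝ) := by exact_mod_cast Nat.pos_of_neZero q
  have h2 : 0 ≤ Real.sin (π * n / q) := by
    refine Real.sin_nonneg_of_nonneg_of_le_pi (by positivity) ?_
    rw [div_le_iff₀ hq]
    gcongr
  have h1 := Complex.norm_exp_I_mul_ofReal_sub_one (2 * (π * n / q))
  rw [stdAddChar_natCast, norm_sub_rev]
  rw [mul_div_cancel_left₀ _ two_ne_zero, Real.norm_of_nonneg (by positivity)] at h1
  rw [← h1]
  congr 3
  push_cast
  ring

theorem LFunction_one_eq_sum_log {χ : DirichletCharacter ℂ q} (hq : 1 < q) (heven : χ.Even)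
    (hprim : χ.IsPrimitive) :
    DirichletCharacter.LFunction χ 1 = -(gaussSum' χ / q) * ∑ n ∈ Finset.Ico 1 q,
      (starRingEnd ℂ) (χ (n : ZMod q)) * (Real.log (2 * Real.sin (π * n / q)) : ℂ) := by
  have hq0 : (q : ℂ) ≠ 0 := by exact_mod_cast (zero_lt_one.trans hq).ne'
  have : Fact (1 < q) := ⟨hq⟩
  have hχ0 : χ⁻¹ 0 = 0 := MulChar.map_nonunit _ not_isUnit_zero
  have hG : gaussSum' χ = gaussSum χ ZMod.stdAddChar := by
    rw [gaussSum, ZMod.sum_eq_sum_Ico (by rw [MulChar.map_nonunit _ not_isUnit_zero, zero_mul]),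
      gaussSum']
    exact Finset.sum_congr rfl fun n _ => by rw [stdAddChar_natCast]
  have heven' : ∀ j, χ⁻¹ (-j) = χ⁻¹ j := by
    have h1 : (χ⁻¹).Even := by
      rw [DirichletCharacter.Even, MulChar.inv_apply]
      rwa [show Ring.inverse (-1 : ZMod q) = -1 from by
        simpa using Ring.inverse_unit (-1 : (ZMod q)ˣ)]
    exact h1.eval_neg
  have hdft : ∀ k, ZMod.dft χ k = χ⁻¹ k * gaussSum' χ := fun k => by
    rw [hG, hprim.fourierTransform_eq_inv_mul_gaussSum, heven']
  have h1 := ZMod.LFunction_dft (ZMod.dft χ) (s := 1) (Or.inl (by rw [hdft, hχ0, zero_mul]))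
  have h2 : ZMod.LFunction (ZMod.dft (ZMod.dft χ)) 1 =
      q * DirichletCharacter.LFunction χ 1 := by
    rw [ZMod.dft_dft]
    simp only [heven.eval_neg, smul_eq_mul]
    simp only [DirichletCharacter.LFunction, ZMod.LFunction, mul_assoc, ← Finset.mul_sum]
    ring
  set S := ∑ j : ZMod q, χ⁻¹ j * expZeta (ZMod.toAddCircle j) 1 with hS
  have h3 : (q : ℂ) * DirichletCharacter.LFunction χ 1 = gaussSum' χ * S := by
    rw [← h2, h1, hS, Finset.mul_sum, ← Equiv.sum_comp (Equiv.neg (ZMod q))]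
    refine Finset.sum_congr rfl fun j _ => ?_
    rw [Equiv.neg_apply, neg_neg, hdft, heven']
    ring
  have h4 : S + S = -(2 * ∑ j : ZMod q, χ⁻¹ j * (Real.log ‖1 - ZMod.stdAddChar j‖ : ℂ)) := by
    have h5 : S = ∑ j : ZMod q, χ⁻¹ j * expZeta (ZMod.toAddCircle (-j)) 1 := by
      rw [hS, ← Equiv.sum_comp (Equiv.neg (ZMod q))]
      simp only [Equiv.neg_apply, heven']
    conv_lhs =>
      arg 2
      rw [h5]
    rw [hS, ← Finset.sum_add_distrib, Finset.mul_sum, ← Finset.sum_neg_distrib]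
    refine Finset.sum_congr rfl fun j _ => ?_
    by_cases hj : j = 0
    · simp [hj, hχ0]
    · rw [expZeta_toAddCircle_one hj, expZeta_toAddCircle_one (neg_ne_zero.2 hj)]
      linear_combination -(χ⁻¹ j) * log_one_sub_stdAddChar_add hj
  have h6 : S = -∑ n ∈ Finset.Ico 1 q,
      (starRingEnd ℂ) (χ (n : ZMod q)) * (Real.log (2 * Real.sin (π * n / q)) : ℂ) := by
    have h7 : S = -∑ j : ZMod q, χ⁻¹ j * (Real.log ‖1 - ZMod.stdAddChar j‖ : ℂ) := by
      linear_combination h4 / 2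
    rw [h7, ZMod.sum_eq_sum_Ico (by rw [hχ0, zero_mul])]
    refine congrArg _ (Finset.sum_congr rfl fun n hn => ?_)
    rw [norm_one_sub_stdAddChar (Finset.mem_Ico.1 hn).2, ← MulChar.star_apply']
    rfl
  rw [h6] at h3
  field_simp
  linear_combination h3

end LValueOne

section DirichletSeries

open scoped nonZeroDivisors

variable (K : Type*) [Field K] [NumberField K]

theorem card_absNorm_preimage (n : ℕ) :
    Nat.card ((fun I : (Ideal (𝓞 K))⁰ => Ideal.absNorm (I : Ideal (𝓞 K))) ⁻¹' {n}) =
      idealCount K n := by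
  refine Nat.card_congr
    { toFun := fun I => ⟨I.1.1, nonZeroDivisors.ne_zero I.1.2, I.2⟩
      invFun := fun I => ⟨⟨I.1, mem_nonZeroDivisors_of_ne_zero I.2.1⟩, I.2.2⟩
      left_inv := fun I => rfl
      right_inv := fun I => rfl }

theorem idealCount_zero : idealCount K 0 = 0 := by
  have : IsEmpty {I : Ideal (𝓞 K) // I ≠ ⊥ ∧ Ideal.absNorm I = 0} :=
    ⟨fun I => I.2.1 (Ideal.absNorm_eq_zero_iff.1 I.2.2)⟩
  rw [idealCount, Nat.card_of_isEmpty]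

theorem idealCount_eq_card {n : ℕ} (hn : n ≠ 0) :
    idealCount K n = Nat.card {I : Ideal (𝓞 K) // Ideal.absNorm I = n} := by
  refine Nat.card_congr (Equiv.subtypeEquivRight fun I => ⟨fun h => h.2, fun h => ⟨?_, h⟩⟩)
  rintro rfl
  exact hn (by rw [← h, Ideal.absNorm_bot])

theorem LSeries_idealCount (s : ℂ) :
    LSeries (fun n => (idealCount K n : ℂ)) s = dedekindZeta K s :=
  LSeries_congr (fun {n} hn => by rw [idealCount_eq_card K hn]) s

variable {K}

theorem LSeriesHasSum_idealCount {s : ℂ}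
    (hs : Summable fun I : (Ideal (𝓞 K))⁰ => (Ideal.absNorm (I : Ideal (𝓞 K)) : ℂ) ^ (-s)) :
    LSeriesHasSum (fun n => (idealCount K n : ℂ)) s
      (∑' I : (Ideal (𝓞 K))⁰, (Ideal.absNorm (I : Ideal (𝓞 K)) : ℂ) ^ (-s)) := by
  refine (hs.hasSum.tsum_fiberwise
    (fun I : (Ideal (𝓞 K))⁰ => Ideal.absNorm (I : Ideal (𝓞 K)))).congr_fun fun n => ?_
  have h1 : ∀ I : (fun I : (Ideal (𝓞 K))⁰ => Ideal.absNorm (I : Ideal (𝓞 K))) ⁻¹' {n},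
      (Ideal.absNorm (I.1 : Ideal (𝓞 K)) : ℂ) ^ (-s) = (n : ℂ) ^ (-s) := fun I => by
    rw [show Ideal.absNorm (I.1 : Ideal (𝓞 K)) = n from I.2]
  rw [tsum_congr h1, tsum_const, card_absNorm_preimage, LSeries.term_def]
  split_ifs with h
  · rw [h, idealCount_zero, zero_smul]
  · rw [Complex.cpow_neg, nsmul_eq_mul, div_eq_mul_inv]

theorem summable_absNorm_cpow {s : ℂ}
    (hs : Summable fun I : (Ideal (𝓞 K))⁰ => (Ideal.absNorm (I : Ideal (𝓞 K)) : ℝ) ^ (-s.re)) :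
    Summable fun I : (Ideal (𝓞 K))⁰ => (Ideal.absNorm (I : Ideal (𝓞 K)) : ℂ) ^ (-s) := by
  refine Summable.of_norm (hs.congr fun I => ?_)
  have hI : 0 < Ideal.absNorm (I : Ideal (𝓞 K)) :=
    Nat.pos_of_ne_zero (Ideal.absNorm_eq_zero_iff.not.2 (nonZeroDivisors.ne_zero I.2))
  rw [Complex.norm_natCast_cpow_of_pos hI, Complex.neg_re]

variable {q : ℕ} [NeZero q] (χ : DirichletCharacter ℂ q)

theorem DKchi_eq_convolution :
    DKchi K χ =
      LSeries.convolution (fun n => (idealCount K n : ℂ)) fun n : ℕ => χ (n : ZMod q) := by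
  funext n
  rw [LSeries.convolution_def, DKchi,
    ← Nat.sum_divisorsAntidiagonal (fun a b => (idealCount K a : ℂ) * χ (b : ZMod q))]

theorem DKchi_zero : DKchi K χ 0 = 0 := by
  simp [DKchi]

theorem LSeriesHasSum_DKchi {s : ℂ} (hs1 : 1 < s.re)
    (hs : Summable fun I : (Ideal (𝓞 K))⁰ => (Ideal.absNorm (I : Ideal (𝓞 K)) : ℂ) ^ (-s)) :
    LSeriesHasSum (DKchi K χ) s
      ((∑' I : (Ideal (𝓞 K))⁰, (Ideal.absNorm (I : Ideal (𝓞 K)) : ℂ) ^ (-s)) *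
        DirichletCharacter.LFunction χ s) := by
  rw [DirichletCharacter.LFunction_eq_LSeries χ hs1]
  have h1 := (LSeriesHasSum_idealCount hs).convolution
    (DirichletCharacter.LSeriesSummable_of_one_lt_re χ hs1).LSeriesHasSum
  rwa [DKchi_eq_convolution]

theorem term_DKchi (s : ℂ) (n : ℕ) :
    LSeries.term (DKchi K χ) s n = DKchi K χ n * (n : ℂ) ^ (-s) := by
  rw [LSeries.term_def]
  split_ifs with h
  · rw [h, DKchi_zero, zero_mul]
  · rw [Complex.cpow_neg, div_eq_mul_inv]

theorem tsum_DKchi {s : ℂ} (hs1 : 1 < s.re)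
    (hs : Summable fun I : (Ideal (𝓞 K))⁰ => (Ideal.absNorm (I : Ideal (𝓞 K)) : ℂ) ^ (-s)) :
    ∑' n, DKchi K χ n * (n : ℂ) ^ (-s) =
      (∑' I : (Ideal (𝓞 K))⁰, (Ideal.absNorm (I : Ideal (𝓞 K)) : ℂ) ^ (-s)) *
        DirichletCharacter.LFunction χ s := by
  rw [← (LSeriesHasSum_DKchi χ hs1 hs).tsum_eq]
  exact tsum_congr fun n => (term_DKchi χ s n).symm

theorem summable_norm_DKchi {s : ℝ} (hs1 : 1 < s)
    (hs : Summable fun I : (Ideal (𝓞 K))⁰ => (Ideal.absNorm (I : Ideal (𝓞 K)) : ℝ) ^ (-s)) :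
    Summable fun n : ℕ => ‖DKchi K χ n‖ * (n : ℝ) ^ (-s) := by
  have h1 := (LSeriesHasSum_DKchi χ (s := s) (by simpa using hs1)
    (summable_absNorm_cpow (by simpa using hs))).LSeriesSummable.norm
  refine h1.congr fun n => ?_
  rcases Nat.eq_zero_or_pos n with rfl | hn
  · simp [DKchi_zero]
  · rw [term_DKchi, norm_mul, Complex.norm_natCast_cpow_of_pos hn, Complex.neg_re,
      Complex.ofReal_re]

end DirichletSeries

section RieszMeans

open scoped nonZeroDivisors

universe u

variable {K : Type u} [Field K] [NumberField K] {q : ℕ} [NeZero q]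

theorem dedekindZeta_residue_eq (hc : InfinitePlace.nrComplexPlaces K = 0) :
    dedekindZeta_residue K = dedekindResidue K := by
  rw [dedekindZeta_residue_def, dedekindResidue, hc]
  simp

theorem rieszKernel_half (m : ℕ) (ρ : ℝ) {χ : DirichletCharacter ℂ q} (hq : q ≠ 1)
    (heven : χ.Even) (hnp : χ ≠ 1) (hc : InfinitePlace.nrComplexPlaces K = 0) {Ξ : ℂ → ℂ}
    (hΞd : Differentiable ℂ Ξ)
    (hs : ∀ s : ℝ, 1 / 2 < s → Summable fun I : (Ideal (𝓞 K))⁰ =>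
      (Ideal.absNorm (I : Ideal (𝓞 K)) : ℝ) ^ (-2 * s))
    (hΞ : ∀ w : ℂ, 1 / 2 < w.re → Ξ w = w * (w - 1 / 2) * (zetaFactor (m + 1) w *
      ∑' I : (Ideal (𝓞 K))⁰, (Ideal.absNorm (I : Ideal (𝓞 K)) : ℂ) ^ (-2 * w))) :
    rieszKernel m ρ χ Ξ (1 / 2) = (dedekindResidue K : ℂ) / 2 *
      ((Real.sqrt π : ℂ) / (Real.Gamma (ρ + 3 / 2) : ℂ)) *
        DirichletCharacter.LFunction χ 1 := by
  have hlim : Tendsto (fun s : ℝ => (s : ℂ)) (nhdsWithin 1 (Set.Ioi 1)) (nhds 1) := by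
    have := (Complex.continuous_ofReal.tendsto 1).mono_left
      (nhdsWithin_le_nhds (s := Set.Ioi (1 : ℝ)))
    simpa using this
  have hlim2 : Tendsto (fun s : ℝ => (s : ℂ) / 2) (nhdsWithin 1 (Set.Ioi 1)) (nhds (1 / 2)) :=
    hlim.div_const 2
  have h1 : Tendsto (fun s : ℝ => rieszKernel m ρ χ Ξ ((s : ℂ) / 2)) (nhdsWithin 1 (Set.Ioi 1))
      (nhds (rieszKernel m ρ χ Ξ (1 / 2))) :=
    ((differentiable_rieszKernel m ρ hnp hΞd).continuous.tendsto _).comp hlim2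
  have hΓ : Tendsto (fun s : ℝ => Complex.Gamma ((s : ℂ) / 2)) (nhdsWithin 1 (Set.Ioi 1))
      (nhds (Real.sqrt π : ℂ)) := by
    have h2 : DifferentiableAt ℂ Complex.Gamma (1 / 2) :=
      Complex.differentiableAt_Gamma _ fun k h => by
        have h3 := congrArg Complex.re h
        simp at h3
        have h4 : (0 : ℝ) ≤ k := Nat.cast_nonneg k
        linarith
    have h3 := h2.continuousAt.tendsto.comp hlim2
    rwa [show Complex.Gamma (1 / 2) = (Real.sqrt π : ℂ) by
      rw [← Real.Gamma_one_half_eq, ← Complex.Gamma_ofReal]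
      norm_num] at h3
  have hΓ' : Tendsto (fun s : ℝ => (Complex.Gamma ((s : ℂ) / 2 + ρ + 1))⁻¹)
      (nhdsWithin 1 (Set.Ioi 1)) (nhds (Real.Gamma (ρ + 3 / 2) : ℂ)⁻¹) := by
    have h2 := (Complex.differentiable_one_div_Gamma.continuous.tendsto (1 / 2 + ρ + 1)).comp
      ((hlim2.add_const (ρ : ℂ)).add_const 1)
    rwa [show (1 / 2 + ρ + 1 : ℂ) = ((ρ + 3 / 2 : ℝ) : ℂ) by push_cast; ring,
      Complex.Gamma_ofReal] at h2
  have hL : Tendsto (fun s : ℝ => DirichletCharacter.LFunction χ (s : ℂ))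
      (nhdsWithin 1 (Set.Ioi 1)) (nhds (DirichletCharacter.LFunction χ 1)) :=
    ((DirichletCharacter.differentiable_LFunction hnp).continuous.tendsto 1).comp hlim
  have hZ := tendsto_sub_one_mul_dedekindZeta_nhdsGT K
  rw [dedekindZeta_residue_eq hc] at hZ
  refine tendsto_nhds_unique h1 ((((hZ.div_const 2).mul (hΓ.mul hΓ')).mul hL).congr' ?_)
  filter_upwards [self_mem_nhdsWithin] with s hs1
  have hs1' : 1 < s := hs1
  have hw : 1 / 2 < ((s : ℂ) / 2).re := by
    simp
    linarith
  have hs2 := hs (s / 2) (by linarith)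
  rw [show -2 * (s / 2) = -(s : ℂ).re by rw [Complex.ofReal_re]; ring] at hs2
  have hsum := summable_absNorm_cpow hs2
  rw [rieszKernel_of_half_lt_re m ρ hq heven hw (hΞ _ hw), ← LSeries_idealCount]
  have h5 : (-2 * ((s : ℂ) / 2)) = -s := by ring
  have h6 : (2 * ((s : ℂ) / 2)) = s := by ring
  rw [h5, h6, ← (LSeriesHasSum_idealCount hsum).LSeries_eq, div_eq_mul_inv (Complex.Gamma _)]
  ring

theorem isBigO_rieszMean_DKchi [IsTotallyReal K] {ρ c : ℝ}
    (hρ : (Module.finrank ℚ K : ℝ) / 2 < ρ)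
    (hc : 4 * ((Module.finrank ℚ K : ℝ) + 1) * c = Module.finrank ℚ K - 2 * ρ) (hq : 1 < q)
    {χ : DirichletCharacter ℂ q} (heven : χ.Even) (hnp : χ ≠ 1) (hprim : χ.IsPrimitive) :
    (fun x : ℝ => (1 / (Real.Gamma (ρ + 1) : ℂ)) * ∑ n ∈ Finset.Icc 1 ⌊x⌋₊,
      (((x ^ 2 - (n : ℝ) ^ 2) ^ ρ : ℝ) : ℂ) * DKchi K χ n -
        ((dedekindResidue K : ℂ) / 2 * ((Real.sqrt π : ℂ) / (Real.Gamma (ρ + 3 / 2) : ℂ)) *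
          DirichletCharacter.LFunction χ 1) * ((x ^ (1 + 2 * ρ) : ℝ) : ℂ))
      =O[atTop] fun x : ℝ => x ^ (2 * ρ + 2 * c) := by
  obtain ⟨Ξ, κ, β, l, hΞd, hκ, hl, hβ, hΞb, hs, hΞr, hΞl⟩ := exists_completed_dedekind K
  obtain ⟨m, hm⟩ := Nat.exists_eq_succ_of_ne_zero (Module.finrank_pos (R := ℚ) (M := K)).ne'
  rw [Nat.succ_eq_add_one] at hm
  rw [hm] at hΞr hΞl hρ hc
  have hρ0 : 0 < ρ := lt_of_le_of_lt (by positivity) hρ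
  have hc0 : c < 0 := by
    by_contra! h
    have : 0 ≤ 4 * (((m + 1 : ℕ) : ℝ) + 1) * c := by positivity
    linarith
  have hq1 : q ≠ 1 := hq.ne'
  obtain ⟨C, hC⟩ := exists_norm_rieszKernel_le m ρ hq1 heven hnp c 1 (hΞb c 1)
  have hcomplex : InfinitePlace.nrComplexPlaces K = 0 :=
    nrComplexPlaces_eq_zero_iff.2 inferInstance
  have hhalf := rieszKernel_half m ρ hq1 heven hnp hcomplex hΞd hs hΞr
  have hs2 : Summable fun I : (Ideal (𝓞 K))⁰ =>
      (Ideal.absNorm (I : Ideal (𝓞 K)) : ℝ) ^ (-(2 : ℝ)) := by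
    have h := hs 1 (by norm_num)
    rwa [show (-2 * 1 : ℝ) = -2 by norm_num] at h
  have hsum2 := summable_norm_DKchi χ one_lt_two hs2
  have := isBigO_rieszMean_sub (ρ := ρ) (c := c) (γ := -2 * (((m + 1 : ℕ) : ℝ) + 1)) (C := C)
    (a := DKchi K χ) (H := rieszKernel m ρ χ Ξ) (B := dualCoeff m χ β) (l := dualFreq q m l)
    (f := gammaQuotient (m + 1) ρ c) hρ0 (by linarith)
    (by
      have : (0 : ℝ) < ((m + 1 : ℕ) : ℝ) + 1 := by positivity
      linarith)
    (by rwa [mul_one])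
    (differentiable_rieszKernel m ρ hnp hΞd) hC ?_ (dualFreq_pos m hl)
    (summable_dualCoeff m χ hl (by linarith) (hβ _ (by linarith)))
    (isStirling_gammaQuotient (m + 1) ρ hc) (continuous_gammaQuotient _ _ (by linarith))
    (gammaQuotient_neg _ _ _) ?_
  · rw [← hhalf]
    exact this
  · intro t
    have hw : 1 / 2 < (((1 : ℝ) : ℂ) + t * Complex.I).re := by norm_num
    rw [rieszKernel_of_half_lt_re m ρ hq1 heven hw (hΞr _ hw)]
    have hsum := summable_absNorm_cpow (K := K) (s := 2 * (((1 : ℝ) : ℂ) + t * Complex.I))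
      (by rwa [show -(2 * (((1 : ℝ) : ℂ) + t * Complex.I)).re = -2 by simp])
    have h1 := tsum_DKchi χ (by norm_num) hsum
    simp only [← neg_mul] at h1
    rw [h1]
    norm_num
  · intro t
    have h1 := rieszKernel_of_re_neg m ρ hq1 heven hprim hl hc0 (t := t)
      (hβ (1 / 2 - c) (by linarith)) (hΞl _ (by simpa using hc0))
    rw [h1]
    norm_num

end RieszMeans

theorem statement8 (K : Type*) [Field K] [NumberField K] (r₁ : ℕ) (hr₁ : 1 ≤ r₁)
    (hreal : NumberField.InfinitePlace.nrRealPlaces K = r₁)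
    (hcomplex : NumberField.InfinitePlace.nrComplexPlaces K = 0)
    (q : ℕ) (hq : 1 < q) (χ : DirichletCharacter ℂ q)
    (heven : χ.Even) (hnp : χ ≠ 1) (hprim : χ.IsPrimitive)
    (ρ : ℝ) (hρ : (r₁ : ℝ) / 2 < ρ)
    (θ : ℝ) (hθ : θ = ρ + 1 / 4 - (2 * ρ + 1) / (4 * ((r₁ : ℝ) + 1))) :
    (fun x : ℝ =>
        (1 / (Real.Gamma (ρ + 1) : ℂ)) *
            ∑ n ∈ Finset.Icc 1 ⌊x⌋₊, (((x ^ 2 - (n : ℝ) ^ 2) ^ ρ : ℝ) : ℂ) * DKchi K χ n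
          - (-(gaussSum' χ * (Real.sqrt π : ℂ) * (dedekindResidue K : ℂ)) /
              (2 * (q : ℂ) * (Real.Gamma (ρ + 3 / 2) : ℂ)) * ((x ^ (1 + 2 * ρ) : ℝ) : ℂ) *
              ∑ n ∈ Finset.Ico 1 q,
                (starRingEnd ℂ) (χ (n : ZMod q)) * (Real.log (2 * Real.sin (π * n / q)) : ℂ)))
      =O[atTop] fun x : ℝ => x ^ (2 * θ) := by
  have : NeZero q := ⟨by lia⟩
  have : IsTotallyReal K := nrComplexPlaces_eq_zero_iff.1 hcomplex
  have hr : Module.finrank ℚ K = r₁ := by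
    rw [IsTotallyReal.finrank, ← hreal]
  have h := isBigO_rieszMean_DKchi (K := K) (ρ := ρ)
    (c := 1 / 4 - (2 * ρ + 1) / (4 * ((r₁ : ℝ) + 1))) (by rwa [hr]) (by
      rw [hr]
      field_simp
      ring) hq heven hnp hprim
  have hθ' : 2 * ρ + 2 * (1 / 4 - (2 * ρ + 1) / (4 * ((r₁ : ℝ) + 1))) = 2 * θ := by
    rw [hθ]
    ring
  rw [hθ', LFunction_one_eq_sum_log hq heven hprim] at h
  refine h.congr_left fun x => ?_
  congr 1
  simp only [div_eq_mul_inv, mul_inv]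
  ring
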